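/- Let i ≥ 1 be such that #f_i = 2, and write f_i = {d, d′} with d ≠ d′. Let J and J′ be invariant-factor count functions for d and d′ respectively. Then: (i) for every x ≥ 0, lim_{n→∞} (1/n)·#{1 ≤ m ≤ n : J(m) ≤ x·σ_i·(log log n)^{1/2}} = Φ(x), and for every x < 0 this limit equals 0; (ii) for every x ≥ 0, lim_{n→∞} (1/n)·#{1 ≤ m ≤ n : J(m) + J′(m) ≤ x·σ_i·(log log n)^{1/2}} = Φ(x) − Φ(−x), and for every x < 0 this limit equals 0. -/

import Mathlib

open MeasureTheory ProbabilityTheory Filter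

noncomputable section

/-- A key encoding the lexicographic order on pairs `(φ(q), q)`; this is a valid
encoding on prime powers since every prime power satisfies `q ≤ 2 * φ(q)`. -/
def ppKey (q : ℕ) : ℕ := 2 * Nat.totient q ^ 2 + q

/-- The `n`-th smallest key of a prime power (0-indexed). -/
def ppNthKey (n : ℕ) : ℕ := Nat.nth (fun k => ∃ q : ℕ, IsPrimePow q ∧ ppKey q = k) n

/-- The total φ-sequence `q̃_i` (1-indexed): the enumeration of all prime powers
ordered by nondecreasing totient, with ties broken by increasing size. -/
def qt (i : ℕ) : ℕ := sInf {q : ℕ | IsPrimePow q ∧ ppKey q = ppNthKey (i - 1)}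

/-- `lcm(q̃_1, …, q̃_i)`. -/
def Lseq (i : ℕ) : ℕ := (Finset.Icc 1 i).lcm qt

/-- The universal factor order set `f_i`. -/
def UFO (i : ℕ) : Set ℕ :=
  if Nat.totient (qt i) < Nat.totient (qt (i + 1)) then {Lseq i}
  else {Lseq i, Nat.lcm (Lseq (i - 1)) (qt (i + 1))}

/-- `φ(q̃_i)` as a real number. -/
def phiQ (i : ℕ) : ℝ := (Nat.totient (qt i) : ℝ)

/-- `μ_i = 1/φ(q̃_i) − 1/φ(q̃_{i+1})`. -/
def muSeq (i : ℕ) : ℝ := 1 / phiQ i - 1 / phiQ (i + 1)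

/-- `σ_i = (1/φ(q̃_i) + 1/φ(q̃_{i+1}) − 2/(φ(q̃_i)·φ(q̃_{i+1})))^{1/2}`. -/
def sigSeq (i : ℕ) : ℝ :=
  Real.sqrt (1 / phiQ i + 1 / phiQ (i + 1) - 2 / (phiQ i * phiQ (i + 1)))

/-- `σ_{i;a,b} = (φ(q̃_i)^{−a} + φ(q̃_{i+1})^{−b} − 2/(φ(q̃_i)·φ(q̃_{i+1})))^{1/2}`. -/
def sigAB (i a b : ℕ) : ℝ :=
  Real.sqrt (1 / phiQ i ^ a + 1 / phiQ (i + 1) ^ b - 2 / (phiQ i * phiQ (i + 1)))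

/-- `ν_j = (φ(q̃_j)^{−1}·(1 − φ(q̃_j)^{−1}))^{1/2}`. -/
def nuSeq (j : ℕ) : ℝ := Real.sqrt (1 / phiQ j * (1 - 1 / phiQ j))

/-- `J` is an invariant-factor count function for `d`: whenever `(ℤ/mℤ)ˣ` is isomorphic to
a direct product of cyclic groups `ℤ/λ_1 × ⋯ × ℤ/λ_K` with `1 < λ_1 ∣ λ_2 ∣ ⋯ ∣ λ_K`,
`J m` is the number of indices `j` with `λ_j = d`. -/
def IsInvCount (d : ℕ) (J : ℕ → ℕ) : Prop :=
  ∀ m : ℕ, 1 ≤ m → ∀ K : ℕ, ∀ lam : Fin K → ℕ,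
    (∀ j, 1 < lam j) →
    (∀ j k : Fin K, j ≤ k → lam j ∣ lam k) →
    Nonempty ((ZMod m)ˣ ≃* Multiplicative (∀ j : Fin K, ZMod (lam j))) →
    J m = (Finset.univ.filter fun j : Fin K => lam j = d).card

/-- The number of `m ∈ {1, …, n}` satisfying `P`. -/
def cnt (P : ℕ → Prop) (n : ℕ) : ℕ := {m : ℕ | 1 ≤ m ∧ m ≤ n ∧ P m}.ncard

/-- The average `(1/n)·∑_{m=1}^n J(m)`. -/
def avg (J : ℕ → ℕ) (n : ℕ) : ℝ := (∑ m ∈ Finset.Icc 1 n, (J m : ℝ)) / n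

/-- `log log n`. -/
def LL (n : ℕ) : ℝ := Real.log (Real.log n)

/-- The standard normal cumulative distribution function. -/
def Phi (x : ℝ) : ℝ := (Real.sqrt (2 * Real.pi))⁻¹ * ∫ t in Set.Iic x, Real.exp (-t ^ 2 / 2)

/-- Owen's T-function. -/
def OwenT (h a : ℝ) : ℝ :=
  (2 * Real.pi)⁻¹ * ∫ t in (0:ℝ)..a, Real.exp (-(1 + t ^ 2) * h ^ 2 / 2) / (1 + t ^ 2)

/-- The skew-normal cumulative distribution function with parameter `α`. -/
def PhiSkew (x α : ℝ) : ℝ := Phi x - 2 * OwenT x α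

/-- The standard Gaussian probability measure `γ^k` on `ℝ^k`. -/
def stdGaussian (k : ℕ) : Measure (Fin k → ℝ) :=
  Measure.pi fun _ => gaussianReal 0 1

/-- `ω(m;q,1)`: the number of distinct primes `p ∣ m` with `p ≡ 1 (mod q)`. -/
def omegaQ (m q : ℕ) : ℕ := (m.primeFactors.filter fun p => p % q = 1 % q).card

/-- The correction term `Ē(m;p^α)`. -/
def Ebar (m p α : ℕ) : ℕ :=
  if p ^ α = 2 ∧ 8 ∣ m then 2
  else if p ^ α = 2 ∧ 4 ∣ m ∧ ¬(8 ∣ m) then 1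
  else if p = 2 ∧ 2 ≤ α ∧ 2 ^ (α + 2) ∣ m then 1
  else if p ≠ 2 ∧ p ^ (α + 1) ∣ m then 1
  else 0

/-- `prm(m;q)` for a prime power `q = p^α`: the unique `k` such that `p^k` is the cardinality
of the subgroup `{x ∈ (ℤ/mℤ)ˣ : x^p = 1 and x = y^{p^{α−1}} for some y}` (obtained here as the
`p`-adic valuation of that cardinality; note `p = q.minFac` and `p^{α−1} = q / p`). -/
def prm (m q : ℕ) : ℕ :=
  (Nat.card {x : (ZMod m)ˣ // x ^ q.minFac = 1 ∧ ∃ y : (ZMod m)ˣ, y ^ (q / q.minFac) = x}).factorization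
    q.minFac

/-- `m` is `y`-typical: for all prime powers `q₁, q₂` with `φ(q₁) ≤ y` and `φ(q₁) < φ(q₂)`
one has `prm(m;q₁) > prm(m;q₂)`. -/
def yTypical (y : ℝ) (m : ℕ) : Prop :=
  ∀ q₁ q₂ : ℕ, IsPrimePow q₁ → IsPrimePow q₂ →
    (Nat.totient q₁ : ℝ) ≤ y → Nat.totient q₁ < Nat.totient q₂ →
    prm m q₂ < prm m q₁

/-- The sum of `p ^ (-s)` over primes `p ≡ 1 (mod q)`. -/
def primeZetaOne (q : ℕ) (s : ℝ) : ℝ :=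
  ∑' p : Nat.Primes, if ((p : ℕ) : ZMod q) = 1 then ((p : ℕ) : ℝ) ^ (-s) else 0

lemma hasSum_sum_char_neg_log (q : ℕ) [NeZero q] (p : ℕ) {x : ℝ} (hx0 : 0 ≤ x) (hx1 : x < 1) :
    HasSum (fun k : ℕ => (if (p : ZMod q) ^ k = 1 then (q.totient : ℝ) else 0) * (x ^ k / k))
      (∑ χ : DirichletCharacter ℂ q, (-Complex.log (1 - χ p * (x : ℂ))).re) := by
  have h1 : ∀ χ : DirichletCharacter ℂ q,
      HasSum (fun k : ℕ => ((χ p * (x : ℂ)) ^ k / k)) (-Complex.log (1 - χ p * (x : ℂ))) := by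
    intro χ
    apply Complex.hasSum_taylorSeries_neg_log
    rw [norm_mul, Complex.norm_real, Real.norm_of_nonneg hx0]
    calc _ ≤ 1 * x := by gcongr; exact χ.norm_le_one _
      _ < 1 := by linarith
  have h2 := hasSum_sum (s := Finset.univ) (fun χ (_ : χ ∈ Finset.univ) => h1 χ)
  have h3 := Complex.hasSum_re h2
  rw [Complex.re_sum] at h3
  convert h3 using 2 with k
  have : ∑ χ : DirichletCharacter ℂ q, (χ p * (x : ℂ)) ^ k / k
      = (∑ χ : DirichletCharacter ℂ q, χ ((p : ZMod q) ^ k)) * ((x ^ k / k : ℝ) : ℂ) := by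
    rw [Finset.sum_mul]
    refine Finset.sum_congr rfl fun χ _ => ?_
    rw [map_pow]; push_cast; ring
  rw [this, DirichletCharacter.sum_characters_eq]
  split_ifs
  · rw [← Complex.ofReal_natCast, ← Complex.ofReal_mul, Complex.ofReal_re]
  · simp

lemma neg_log_one_sub_le {x : ℝ} (hx : x ≤ 1 / 2) :
    -Real.log (1 - x) ≤ x + 2 * x ^ 2 := by
  have h := Real.one_sub_inv_le_log_of_pos (show 0 < 1 - x by linarith)
  have : (1 - x)⁻¹ ≤ 1 + x + 2 * x ^ 2 := by
    rw [inv_le_iff_one_le_mul₀ (by linarith)]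
    nlinarith [mul_nonneg (sq_nonneg x) (show 0 ≤ 1 - 2 * x by linarith)]
  linarith

lemma sum_char_neg_log_bounds (q : ℕ) [NeZero q] (p : ℕ) {x : ℝ} (hx0 : 0 ≤ x) (hx1 : x ≤ 1 / 2) :
    (if (p : ZMod q) = 1 then (q.totient : ℝ) else 0) * x
        ≤ ∑ χ : DirichletCharacter ℂ q, (-Complex.log (1 - χ p * (x : ℂ))).re ∧
      ∑ χ : DirichletCharacter ℂ q, (-Complex.log (1 - χ p * (x : ℂ))).re
        ≤ (if (p : ZMod q) = 1 then (q.totient : ℝ) else 0) * x + q.totient * (2 * x ^ 2) := by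
  have hs := hasSum_sum_char_neg_log q p hx0 (by linarith)
  constructor
  · have := le_hasSum hs 1 (fun k _ => by positivity)
    simpa using this
  · have hr : HasSum (fun k : ℕ => x ^ k / k) (-Real.log (1 - x)) := by
      have hc := Complex.hasSum_re (Complex.hasSum_taylorSeries_neg_log (z := (x : ℂ))
        (by rw [Complex.norm_real, Real.norm_of_nonneg hx0]; linarith))
      convert hc using 1
      · ext k
        rw [← Complex.ofReal_pow, ← Complex.ofReal_natCast, ← Complex.ofReal_div,
          Complex.ofReal_re]
      · rw [← Complex.ofReal_one, ← Complex.ofReal_sub, ← Complex.ofReal_log (by linarith)]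
        simp
    have hd := (hr.mul_left (q.totient : ℝ)).sub hs
    have := le_hasSum hd 1 (fun k _ => by
      have : 0 ≤ x ^ k / k := by positivity
      split_ifs
      · simp
      · simp; positivity)
    have h3 := mul_le_mul_of_nonneg_left (neg_log_one_sub_le hx1)
      (show (0:ℝ) ≤ q.totient by positivity)
    simp only [pow_one, Nat.cast_one, div_one] at this
    linarith

lemma summable_primes_rpow_neg {s : ℝ} (hs : 1 < s) :
    Summable fun p : Nat.Primes => ((p : ℕ) : ℝ) ^ (-s) :=
  (Real.summable_nat_rpow.2 (by linarith)).comp_injective Subtype.val_injective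

lemma summable_primeZetaOne (q : ℕ) {s : ℝ} (hs : 1 < s) :
    Summable fun p : Nat.Primes => if ((p : ℕ) : ZMod q) = 1 then ((p : ℕ) : ℝ) ^ (-s) else 0 := by
  refine Summable.of_nonneg_of_le (fun p => by positivity) (fun p => ?_)
    (summable_primes_rpow_neg hs)
  split_ifs
  · exact le_rfl
  · positivity

lemma prime_rpow_neg_le_half (p : Nat.Primes) {s : ℝ} (hs : 1 ≤ s) :
    ((p : ℕ) : ℝ) ^ (-s) ≤ 1 / 2 := by
  have h2 : (2 : ℝ) ≤ (p : ℕ) := by exact_mod_cast p.2.two_le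
  calc ((p : ℕ) : ℝ) ^ (-s) ≤ ((p : ℕ) : ℝ) ^ (-1 : ℝ) :=
        Real.rpow_le_rpow_of_exponent_le (by linarith) (by linarith)
    _ = 1 / ((p : ℕ) : ℝ) := by rw [Real.rpow_neg_one]; simp
    _ ≤ 1 / 2 := by gcongr

lemma log_norm_LSeries_char (q : ℕ) [NeZero q] (χ : DirichletCharacter ℂ q) {s : ℝ} (hs : 1 < s) :
    HasSum (fun p : Nat.Primes =>
      (-Complex.log (1 - χ (p : ℕ) * ((((p : ℕ) : ℝ) ^ (-s) : ℝ) : ℂ))).re)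
      (Real.log ‖LSeries (fun n => χ n) (s : ℂ)‖) := by
  have hs' : 1 < (s : ℂ).re := by simpa using hs
  have e : ∀ p : Nat.Primes, ((((p : ℕ) : ℝ) ^ (-s) : ℝ) : ℂ) = ((p : ℕ) : ℂ) ^ (-(s : ℂ)) := by
    intro p
    rw [Complex.ofReal_cpow (by positivity)]; simp
  simp_rw [e]
  rw [← DirichletCharacter.LSeries_eulerProduct_exp_log χ hs', Complex.norm_exp, Real.log_exp]
  exact Complex.hasSum_re
    (DirichletCharacter.summable_neg_log_one_sub_mul_prime_cpow χ hs').hasSum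

/-- Orthogonality of characters applied to `∑ χ, log ‖L(s, χ)‖`. -/
lemma sum_log_norm_LSeries_bounds : ∃ K : ℝ, ∀ (q : ℕ) [NeZero q] (s : ℝ), 1 < s →
    q.totient * primeZetaOne q s ≤
        ∑ χ : DirichletCharacter ℂ q, Real.log ‖LSeries (fun n => χ n) (s : ℂ)‖ ∧
      ∑ χ : DirichletCharacter ℂ q, Real.log ‖LSeries (fun n => χ n) (s : ℂ)‖ ≤
        q.totient * (primeZetaOne q s + K) := by
  have hK : Summable fun p : Nat.Primes => 2 * ((p : ℕ) : ℝ) ^ (-(2:ℝ)) :=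
    (summable_primes_rpow_neg one_lt_two).mul_left 2
  refine ⟨∑' p : Nat.Primes, 2 * ((p : ℕ) : ℝ) ^ (-(2:ℝ)), fun q _ s hs => ?_⟩
  have hsum := hasSum_sum (s := Finset.univ)
    (fun χ (_ : χ ∈ Finset.univ) => log_norm_LSeries_char q χ hs)
  have hP := (summable_primeZetaOne q hs).hasSum
  have hb := fun p : Nat.Primes => sum_char_neg_log_bounds q p
    (x := ((p : ℕ) : ℝ) ^ (-s)) (by positivity) (prime_rpow_neg_le_half p hs.le)
  constructor
  · refine hasSum_le (fun p => ?_) (hP.mul_left (q.totient : ℝ)) hsum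
    refine le_trans (le_of_eq ?_) (hb p).1
    split_ifs <;> simp
  · refine hasSum_le (fun p => ?_) hsum ((hP.add hK.hasSum).mul_left (q.totient : ℝ))
    refine (hb p).2.trans ?_
    have h2 : (((p : ℕ) : ℝ) ^ (-s)) ^ 2 ≤ ((p : ℕ) : ℝ) ^ (-(2:ℝ)) := by
      rw [← Real.rpow_natCast, ← Real.rpow_mul (by positivity)]
      apply Real.rpow_le_rpow_of_exponent_le
      · exact_mod_cast p.2.one_lt.le
      · push_cast; linarith
    have h3 : (q.totient : ℝ) * (2 * (((p : ℕ) : ℝ) ^ (-s)) ^ 2) ≤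
      q.totient * (2 * ((p : ℕ) : ℝ) ^ (-(2:ℝ))) := by gcongr
    rw [mul_add]
    refine add_le_add (le_of_eq ?_) h3
    split_ifs <;> simp

open Classical in
/-- `L(s, χ)` with its pole at `s = 1` removed. -/
def regL (q : ℕ) [NeZero q] (χ : DirichletCharacter ℂ q) (s : ℂ) : ℂ :=
  if χ = 1 then DirichletCharacter.LFunctionTrivChar₁ q s else DirichletCharacter.LFunction χ s

lemma regL_bounded (q : ℕ) [NeZero q] (χ : DirichletCharacter ℂ q) :
    ∃ C : ℝ, ∀ s : ℝ, s ∈ Set.Icc (1 : ℝ) 2 → |Real.log ‖regL q χ s‖| ≤ C := by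
  have hc : Continuous (regL q χ) := by
    unfold regL
    split_ifs with h
    · exact (DirichletCharacter.differentiable_LFunctionTrivChar₁ q).continuous
    · exact (DirichletCharacter.differentiable_LFunction h).continuous
  have hne : ∀ s : ℝ, s ∈ Set.Icc (1 : ℝ) 2 → regL q χ s ≠ 0 := by
    intro s hs
    have hre : 1 ≤ (s : ℂ).re := by simpa using hs.1
    unfold regL
    split_ifs with h
    · rcases eq_or_ne s 1 with rfl | h1
      · simpa using DirichletCharacter.LFunctionTrivChar₁_apply_one_ne_zero q
      · have h1' : (s : ℂ) ≠ 1 := by exact_mod_cast h1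
        rw [DirichletCharacter.LFunctionTrivChar₁, Function.update_of_ne h1']
        exact mul_ne_zero (sub_ne_zero.2 h1')
          (DirichletCharacter.LFunction_ne_zero_of_one_le_re 1 (.inr h1') hre)
    · exact DirichletCharacter.LFunction_ne_zero_of_one_le_re χ (.inl h) hre
  have hco : ContinuousOn (fun s : ℝ => Real.log ‖regL q χ s‖) (Set.Icc 1 2) := by
    refine ContinuousOn.log ?_ fun s hs => norm_ne_zero_iff.2 (hne s hs)
    exact (hc.comp Complex.continuous_ofReal).norm.continuousOn
  obtain ⟨C, hC⟩ := isCompact_Icc.exists_bound_of_continuousOn hco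
  exact ⟨C, fun s hs => by simpa using hC s hs⟩

lemma log_norm_LSeries_eq (q : ℕ) [NeZero q] (χ : DirichletCharacter ℂ q) {s : ℝ}
    (hs : 1 < s) [Decidable (χ = 1)] :
    Real.log ‖LSeries (fun n => χ n) (s : ℂ)‖ =
      (if χ = 1 then Real.log (1 / (s - 1)) else 0) + Real.log ‖regL q χ s‖ := by
  have hs' : 1 < (s : ℂ).re := by simpa using hs
  have h1' : (s : ℂ) ≠ 1 := by exact_mod_cast hs.ne'
  rw [← DirichletCharacter.LFunction_eq_LSeries χ hs']
  unfold regL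
  split_ifs with h
  · subst h
    rw [DirichletCharacter.LFunctionTrivChar₁, Function.update_of_ne h1', norm_mul,
      Real.log_mul (by simpa using sub_ne_zero.2 h1')
        (norm_ne_zero_iff.2
          (DirichletCharacter.LFunction_ne_zero_of_one_le_re 1 (.inr h1') hs'.le))]
    have : ‖(s : ℂ) - 1‖ = s - 1 := by
      rw [← Complex.ofReal_one, ← Complex.ofReal_sub, Complex.norm_real,
        Real.norm_of_nonneg (by linarith)]
    rw [this, one_div, Real.log_inv]
    ring_nf
  · simp

/-- The prime zeta function of the class `1 (mod q)` near `s = 1`. -/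
lemma primeZetaOne_asymp (q : ℕ) [NeZero q] : ∃ C : ℝ, ∀ s : ℝ, 1 < s → s ≤ 2 →
    |primeZetaOne q s - Real.log (1 / (s - 1)) / q.totient| ≤ C := by
  classical
  obtain ⟨K, hK⟩ := sum_log_norm_LSeries_bounds
  choose C hC using regL_bounded q
  have hφ : (0 : ℝ) < q.totient := by exact_mod_cast Nat.totient_pos.2 (NeZero.pos q)
  refine ⟨(∑ χ, C χ) / q.totient + |K|, fun s h1 h2 => ?_⟩
  obtain ⟨hl, hu⟩ := hK q s h1
  set R := ∑ χ : DirichletCharacter ℂ q, Real.log ‖regL q χ s‖ with hR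
  have hsum : ∑ χ : DirichletCharacter ℂ q, Real.log ‖LSeries (fun n => χ n) (s : ℂ)‖ =
      Real.log (1 / (s - 1)) + R := by
    simp_rw [log_norm_LSeries_eq q _ h1]
    rw [Finset.sum_add_distrib, Finset.sum_ite_eq' Finset.univ]
    simp [hR]
  have hRb : |R| ≤ ∑ χ, C χ := by
    refine (Finset.abs_sum_le_sum_abs _ _).trans (Finset.sum_le_sum fun χ _ => ?_)
    exact hC χ s ⟨h1.le, h2⟩
  rw [hsum] at hl hu
  have hRb' := abs_le.1 hRb
  have e1 : (q.totient : ℝ) * (Real.log (1 / (s - 1)) / q.totient) = Real.log (1 / (s - 1)) := by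
    field_simp
  have e2 : (q.totient : ℝ) * ((∑ χ, C χ) / q.totient) = ∑ χ, C χ := by field_simp
  rw [abs_le]
  constructor
  · refine le_of_mul_le_mul_left ?_ hφ
    nlinarith [le_abs_self K]
  · refine le_of_mul_le_mul_left ?_ hφ
    nlinarith [abs_nonneg K]

lemma norm_sum_range_char_le (q : ℕ) [NeZero q] (χ : DirichletCharacter ℂ q) (hχ : χ ≠ 1)
    {s : ℝ} (hs : 1 < s) (N : ℕ) :
    ‖∑ a ∈ Finset.range ((N + 1) * q), χ a * (((a : ℝ) ^ (-s) : ℝ) : ℂ)‖ ≤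
      2 + Real.log q - q * (((N + 1) * q : ℝ) ^ (-s)) := by
  have hq : 0 < q := NeZero.pos q
  have hqr : (1 : ℝ) ≤ q := by exact_mod_cast hq
  induction N with
  | zero =>
    have h1 : ‖∑ a ∈ Finset.range ((0 + 1) * q), χ a * (((a : ℝ) ^ (-s) : ℝ) : ℂ)‖ ≤
        1 + Real.log q := by
      refine (norm_sum_le _ _).trans ?_
      rw [zero_add, one_mul]
      calc ∑ a ∈ Finset.range q, ‖χ a * (((a : ℝ) ^ (-s) : ℝ) : ℂ)‖
          ≤ ∑ a ∈ Finset.range (q + 1), ((a : ℝ))⁻¹ := by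
            rw [Finset.sum_range_succ]
            refine le_trans (Finset.sum_le_sum fun a _ => ?_) (le_add_of_nonneg_right (by positivity))
            rw [norm_mul, Complex.norm_real, Real.norm_of_nonneg (by positivity)]
            rcases Nat.eq_zero_or_pos a with rfl | ha
            · simp [Real.zero_rpow (show -s ≠ 0 by linarith)]
            · calc _ ≤ 1 * (a : ℝ) ^ (-1 : ℝ) := by
                    gcongr
                    · exact χ.norm_le_one _
                    · exact_mod_cast ha
                _ = _ := by rw [Real.rpow_neg_one, one_mul]
        _ = (harmonic q : ℝ) := by
            rw [Finset.sum_range_succ', harmonic]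
            push_cast; simp
        _ ≤ _ := harmonic_le_one_add_log q
    have h2 : (q : ℝ) * (((0 : ℕ) + 1) * q : ℝ) ^ (-s) ≤ 1 := by
      calc (q : ℝ) * (((0 : ℕ) + 1) * q : ℝ) ^ (-s) ≤ q * (q : ℝ) ^ (-1 : ℝ) := by
            simp only [Nat.cast_zero, zero_add, one_mul]
            gcongr
        _ = 1 := by rw [Real.rpow_neg_one]; field_simp
    linarith
  | succ N ih =>
    rw [show (N + 1 + 1) * q = (N + 1) * q + q by ring, Finset.sum_range_add]
    have hz : ∑ r ∈ Finset.range q, χ (((N + 1) * q + r : ℕ) : ZMod q) = 0 := by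
      have := MulChar.sum_eq_zero_of_ne_one hχ
      rw [← this]
      refine Finset.sum_bij' (fun a _ => (a : ZMod q)) (fun b _ => b.val) ?_ ?_ ?_ ?_ ?_
      · simp
      · intro b _; simpa using ZMod.val_lt b
      · intro a ha; exact ZMod.val_cast_of_lt (Finset.mem_range.1 ha)
      · intro b _; simp
      · intro a _; simp
    set A : ℝ := ((N + 1) * q : ℝ) ^ (-s)
    set B : ℝ := (((N + 1 : ℕ) + 1) * q : ℝ) ^ (-s)
    have hblock : ‖∑ r ∈ Finset.range q, χ (((N + 1) * q + r : ℕ) : ZMod q) *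
        (((((N + 1) * q + r : ℕ) : ℝ) ^ (-s) : ℝ) : ℂ)‖ ≤ q * (A - B) := by
      have : ∑ r ∈ Finset.range q, χ (((N + 1) * q + r : ℕ) : ZMod q) *
          (((((N + 1) * q + r : ℕ) : ℝ) ^ (-s) : ℝ) : ℂ) =
          ∑ r ∈ Finset.range q, χ (((N + 1) * q + r : ℕ) : ZMod q) *
          (((((N + 1) * q + r : ℕ) : ℝ) ^ (-s) - B : ℝ) : ℂ) := by
        simp_rw [Complex.ofReal_sub, mul_sub]
        rw [Finset.sum_sub_distrib, ← Finset.sum_mul, hz]; simp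
      rw [this]
      refine (norm_sum_le _ _).trans ?_
      calc _ ≤ ∑ r ∈ Finset.range q, (A - B) := by
            refine Finset.sum_le_sum fun r hr => ?_
            have hr' : (r : ℝ) ≤ q := by exact_mod_cast (Finset.mem_range.1 hr).le
            have hA : ((((N + 1) * q + r : ℕ) : ℝ) ^ (-s)) ≤ A := by
              apply Real.rpow_le_rpow_of_nonpos (by positivity) _ (by linarith)
              push_cast; linarith [Nat.cast_nonneg (α := ℝ) r]
            have hB : B ≤ ((((N + 1) * q + r : ℕ) : ℝ) ^ (-s)) := by
              apply Real.rpow_le_rpow_of_nonpos (by positivity) _ (by linarith)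
              push_cast; nlinarith
            rw [norm_mul, Complex.norm_real, Real.norm_of_nonneg (by linarith)]
            calc _ ≤ 1 * (((((N + 1) * q + r : ℕ) : ℝ) ^ (-s)) - B) := by
                  gcongr
                  exact χ.norm_le_one _
              _ ≤ _ := by linarith
        _ = _ := by simp; ring
    refine (norm_add_le _ _).trans ?_
    linarith [mul_sub (q : ℝ) A B]

lemma norm_LSeries_char_le (q : ℕ) [NeZero q] (χ : DirichletCharacter ℂ q) (hχ : χ ≠ 1)
    {s : ℝ} (hs : 1 < s) : ‖LSeries (fun n => χ n) (s : ℂ)‖ ≤ 2 + Real.log q := by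
  have hs' : 1 < (s : ℂ).re := by simpa using hs
  have hsum := (DirichletCharacter.LSeriesSummable_of_one_lt_re χ hs').hasSum.tendsto_sum_nat
  have hq : 0 < q := NeZero.pos q
  have ht : Tendsto (fun N : ℕ => (N + 1) * q) atTop atTop :=
    (tendsto_add_atTop_nat 1).atTop_mul_const' hq
  refine le_of_tendsto (hsum.comp ht).norm (Eventually.of_forall fun N => ?_)
  have := norm_sum_range_char_le q χ hχ hs N
  have e : ∑ a ∈ Finset.range ((N + 1) * q), LSeries.term (fun n => χ n) (s : ℂ) a =
      ∑ a ∈ Finset.range ((N + 1) * q), χ a * (((a : ℝ) ^ (-s) : ℝ) : ℂ) := by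
    refine Finset.sum_congr rfl fun a _ => ?_
    rcases Nat.eq_zero_or_pos a with rfl | ha
    · simp [Real.zero_rpow (show -s ≠ 0 by linarith)]
    · rw [LSeries.term_of_ne_zero ha.ne', div_eq_mul_inv, ← Complex.cpow_neg,
        Complex.ofReal_cpow (by positivity)]
      simp
  simp only [Function.comp_apply, e]
  have h0 : 0 ≤ (q : ℝ) * (((N + 1) * q : ℝ) ^ (-s)) := by positivity
  linarith

lemma norm_LSeries_trivial_le (q : ℕ) [NeZero q] {s : ℝ} (hs : 1 < s) :
    ‖LSeries (fun n => (1 : DirichletCharacter ℂ q) n) (s : ℂ)‖ ≤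
      ∑' n : ℕ, (n : ℝ) ^ (-s) := by
  have hs' : 1 < (s : ℂ).re := by simpa using hs
  have hsm : Summable fun n : ℕ => (n : ℝ) ^ (-s) := Real.summable_nat_rpow.2 (by linarith)
  refine tsum_of_norm_bounded hsm.hasSum fun a => ?_
  rcases Nat.eq_zero_or_pos a with rfl | ha
  · simp; positivity
  · rw [LSeries.term_of_ne_zero ha.ne', norm_div, ← Complex.ofReal_natCast,
      Complex.norm_cpow_eq_rpow_re_of_pos (by exact_mod_cast ha), Real.rpow_neg (by positivity),
      div_eq_mul_inv]
    simp only [Complex.ofReal_re]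
    calc _ ≤ 1 * ((a : ℝ) ^ s)⁻¹ := by
          gcongr
          exact DirichletCharacter.norm_le_one _ _
      _ = _ := one_mul _

lemma norm_LSeries_trivial_bound : ∃ C : ℝ, 0 ≤ C ∧ ∀ (q : ℕ) [NeZero q] (s : ℝ), 1 < s → s ≤ 2 →
    Real.log ‖LSeries (fun n => (1 : DirichletCharacter ℂ q) n) (s : ℂ)‖ ≤
      Real.log (1 / (s - 1)) + C := by
  classical
  obtain ⟨C, hC⟩ := regL_bounded 1 1
  refine ⟨|C|, abs_nonneg _, fun q _ s hs hs2 => ?_⟩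
  have hs' : 1 < (s : ℂ).re := by simpa using hs
  have hsm : Summable fun n : ℕ => (n : ℝ) ^ (-s) := Real.summable_nat_rpow.2 (by linarith)
  have h1 : LSeries (fun n => (1 : DirichletCharacter ℂ 1) n) (s : ℂ) =
      ((∑' n : ℕ, (n : ℝ) ^ (-s) : ℝ) : ℂ) := by
    rw [Complex.ofReal_tsum, LSeries]
    refine tsum_congr fun a => ?_
    rcases Nat.eq_zero_or_pos a with rfl | ha
    · simp [Real.zero_rpow (show -s ≠ 0 by linarith)]
    · rw [LSeries.term_of_ne_zero ha.ne', div_eq_mul_inv, ← Complex.cpow_neg,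
        Complex.ofReal_cpow (by positivity)]
      have : (a : ZMod 1) = 1 := Subsingleton.elim _ _
      simp [this]
  have h2 := log_norm_LSeries_eq 1 1 hs
  rw [if_pos rfl, h1, Complex.norm_real, Real.norm_of_nonneg (tsum_nonneg fun _ => by positivity)]
    at h2
  have h3 := norm_LSeries_trivial_le q hs
  have hpos : 0 < ‖LSeries (fun n => (1 : DirichletCharacter ℂ q) n) (s : ℂ)‖ := by
    rw [norm_pos_iff, ← DirichletCharacter.LFunction_eq_LSeries 1 hs']
    exact DirichletCharacter.LFunction_ne_zero_of_one_le_re 1 (.inr (by exact_mod_cast hs.ne'))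
      hs'.le
  have h4 := Real.log_le_log hpos h3
  have h5 := hC s ⟨hs.le, hs2⟩
  linarith [le_abs_self C, le_abs_self (Real.log ‖regL 1 1 (s : ℂ)‖)]

/-- An upper bound for `primeZetaOne q s` with explicit dependence on the modulus. -/
lemma primeZetaOne_le : ∃ C : ℝ, 0 ≤ C ∧ ∀ (q : ℕ) [NeZero q] (s : ℝ), 1 < s → s ≤ 2 →
    primeZetaOne q s ≤ (Real.log (1 / (s - 1)) + C) / q.totient + Real.log (2 + Real.log q) := by
  classical
  obtain ⟨K, hK⟩ := sum_log_norm_LSeries_bounds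
  obtain ⟨C, hC0, hC⟩ := norm_LSeries_trivial_bound
  refine ⟨C, hC0, fun q _ s hs hs2 => ?_⟩
  have hφ : (0 : ℝ) < q.totient := by exact_mod_cast Nat.totient_pos.2 (NeZero.pos q)
  have hlq : 0 ≤ Real.log q := Real.log_natCast_nonneg q
  have hll : 0 ≤ Real.log (2 + Real.log q) := Real.log_nonneg (by linarith)
  have hs0 : 0 ≤ Real.log (1 / (s - 1)) := by
    apply Real.log_nonneg
    rw [le_div_iff₀ (by linarith)]; linarith
  have hb : ∀ χ : DirichletCharacter ℂ q, Real.log ‖LSeries (fun n => χ n) (s : ℂ)‖ ≤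
      (if χ = 1 then Real.log (1 / (s - 1)) + C else 0) + Real.log (2 + Real.log q) := by
    intro χ
    split_ifs with h
    · subst h
      linarith [hC q s hs hs2]
    · rw [zero_add]
      rcases eq_or_ne ‖LSeries (fun n => χ n) (s : ℂ)‖ 0 with h0 | h0
      · rw [h0]; simpa using hll
      · exact Real.log_le_log (lt_of_le_of_ne (norm_nonneg _) h0.symm)
          (norm_LSeries_char_le q χ h hs)
  have hsum := Finset.sum_le_sum fun χ (_ : χ ∈ Finset.univ) => hb χ
  rw [Finset.sum_add_distrib, Finset.sum_ite_eq' Finset.univ] at hsum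
  simp only [Finset.mem_univ, if_true, Finset.sum_const, nsmul_eq_mul] at hsum
  have hcard : (Finset.univ : Finset (DirichletCharacter ℂ q)).card = q.totient := by
    rw [Finset.card_univ, ← Nat.card_eq_fintype_card]
    exact DirichletCharacter.card_eq_totient_of_hasEnoughRootsOfUnity ℂ q
  rw [hcard] at hsum
  refine le_of_mul_le_mul_left ?_ hφ
  refine ((hK q s hs).1.trans hsum).trans (le_of_eq ?_)
  field_simp

/-- `∑ log p / p ^ s` is `O(1 / (s - 1))`. -/
lemma sum_log_mul_rpow_le : ∃ C : ℝ, 0 ≤ C ∧ ∀ s : ℝ, 1 < s → s ≤ 2 →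
    Summable (fun p : Nat.Primes => Real.log (p : ℕ) * ((p : ℕ) : ℝ) ^ (-s)) ∧
    ∑' p : Nat.Primes, Real.log (p : ℕ) * ((p : ℕ) : ℝ) ^ (-s) ≤ C / (s - 1) := by
  obtain ⟨C, hC⟩ := primeZetaOne_asymp 1
  have hone : ∀ s, primeZetaOne 1 s = ∑' p : Nat.Primes, ((p : ℕ) : ℝ) ^ (-s) := by
    intro s
    refine tsum_congr fun p => if_pos (Subsingleton.elim _ _)
  have hC0 : 0 ≤ C := (abs_nonneg _).trans (hC 2 (by norm_num) le_rfl)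
  have hl2 : 0 ≤ Real.log 2 := Real.log_nonneg (by norm_num)
  refine ⟨2 * (Real.log 2 + 2 * C), by positivity, fun s hs hs2 => ?_⟩
  set s' := 1 + (s - 1) / 2 with hs'
  have h1 := summable_primes_rpow_neg hs
  have h2 := summable_primes_rpow_neg (s := s') (by linarith)
  have hterm : ∀ p : Nat.Primes, Real.log (p : ℕ) * ((p : ℕ) : ℝ) ^ (-s) ≤
      2 / (s - 1) * (((p : ℕ) : ℝ) ^ (-s') - ((p : ℕ) : ℝ) ^ (-s)) := by
    intro p
    have hp : (0 : ℝ) < (p : ℕ) := by exact_mod_cast p.2.pos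
    have e : ((p : ℕ) : ℝ) ^ (-s') = ((p : ℕ) : ℝ) ^ (-s) * ((p : ℕ) : ℝ) ^ ((s - 1) / 2) := by
      rw [← Real.rpow_add hp]; congr 1; rw [hs']; ring
    have h3 : (s - 1) / 2 * Real.log (p : ℕ) ≤ ((p : ℕ) : ℝ) ^ ((s - 1) / 2) - 1 := by
      rw [Real.rpow_def_of_pos hp]
      linarith [Real.add_one_le_exp (Real.log (p : ℕ) * ((s - 1) / 2))]
    have h4 : (0 : ℝ) < ((p : ℕ) : ℝ) ^ (-s) := by positivity
    rw [e, div_mul_eq_mul_div, le_div_iff₀ (by linarith)]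
    nlinarith
  have hd := (h2.sub h1).mul_left (2 / (s - 1))
  have hsm : Summable (fun p : Nat.Primes => Real.log (p : ℕ) * ((p : ℕ) : ℝ) ^ (-s)) :=
    Summable.of_nonneg_of_le (fun p => mul_nonneg (Real.log_natCast_nonneg _) (by positivity))
      hterm hd
  refine ⟨hsm, (hsm.tsum_le_tsum hterm hd).trans ?_⟩
  rw [tsum_mul_left, h2.tsum_sub h1, ← hone, ← hone]
  have a1 := abs_le.1 (hC s hs hs2)
  have a2 := abs_le.1 (hC s' (by linarith) (by linarith))
  have e : Real.log (1 / (s' - 1)) = Real.log (1 / (s - 1)) + Real.log 2 := by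
    rw [← Real.log_mul (by apply ne_of_gt; apply one_div_pos.2; linarith) (by norm_num)]
    congr 1
    rw [hs']; field_simp; ring
  simp only [Nat.totient_one, Nat.cast_one, div_one] at a1 a2
  rw [div_mul_eq_mul_div]
  apply div_le_div_of_nonneg_right _ (by linarith)
  linarith

/-- The sum of `1 / p` over primes `p ≤ n`, `p ≡ 1 (mod q)`. -/
def primeRecip (q n : ℕ) : ℝ :=
  ∑ p ∈ (Finset.range (n + 1)).filter (fun p => p.Prime ∧ p % q = 1 % q), (1 : ℝ) / p

lemma primeRecip_eq_tsum (q n : ℕ) : primeRecip q n =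
    ∑' p : Nat.Primes, if (p : ℕ) ≤ n ∧ ((p : ℕ) : ZMod q) = 1 then 1 / ((p : ℕ) : ℝ) else 0 := by
  have h : ∀ f : ℕ → ℝ, ∑' p : Nat.Primes, f p = ∑' p : ℕ, if p.Prime then f p else 0 := by
    intro f
    refine (tsum_subtype {p : ℕ | p.Prime} f).trans ?_
    simp only [Set.indicator, Set.mem_ofPred_eq]
    congr!
  rw [h (fun p => if p ≤ n ∧ (p : ZMod q) = 1 then 1 / (p : ℝ) else 0), primeRecip,
    Finset.sum_filter, tsum_eq_sum (s := Finset.range (n + 1))]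
  · refine Finset.sum_congr rfl fun p hp => ?_
    have hp' : p ≤ n := by simpa [Nat.lt_succ_iff] using hp
    have : (p : ZMod q) = 1 ↔ p % q = 1 % q := by
      rw [← Nat.cast_one, ZMod.natCast_eq_natCast_iff']
    simp only [this]
    by_cases h1 : p.Prime <;> by_cases h2 : p % q = 1 % q <;> simp [h1, h2, hp']
  · intro p hp
    have hp' : ¬ p ≤ n := by simpa [Nat.lt_succ_iff] using hp
    simp [hp']

lemma primeRecip_sub_primeZetaOne : ∃ C : ℝ, 0 ≤ C ∧ ∀ (q n : ℕ), 3 ≤ n →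
    |primeRecip q n - primeZetaOne q (1 + 1 / Real.log n)| ≤ C := by
  obtain ⟨C, hC0, hC⟩ := sum_log_mul_rpow_le
  refine ⟨2 * C, by positivity, fun q n hn => ?_⟩
  have hn3 : (3 : ℝ) ≤ n := by exact_mod_cast hn
  have hln : 1 < Real.log n := by
    rw [Real.lt_log_iff_exp_lt (by linarith)]
    exact lt_of_lt_of_le Real.exp_one_lt_d9 (by linarith)
  set s := 1 + 1 / Real.log n with hs
  have hs1 : s - 1 = 1 / Real.log n := by rw [hs]; ring
  have hd : 0 < 1 / Real.log n := by positivity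
  have hd1 : 1 / Real.log n ≤ 1 := by rw [div_le_one (by linarith)]; linarith
  obtain ⟨hsm, hle⟩ := hC s (by linarith) (by linarith)
  have hterm : ∀ p : Nat.Primes,
      ‖(if (p : ℕ) ≤ n ∧ ((p : ℕ) : ZMod q) = 1 then 1 / ((p : ℕ) : ℝ) else 0) -
        (if ((p : ℕ) : ZMod q) = 1 then ((p : ℕ) : ℝ) ^ (-s) else 0)‖ ≤
      2 * (s - 1) * (Real.log (p : ℕ) * ((p : ℕ) : ℝ) ^ (-s)) := by
    intro p
    have hp : (0 : ℝ) < (p : ℕ) := by exact_mod_cast p.2.pos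
    have hlp : 0 ≤ Real.log (p : ℕ) := Real.log_natCast_nonneg _
    have h4 : (0 : ℝ) < ((p : ℕ) : ℝ) ^ (-s) := by positivity
    have hr : 0 ≤ 2 * (s - 1) * (Real.log (p : ℕ) * ((p : ℕ) : ℝ) ^ (-s)) := by
      rw [hs1]; positivity
    by_cases h1 : ((p : ℕ) : ZMod q) = 1
    swap
    · simpa [h1] using hr
    by_cases h2 : (p : ℕ) ≤ n
    · simp only [h1, h2, and_self, if_true]
      set u := Real.log (p : ℕ) * (s - 1) with hu
      have e : 1 / ((p : ℕ) : ℝ) = ((p : ℕ) : ℝ) ^ (-s) * Real.exp u := by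
        rw [hu, ← Real.rpow_def_of_pos hp, ← Real.rpow_add hp, one_div, ← Real.rpow_neg_one]
        congr 1; ring
      have hu0 : 0 ≤ u := by rw [hu, hs1]; positivity
      have hu1 : u ≤ 1 := by
        rw [hu, hs1, mul_one_div, div_le_one (by linarith)]
        exact Real.log_le_log hp (by exact_mod_cast h2)
      have hexp : Real.exp u ≤ 1 + 2 * u := by
        have := Real.exp_bound_div_one_sub_of_interval hu0
        have h3 := Real.abs_exp_sub_one_sub_id_le (x := u) (by rw [abs_of_nonneg hu0]; exact hu1)
        have := abs_le.1 h3
        nlinarith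
      have hexp1 : 1 ≤ Real.exp u := Real.one_le_exp hu0
      rw [e, Real.norm_of_nonneg (by nlinarith)]
      have : ((p : ℕ) : ℝ) ^ (-s) * Real.exp u ≤ ((p : ℕ) : ℝ) ^ (-s) * (1 + 2 * u) := by gcongr
      rw [hu] at this ⊢
      linarith
    · simp only [h1, h2, false_and, if_true, if_false]
      rw [zero_sub, norm_neg, Real.norm_of_nonneg h4.le]
      have : 1 ≤ (s - 1) * Real.log (p : ℕ) := by
        rw [hs1, div_mul_eq_mul_div, one_mul, le_div_iff₀ (by linarith), one_mul]
        exact Real.log_le_log (by linarith) (by exact_mod_cast (not_le.1 h2).le)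
      nlinarith
  have hs2 := hsm.mul_left (2 * (s - 1))
  have hP := summable_primeZetaOne q (s := s) (by linarith)
  have hfin : Summable fun p : Nat.Primes =>
      if (p : ℕ) ≤ n ∧ ((p : ℕ) : ZMod q) = 1 then 1 / ((p : ℕ) : ℝ) else 0 := by
    have := (Summable.of_norm_bounded hs2 hterm).add hP
    simpa using this
  rw [primeRecip_eq_tsum, primeZetaOne, ← hfin.tsum_sub hP, ← Real.norm_eq_abs]
  refine (tsum_of_norm_bounded hs2.hasSum hterm).trans ?_
  rw [tsum_mul_left]
  have : 0 < s - 1 := by linarith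
  calc _ ≤ 2 * (s - 1) * (C / (s - 1)) := by gcongr
    _ = 2 * C := by field_simp

/-- Mertens' theorem for primes `p ≡ 1 (mod q)`. -/
theorem primeRecip_asymp (q : ℕ) [NeZero q] : ∃ C : ℝ, 0 ≤ C ∧ ∀ n : ℕ, 3 ≤ n →
    |primeRecip q n - LL n / q.totient| ≤ C := by
  obtain ⟨C, hC0, hC⟩ := primeRecip_sub_primeZetaOne
  obtain ⟨D, hD⟩ := primeZetaOne_asymp q
  have hD0 : 0 ≤ D := (abs_nonneg _).trans (hD 2 (by norm_num) le_rfl)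
  refine ⟨C + D, by positivity, fun n hn => ?_⟩
  have hn3 : (3 : ℝ) ≤ n := by exact_mod_cast hn
  have hln : 1 < Real.log n := by
    rw [Real.lt_log_iff_exp_lt (by linarith)]
    exact lt_of_lt_of_le Real.exp_one_lt_d9 (by linarith)
  have hd : 0 < 1 / Real.log n := by positivity
  have hd1 : 1 / Real.log n ≤ 1 := by rw [div_le_one (by linarith)]; linarith
  have h1 := abs_le.1 (hC q n hn)
  have h2 := abs_le.1 (hD (1 + 1 / Real.log n) (by linarith) (by linarith))
  rw [add_sub_cancel_left, one_div_one_div] at h2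
  rw [LL, abs_le]
  constructor <;> linarith

/-- Upper bound for the reciprocal sum with explicit dependence on the modulus. -/
theorem primeRecip_le : ∃ C : ℝ, 0 ≤ C ∧ ∀ (q n : ℕ), 0 < q → 3 ≤ n →
    primeRecip q n ≤ LL n / q.totient + Real.log (2 + Real.log q) + C := by
  obtain ⟨C, hC0, hC⟩ := primeRecip_sub_primeZetaOne
  obtain ⟨D, hD0, hD⟩ := primeZetaOne_le
  refine ⟨C + D, by positivity, fun q n hq hn => ?_⟩
  have : NeZero q := ⟨hq.ne'⟩
  have hn3 : (3 : ℝ) ≤ n := by exact_mod_cast hn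
  have hln : 1 < Real.log n := by
    rw [Real.lt_log_iff_exp_lt (by linarith)]
    exact lt_of_lt_of_le Real.exp_one_lt_d9 (by linarith)
  have hd : 0 < 1 / Real.log n := by positivity
  have hd1 : 1 / Real.log n ≤ 1 := by rw [div_le_one (by linarith)]; linarith
  have h1 := abs_le.1 (hC q n hn)
  have h2 := hD q (1 + 1 / Real.log n) (by linarith) (by linarith)
  rw [add_sub_cancel_left, one_div_one_div, add_div] at h2
  have hφ : (1 : ℝ) ≤ q.totient := by exact_mod_cast Nat.totient_pos.2 hq
  have : D / q.totient ≤ D := div_le_self hD0 hφ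
  rw [LL]
  linarith

lemma isPrimePow_le_two_mul_totient {Q : ℕ} (hQ : IsPrimePow Q) : Q ≤ 2 * Q.totient := by
  obtain ⟨p, k, hp, hk, rfl⟩ := (isPrimePow_nat_iff _).1 hQ
  rw [Nat.totient_prime_pow hp hk]
  obtain ⟨j, rfl⟩ := Nat.exists_eq_succ_of_ne_zero hk.ne'
  have : p ≤ 2 * (p - 1) := by have := hp.two_le; omega
  calc p ^ (j + 1) = p ^ j * p := pow_succ _ _
    _ ≤ p ^ j * (2 * (p - 1)) := Nat.mul_le_mul_left _ this
    _ = _ := by simp; ring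

lemma ppKey_lt_of_totient_lt {Q R : ℕ} (hQ : IsPrimePow Q) (h : Q.totient < R.totient) :
    ppKey Q < ppKey R := by
  have := isPrimePow_le_two_mul_totient hQ
  unfold ppKey
  have h2 : (Q.totient + 1) ^ 2 ≤ R.totient ^ 2 := Nat.pow_le_pow_left h 2
  nlinarith

lemma ppKey_injOn {Q R : ℕ} (hQ : IsPrimePow Q) (hR : IsPrimePow R) (h : ppKey Q = ppKey R) :
    Q = R := by
  rcases lt_trichotomy Q.totient R.totient with h1 | h1 | h1
  · exact absurd h (ppKey_lt_of_totient_lt hQ h1).ne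
  · simpa [ppKey, h1] using h
  · exact absurd h (ppKey_lt_of_totient_lt hR h1).ne'

lemma infinite_ppKey : {k : ℕ | ∃ q : ℕ, IsPrimePow q ∧ ppKey q = k}.Infinite := by
  have : (ppKey '' {p : ℕ | p.Prime}).Infinite := by
    refine Nat.infinite_setOfPred_prime.image ?_
    intro p hp q hq h
    exact ppKey_injOn (Nat.Prime.isPrimePow hp) (Nat.Prime.isPrimePow hq) h
  refine this.mono ?_
  rintro _ ⟨p, hp, rfl⟩
  exact ⟨p, Nat.Prime.isPrimePow hp, rfl⟩

lemma qt_spec (i : ℕ) : IsPrimePow (qt i) ∧ ppKey (qt i) = ppNthKey (i - 1) := by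
  have h := Nat.nth_mem_of_infinite infinite_ppKey (i - 1)
  exact Nat.sInf_mem (s := {q : ℕ | IsPrimePow q ∧ ppKey q = ppNthKey (i - 1)}) h

lemma ppNthKey_strictMono : StrictMono ppNthKey := Nat.nth_strictMono infinite_ppKey

lemma ppKey_qt_lt {j k : ℕ} (hj : 1 ≤ j) (h : j < k) : ppKey (qt j) < ppKey (qt k) := by
  rw [(qt_spec j).2, (qt_spec k).2]
  exact ppNthKey_strictMono (by omega)

lemma exists_qt_eq {Q : ℕ} (hQ : IsPrimePow Q) : ∃ j, 1 ≤ j ∧ qt j = Q := by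
  have : ppKey Q ∈ Set.range ppNthKey := by
    have := Nat.range_nth_of_infinite infinite_ppKey
    unfold ppNthKey
    rw [this]
    exact ⟨Q, hQ, rfl⟩
  obtain ⟨n, hn⟩ := this
  refine ⟨n + 1, by omega, ppKey_injOn (qt_spec _).1 hQ ?_⟩
  rw [(qt_spec _).2, ← hn]; rfl

lemma totient_qt_le {j k : ℕ} (hj : 1 ≤ j) (h : j ≤ k) : (qt j).totient ≤ (qt k).totient := by
  rcases h.eq_or_lt with rfl | h
  · exact le_rfl
  · by_contra! h2
    exact absurd (ppKey_qt_lt hj h) (ppKey_lt_of_totient_lt (qt_spec k).1 h2).le.not_gt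

lemma qt_injective {j k : ℕ} (hj : 1 ≤ j) (hk : 1 ≤ k) (h : qt j = qt k) : j = k := by
  rcases lt_trichotomy j k with h1 | h1 | h1
  · exact absurd (ppKey_qt_lt hj h1) (by rw [h]; exact lt_irrefl _)
  · exact h1
  · exact absurd (ppKey_qt_lt hk h1) (by rw [h]; exact lt_irrefl _)

lemma lt_of_totient_qt_lt {j k : ℕ} (hk : 1 ≤ k) (h : (qt j).totient < (qt k).totient) :
    j < k := by
  by_contra! h2
  exact absurd (totient_qt_le hk h2) h.not_ge

lemma totient_prime_pow_injective {p a b : ℕ} (hp : p.Prime) (ha : 0 < a) (hb : 0 < b)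
    (h : (p ^ a).totient = (p ^ b).totient) : a = b := by
  rw [Nat.totient_prime_pow hp ha, Nat.totient_prime_pow hp hb] at h
  have h2 := Nat.eq_of_mul_eq_mul_right (by have := hp.two_le; omega) h
  have := Nat.pow_right_injective hp.two_le h2
  omega

lemma le_of_totient_prime_pow_eq {p r k l : ℕ} (hp : p.Prime) (hr : r.Prime) (hk : 2 ≤ k)
    (hl : 2 ≤ l) (h : (p ^ k).totient = (r ^ l).totient) : p ≤ r := by
  rw [Nat.totient_prime_pow hp (by omega), Nat.totient_prime_pow hr (by omega)] at h
  have h1 : p ∣ r ^ (l - 1) * (r - 1) := by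
    rw [← h]
    exact (dvd_pow_self p (by omega)).mul_right _
  have h2 := hr.two_le
  rcases (Nat.Prime.dvd_mul hp).1 h1 with h1 | h1
  · exact Nat.le_of_dvd (by omega) (hp.dvd_of_dvd_pow h1)
  · exact (Nat.le_of_dvd (by omega) h1).trans (by omega)

/-- Two prime powers with the same totient, both primes or both proper powers, agree. -/
lemma primePow_eq_of_totient_eq {p r k l : ℕ} (hp : p.Prime) (hr : r.Prime) (hk : 0 < k)
    (hl : 0 < l) (hkl : k = 1 ↔ l = 1) (h : (p ^ k).totient = (r ^ l).totient) :
    p ^ k = r ^ l := by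
  by_cases hk1 : k = 1
  · rw [hkl.1 hk1, hk1] at h ⊢
    simp only [pow_one, Nat.totient_prime hp, Nat.totient_prime hr] at h ⊢
    have := hp.two_le; have := hr.two_le; omega
  · have hl1 : l ≠ 1 := fun h => hk1 (hkl.2 h)
    have : p = r := le_antisymm
      (le_of_totient_prime_pow_eq hp hr (by omega) (by omega) h)
      (le_of_totient_prime_pow_eq hr hp (by omega) (by omega) h.symm)
    subst this
    rw [totient_prime_pow_injective hp hk hl h]

lemma primePow_eq_or_eq_of_totient_eq {Q R S : ℕ} (hQ : IsPrimePow Q) (hR : IsPrimePow R)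
    (hS : IsPrimePow S) (hQR : Q ≠ R) (h1 : Q.totient = R.totient) (h2 : S.totient = Q.totient) :
    S = Q ∨ S = R := by
  obtain ⟨p, k, hp, hk, rfl⟩ := (isPrimePow_nat_iff _).1 hQ
  obtain ⟨r, l, hr, hl, rfl⟩ := (isPrimePow_nat_iff _).1 hR
  obtain ⟨s, m, hs, hm, rfl⟩ := (isPrimePow_nat_iff _).1 hS
  by_cases c1 : k = 1 ↔ l = 1
  · exact absurd (primePow_eq_of_totient_eq hp hr hk hl c1 h1) hQR
  · by_cases c2 : m = 1 ↔ k = 1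
    · exact Or.inl (primePow_eq_of_totient_eq hs hp hm hk c2 h2)
    · exact Or.inr (primePow_eq_of_totient_eq hs hr hm hl (by tauto) (h2.trans h1))

lemma eq_of_dvd_of_totient_eq {Q R : ℕ} (hQ : IsPrimePow Q) (hR : IsPrimePow R) (h : Q ∣ R)
    (h2 : Q.totient = R.totient) : Q = R := by
  obtain ⟨r, l, hr, hl, rfl⟩ := (isPrimePow_nat_iff _).1 hR
  obtain ⟨k, hk, rfl⟩ := (Nat.dvd_prime_pow hr).1 h
  have hk0 : 0 < k := by
    rcases Nat.eq_zero_or_pos k with rfl | h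
    · exact absurd rfl hQ.ne_one
    · exact h
  rw [totient_prime_pow_injective hr hk0 hl h2]

lemma primePow_dvd_lcm {Q a b : ℕ} (hQ : IsPrimePow Q) (ha : a ≠ 0) (hb : b ≠ 0) :
    Q ∣ Nat.lcm a b ↔ Q ∣ a ∨ Q ∣ b := by
  obtain ⟨p, k, hp, hk, rfl⟩ := (isPrimePow_nat_iff _).1 hQ
  rw [hp.pow_dvd_iff_le_factorization (Nat.lcm_ne_zero ha hb),
    hp.pow_dvd_iff_le_factorization ha, hp.pow_dvd_iff_le_factorization hb,
    Nat.factorization_lcm ha hb]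
  simp

lemma finset_lcm_qt_ne_zero (s : Finset ℕ) : s.lcm qt ≠ 0 := by
  rw [Ne, Finset.lcm_eq_zero_iff]
  rintro ⟨j, -, hj⟩
  exact (qt_spec j).1.ne_zero hj

lemma primePow_dvd_finset_lcm {Q : ℕ} (hQ : IsPrimePow Q) (s : Finset ℕ) :
    Q ∣ s.lcm qt ↔ ∃ j ∈ s, Q ∣ qt j := by
  induction s using Finset.induction_on with
  | empty => simp [hQ.ne_one]
  | insert a s ha ih =>
    rw [Finset.lcm_insert, lcm_eq_nat_lcm, primePow_dvd_lcm hQ (qt_spec a).1.ne_zero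
      (finset_lcm_qt_ne_zero s), ih]
    simp

lemma primePow_dvd_lcm_qt {i q q' d : ℕ} (hi : 1 ≤ i) (hq : IsPrimePow q) (hq' : IsPrimePow q')
    (hqq : q.totient = q'.totient) (hne : q ≠ q') (hd : d = Nat.lcm (Lseq (i - 1)) q)
    (h1 : ∀ j, 1 ≤ j → j < i → qt j ≠ q ∧ qt j ≠ q' ∧ (qt j).totient ≤ q.totient)
    (h2 : ∀ Q, IsPrimePow Q → Q.totient < q.totient → ∃ j, 1 ≤ j ∧ j < i ∧ qt j = Q)
    {Q : ℕ} (hQ : IsPrimePow Q) : Q ∣ d ↔ Q.totient < q.totient ∨ Q = q := by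
  rw [hd, Lseq, primePow_dvd_lcm hQ (finset_lcm_qt_ne_zero _) hq.ne_zero,
    primePow_dvd_finset_lcm hQ]
  constructor
  · rintro (⟨j, hj, hd⟩ | hd)
    · rw [Finset.mem_Icc] at hj
      have hle := Nat.le_of_dvd (Nat.totient_pos.2 (qt_spec j).1.pos) (Nat.totient_dvd_of_dvd hd)
      obtain ⟨a, b, c⟩ := h1 j hj.1 (by omega)
      refine Or.inl (lt_of_le_of_lt hle (lt_of_le_of_ne c fun h => ?_))
      rcases primePow_eq_or_eq_of_totient_eq hq hq' (qt_spec j).1 hne hqq h with h | h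
      exacts [a h, b h]
    · have hle := Nat.le_of_dvd (Nat.totient_pos.2 hq.pos) (Nat.totient_dvd_of_dvd hd)
      rcases hle.lt_or_eq with h | h
      · exact Or.inl h
      · exact Or.inr (eq_of_dvd_of_totient_eq hQ hq hd h)
  · rintro (h | h)
    · obtain ⟨j, a, b, c⟩ := h2 Q hQ h
      exact Or.inl ⟨j, Finset.mem_Icc.2 ⟨a, by omega⟩, by rw [c]⟩
    · exact Or.inr (by rw [h])

/-- The two members of a two-element universal factor order set, described through the prime
powers dividing them. -/
theorem UFO_structure {i : ℕ} (hi : 1 ≤ i) (hcard : (UFO i).ncard = 2) :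
    ∃ d d' : ℕ, UFO i = {d, d'} ∧ d ≠ 0 ∧ d' ≠ 0 ∧
      IsPrimePow (qt i) ∧ IsPrimePow (qt (i + 1)) ∧ Nat.Coprime (qt i) (qt (i + 1)) ∧
      (qt (i + 1)).totient = (qt i).totient ∧ 2 ≤ (qt i).totient ∧
      (∀ Q, IsPrimePow Q → Q.totient = (qt i).totient → Q = qt i ∨ Q = qt (i + 1)) ∧
      (∀ Q, IsPrimePow Q → (Q ∣ d ↔ Q.totient < (qt i).totient ∨ Q = qt i)) ∧
      (∀ Q, IsPrimePow Q → (Q ∣ d' ↔ Q.totient < (qt i).totient ∨ Q = qt (i + 1))) := by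
  have hlt : ¬ (qt i).totient < (qt (i + 1)).totient := by
    intro h
    rw [UFO, if_pos h, Set.ncard_singleton] at hcard
    omega
  have heq : (qt i).totient = (qt (i + 1)).totient :=
    le_antisymm (totient_qt_le hi (by omega)) (not_lt.1 hlt)
  have hq := (qt_spec i).1
  have hq' := (qt_spec (i + 1)).1
  have hne : qt i ≠ qt (i + 1) := fun h => by
    have := qt_injective hi (by omega) h
    omega
  have h1 : ∀ j, 1 ≤ j → j < i → qt j ≠ qt i ∧ qt j ≠ qt (i + 1) ∧
      (qt j).totient ≤ (qt i).totient := fun j hj hji =>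
    ⟨fun h => by have := qt_injective hj hi h; omega,
      fun h => by have := qt_injective hj (by omega) h; omega, totient_qt_le hj hji.le⟩
  have h2 : ∀ Q, IsPrimePow Q → Q.totient < (qt i).totient → ∃ j, 1 ≤ j ∧ j < i ∧ qt j = Q := by
    intro Q hQ hlt
    obtain ⟨j, hj, rfl⟩ := exists_qt_eq hQ
    exact ⟨j, hj, lt_of_totient_qt_lt hi hlt, rfl⟩
  have hL : Lseq i = Nat.lcm (Lseq (i - 1)) (qt i) := by
    obtain ⟨k, rfl⟩ : ∃ k, i = k + 1 := ⟨i - 1, by omega⟩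
    rw [Lseq, Lseq, ← Finset.insert_Icc_right_eq_Icc_add_one (by omega), Finset.lcm_insert,
      lcm_eq_nat_lcm, Nat.lcm_comm]
    rfl
  refine ⟨Lseq i, Nat.lcm (Lseq (i - 1)) (qt (i + 1)), by rw [UFO, if_neg hlt],
    finset_lcm_qt_ne_zero _, Nat.lcm_ne_zero (finset_lcm_qt_ne_zero _) hq'.ne_zero, hq, hq',
    ?_, heq.symm, ?_, fun Q hQ h => primePow_eq_or_eq_of_totient_eq hq hq' hQ hne heq h,
    fun Q hQ => primePow_dvd_lcm_qt hi hq hq' heq hne hL h1 h2 hQ, fun Q hQ => ?_⟩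
  · obtain ⟨p, k, hp, hk, e⟩ := (isPrimePow_nat_iff _).1 hq
    obtain ⟨r, l, hr, hl, e'⟩ := (isPrimePow_nat_iff _).1 hq'
    have hpr : p ≠ r := by
      rintro rfl
      rw [← e, ← e'] at heq
      exact hne (by rw [← e, ← e', totient_prime_pow_injective hp hk hl heq])
    rw [← e, ← e']
    exact Nat.Coprime.pow _ _ ((Nat.coprime_primes hp hr).2 hpr)
  · by_contra! hv
    have a := isPrimePow_le_two_mul_totient hq
    have b := isPrimePow_le_two_mul_totient hq'
    have := hq.two_le
    have := hq'.two_le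
    omega
  · rw [heq]
    refine primePow_dvd_lcm_qt hi hq' hq heq.symm hne.symm rfl (fun j hj hji => ?_)
      (fun Q hQ h => h2 Q hQ (heq ▸ h)) hQ
    obtain ⟨a, b, c⟩ := h1 j hj hji
    exact ⟨b, a, heq ▸ c⟩

/-- In a finite commutative group, a cyclic subgroup generated by an element whose order is the
exponent is a direct factor. -/
lemma exists_mulEquiv_zpowers_prod (G : Type) [CommGroup G] [Finite G] {g : G}
    (hg : orderOf g = Monoid.exponent G) :
    ∃ N : Subgroup G, Nonempty (Subgroup.zpowers g × N ≃* G) := by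
  have hne : NeZero (Monoid.exponent G) := ⟨Monoid.exponent_ne_zero_of_finite⟩
  have hcard : Nat.card (Subgroup.zpowers g) = Nat.card (rootsOfUnity (Monoid.exponent G) ℂ) := by
    rw [Nat.card_zpowers, hg, Complex.card_rootsOfUnity]
  let e : Subgroup.zpowers g ≃* rootsOfUnity (Monoid.exponent G) ℂ :=
    mulEquivOfCyclicCardEq hcard
  let ψ : Subgroup.zpowers g →* ℂˣ := (rootsOfUnity (Monoid.exponent G) ℂ).subtype.comp e.toMonoidHom
  obtain ⟨χ, hχ⟩ := MonoidHom.domRestrict_surjective ℂ (Subgroup.zpowers g) ψ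
  have hχ' : ∀ a : Subgroup.zpowers g, χ a = e a := fun a => by
    exact DFunLike.congr_fun hχ a
  refine ⟨χ.ker, ⟨MulEquiv.ofBijective
    ((Subgroup.zpowers g).subtype.coprod χ.ker.subtype) ⟨?_, ?_⟩⟩⟩
  · rw [injective_iff_map_eq_one]
    rintro ⟨a, b⟩ hab
    simp only [MonoidHom.coprod_apply, Subgroup.subtype_apply] at hab
    have h1 : χ a = 1 := by
      have := congrArg χ hab
      rwa [map_mul, χ.mem_ker.1 b.2, mul_one, map_one] at this
    have ha : a = 1 := by
      rw [hχ'] at h1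
      exact e.map_eq_one_iff.1 (Subtype.ext h1)
    subst ha
    simp only [Subgroup.coe_one, one_mul] at hab
    exact Prod.ext rfl (Subtype.ext hab)
  · intro x
    have hx : χ x ∈ rootsOfUnity (Monoid.exponent G) ℂ := by
      rw [mem_rootsOfUnity, ← map_pow, Monoid.pow_exponent_eq_one, map_one]
    let a := e.symm ⟨χ x, hx⟩
    have ha : χ a = χ x := by rw [hχ']; simp [a]
    refine ⟨(a, ⟨(a : G)⁻¹ * x, ?_⟩), by simp⟩
    rw [MonoidHom.mem_ker, map_mul, map_inv, ha, inv_mul_cancel]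

/-- A nontrivial chain of divisors realising `G` as a product of cyclic groups. -/
def IsInvChain (G : Type) [CommGroup G] (K : ℕ) (lam : Fin K → ℕ) : Prop :=
  (∀ j, 1 < lam j) ∧ (∀ j k : Fin K, j ≤ k → lam j ∣ lam k) ∧
    Nonempty (G ≃* Multiplicative (∀ j : Fin K, ZMod (lam j)))

lemma dvd_exponent_of_mulEquiv {G : Type} [CommGroup G] {K : ℕ} {lam : Fin K → ℕ}
    (e : G ≃* Multiplicative (∀ j : Fin K, ZMod (lam j))) (j : Fin K) :
    lam j ∣ Monoid.exponent G := by
  have h := Monoid.pow_exponent_eq_one (e.symm (Multiplicative.ofAdd (Pi.single j 1)))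
  rw [← map_pow, ← e.symm.map_one] at h
  have h2 := e.symm.injective h
  rw [← ofAdd_nsmul] at h2
  have h3 : Monoid.exponent G • (Pi.single j 1 : ∀ j : Fin K, ZMod (lam j)) = 0 := h2
  have h4 := congrFun h3 j
  simp only [Pi.smul_apply, Pi.single_eq_same, Pi.zero_apply, nsmul_eq_mul, mul_one] at h4
  exact (ZMod.natCast_eq_zero_iff _ _).1 h4

/-- Splitting off the last factor of a finite product. -/
def snocAddEquiv {K : ℕ} (μ : Fin (K + 1) → ℕ) :
    ZMod (μ (Fin.last K)) × (∀ j : Fin K, ZMod (μ j.castSucc)) ≃+ ∀ j, ZMod (μ j) where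
  toEquiv := Fin.snocEquiv (fun j => ZMod (μ j))
  map_add' := by
    rintro ⟨a, f⟩ ⟨b, g⟩
    funext j
    refine Fin.lastCases ?_ (fun i => ?_) j <;> simp [Fin.snocEquiv]

theorem exists_isInvChain : ∀ (n : ℕ) (G : Type) [CommGroup G] [Finite G], Nat.card G = n →
    ∃ (K : ℕ) (lam : Fin K → ℕ), IsInvChain G K lam := by
  intro n
  induction n using Nat.strong_induction_on with
  | _ n ih =>
    intro G _ _ hn
    rcases subsingleton_or_nontrivial G with hG | hG
    · refine ⟨0, Fin.elim0, fun j => j.elim0, fun j => j.elim0, ⟨?_⟩⟩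
      exact { toFun := fun _ => 1, invFun := fun _ => 1, left_inv := fun _ => Subsingleton.elim _ _,
              right_inv := fun _ => Subsingleton.elim _ _, map_mul' := fun _ _ => (mul_one _).symm }
    · obtain ⟨g, hg⟩ := Monoid.exists_orderOf_eq_exponent (Monoid.ExponentExists.of_finite (G := G))
      obtain ⟨N, ⟨e⟩⟩ := exists_mulEquiv_zpowers_prod G hg
      have he1 : 1 < Monoid.exponent G := by
        have h0 : Monoid.exponent G ≠ 0 := Monoid.exponent_ne_zero_of_finite
        have h1 : Monoid.exponent G ≠ 1 := fun h =>
          not_subsingleton G (Monoid.exp_eq_one_iff.1 h)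
        omega
      have hc : Nat.card N < n := by
        rw [← hn, ← Nat.card_congr e.toEquiv, Nat.card_prod, Nat.card_zpowers, hg]
        have : 0 < Nat.card N := Nat.card_pos
        nlinarith
      obtain ⟨K, lam, h1, h2, ⟨f⟩⟩ := ih _ hc N rfl
      obtain ⟨μ, hμl, hμ⟩ : ∃ μ : Fin (K + 1) → ℕ, μ (Fin.last K) = Monoid.exponent G ∧
          lam = fun j : Fin K => μ j.castSucc :=
        ⟨Fin.snoc (α := fun _ => ℕ) lam (Monoid.exponent G), by simp, by ext j; simp⟩
      subst hμ
      have hdvd : ∀ j : Fin K, μ j.castSucc ∣ μ (Fin.last K) := fun j => by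
        rw [hμl]
        exact (dvd_exponent_of_mulEquiv f j).trans (Monoid.exponent_submonoid_dvd N.toSubmonoid)
      refine ⟨K + 1, μ, fun j => ?_, fun j k => ?_, ⟨?_⟩⟩
      · refine Fin.lastCases ?_ (fun i => h1 i) j
        rwa [hμl]
      · refine Fin.lastCases (fun _ => ?_) (fun i => ?_) k
        · refine Fin.lastCases dvd_rfl hdvd j
        · refine Fin.lastCases (fun h => ?_) (fun i' h => h2 _ _ h) j
          exact absurd h (not_le.2 (Fin.castSucc_lt_last i))
      · have hz : Subgroup.zpowers g ≃* Multiplicative (ZMod (μ (Fin.last K))) := by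
          apply mulEquivOfCyclicCardEq
          rw [Nat.card_zpowers, hg, hμl]
          simp
        exact e.symm.trans ((hz.prodCongr f).trans
          (MulEquiv.prodMultiplicative _ _ |>.symm.trans
            (AddEquiv.toMultiplicative (snocAddEquiv μ))))

/-- The number of elements of order dividing `p` which are `p ^ β`-th powers. -/
def torsionCard (p β : ℕ) (G : Type) [CommGroup G] : ℕ :=
  Nat.card {x : G // x ^ p = 1 ∧ ∃ y : G, y ^ p ^ β = x}

lemma torsionCard_congr (p β : ℕ) {G H : Type} [CommGroup G] [CommGroup H] (e : G ≃* H) :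
    torsionCard p β G = torsionCard p β H := by
  refine Nat.card_congr (e.toEquiv.subtypeEquiv fun x => ?_)
  simp only [MulEquiv.toEquiv_eq_coe, EquivLike.coe_coe, ← map_pow]
  refine and_congr (by rw [e.map_eq_one_iff]) ⟨?_, ?_⟩
  · rintro ⟨y, rfl⟩
    exact ⟨e y, by simp⟩
  · rintro ⟨y, hy⟩
    exact ⟨e.symm y, by rw [← map_pow, hy]; simp⟩

lemma torsionCard_pi (p β : ℕ) {ι : Type} [Fintype ι] (G : ι → Type) [∀ i, CommGroup (G i)] :
    torsionCard p β (∀ i, G i) = ∏ i, torsionCard p β (G i) := by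
  unfold torsionCard
  rw [← Nat.card_pi]
  refine Nat.card_congr (Equiv.trans (Equiv.subtypeEquivRight fun f => ?_)
    (Equiv.subtypePiEquivPi (p := fun i x => x ^ p = 1 ∧ ∃ y : G i, y ^ p ^ β = x)))
  constructor
  · rintro ⟨h, y, hy⟩ i
    exact ⟨congrFun h i, y i, congrFun hy i⟩
  · intro h
    choose h1 y hy using h
    exact ⟨funext h1, y, funext hy⟩

lemma torsionCard_pos (p β : ℕ) (G : Type) [CommGroup G] [Finite G] : 0 < torsionCard p β G := by
  have : Nonempty {x : G // x ^ p = 1 ∧ ∃ y : G, y ^ p ^ β = x} := ⟨⟨1, one_pow _, 1, one_pow _⟩⟩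
  exact Nat.card_pos

lemma torsionCard_le (p β : ℕ) (G : Type) [CommGroup G] [Finite G] :
    torsionCard p β G ≤ Nat.card (powMonoidHom p : G →* G).ker := by
  refine Nat.card_le_card_of_injective
    (fun x => (⟨x.1, by simpa using x.2.1⟩ : (powMonoidHom p : G →* G).ker)) ?_
  intro x y h
  simpa [Subtype.ext_iff] using h

lemma torsionCard_eq_one_of {p β : ℕ} {G : Type} [CommGroup G]
    (h : ∀ x : G, x ^ p = 1 → (∃ y : G, y ^ p ^ β = x) → x = 1) : torsionCard p β G = 1 := by
  rw [torsionCard, Nat.card_eq_one_iff_unique]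
  exact ⟨⟨fun x y => Subtype.ext ((h _ x.2.1 x.2.2).trans (h _ y.2.1 y.2.2).symm)⟩,
    ⟨⟨1, one_pow _, 1, one_pow _⟩⟩⟩

lemma torsionCard_of_isCyclic {p : ℕ} (hp : p.Prime) (β : ℕ) (G : Type) [CommGroup G] [Finite G]
    [IsCyclic G] : torsionCard p β G = if p ^ (β + 1) ∣ Nat.card G then p else 1 := by
  split_ifs with h
  · have hk : Nat.card (powMonoidHom p : G →* G).ker = p := by
      rw [IsCyclic.card_powMonoidHom_ker, Nat.gcd_eq_right]
      exact (dvd_pow_self p (Nat.succ_ne_zero β)).trans h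
    rw [← hk, hk]
    refine Eq.trans (Nat.card_congr (Equiv.subtypeEquivRight fun x => ?_)) hk
    rw [MonoidHom.mem_ker, powMonoidHom_apply, and_iff_left_iff_imp]
    intro hx
    obtain ⟨g, hg⟩ := IsCyclic.exists_generator (α := G)
    obtain ⟨k, rfl⟩ := mem_powers_iff_mem_zpowers.2 (hg x)
    have ho : orderOf g = Nat.card G := orderOf_eq_card_of_forall_mem_zpowers hg
    simp only at hx ⊢
    rw [← pow_mul] at hx
    have h2 := h.trans (ho ▸ orderOf_dvd_of_pow_eq_one hx)
    rw [pow_succ] at h2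
    obtain ⟨c, rfl⟩ := Nat.dvd_of_mul_dvd_mul_right hp.pos h2
    exact ⟨g ^ c, by rw [← pow_mul, mul_comm]⟩
  · refine torsionCard_eq_one_of fun x hx ⟨y, hy⟩ => ?_
    have h1 : orderOf y ∣ p ^ (β + 1) := by
      apply orderOf_dvd_of_pow_eq_one
      rw [pow_succ, pow_mul, hy, hx]
    obtain ⟨s, hs, hs'⟩ := (Nat.dvd_prime_pow hp).1 h1
    have : s ≠ β + 1 := by
      rintro rfl
      exact h (hs' ▸ orderOf_dvd_natCard y)
    rw [← hy]
    exact orderOf_dvd_iff_pow_eq_one.1 (hs' ▸ pow_dvd_pow p (by omega))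

lemma torsionCard_of_isInvChain {p : ℕ} (hp : p.Prime) (β : ℕ) {G : Type} [CommGroup G] {K : ℕ}
    {lam : Fin K → ℕ} (h : IsInvChain G K lam) :
    torsionCard p β G = p ^ (Finset.univ.filter fun j => p ^ (β + 1) ∣ lam j).card := by
  obtain ⟨h1, -, ⟨e⟩⟩ := h
  rw [torsionCard_congr p β (e.trans (MulEquiv.piMultiplicative _)), torsionCard_pi,
    Finset.card_eq_sum_ones, Finset.sum_filter, ← Finset.prod_pow_eq_pow_sum]
  refine Finset.prod_congr rfl fun j _ => ?_
  have : NeZero (lam j) := ⟨by have := h1 j; omega⟩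
  rw [torsionCard_of_isCyclic hp]
  simp only [Nat.card_eq_fintype_card, Fintype.card_multiplicative, ZMod.card]
  split_ifs <;> simp

lemma card_sq_eq_one_units_two_pow (a : ℕ) :
    Nat.card (powMonoidHom 2 : (ZMod (2 ^ a))ˣ →* (ZMod (2 ^ a))ˣ).ker ≤ 4 := by
  rcases a with _ | b
  · have : Subsingleton (ZMod (2 ^ 0))ˣ := by
      rw [pow_zero]; infer_instance
    exact (Finite.card_le_one_iff_subsingleton.2 inferInstance).trans (by norm_num)
  · let S : Finset (ZMod (2 ^ (b + 1))) := {1, 1 + 2 ^ b, -1, -1 + 2 ^ b}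
    have key : ∀ (ε k : ℤ), ((ε + 2 ^ b * k : ℤ) : ZMod (2 ^ (b + 1))) = ε ∨
        ((ε + 2 ^ b * k : ℤ) : ZMod (2 ^ (b + 1))) = ε + 2 ^ b := by
      intro ε k
      have hz : (2 : ZMod (2 ^ (b + 1))) ^ b * 2 = 0 := by
        rw [← pow_succ]
        exact_mod_cast ZMod.natCast_self (2 ^ (b + 1))
      rcases Int.even_or_odd' k with ⟨c, rfl | rfl⟩
      · left
        push_cast
        linear_combination (c : ZMod (2 ^ (b + 1))) * hz
      · right
        push_cast
        linear_combination (c : ZMod (2 ^ (b + 1))) * hz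
    have hS : ∀ x : (powMonoidHom 2 : (ZMod (2 ^ (b + 1)))ˣ →* (ZMod (2 ^ (b + 1)))ˣ).ker,
        ((x : (ZMod (2 ^ (b + 1)))ˣ) : ZMod (2 ^ (b + 1))) ∈ S := by
      rintro ⟨x, hx⟩
      rw [MonoidHom.mem_ker, powMonoidHom_apply] at hx
      have hx' : (x : ZMod (2 ^ (b + 1))) ^ 2 = 1 := by rw [← Units.val_pow_eq_pow_val, hx]; rfl
      obtain ⟨u, hu⟩ := ZMod.intCast_surjective (x : ZMod (2 ^ (b + 1)))
      rw [← hu] at hx'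
      have hd : (2 : ℤ) ^ (b + 1) ∣ (u - 1) * (u + 1) := by
        have : (((u - 1) * (u + 1) : ℤ) : ZMod (2 ^ (b + 1))) = 0 := by
          push_cast
          linear_combination hx'
        exact_mod_cast (ZMod.intCast_zmod_eq_zero_iff_dvd _ _).1 this
      have hodd : Odd u := by
        by_contra h
        rw [Int.not_odd_iff_even] at h
        have h2 : (2 : ℤ) ∣ (u - 1) * (u + 1) := (dvd_pow_self 2 (by omega)).trans hd
        obtain ⟨c, rfl⟩ := h
        obtain ⟨e, he⟩ := h2
        have : 2 * (2 * (c * c) - e) = 1 := by linear_combination he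
        omega
      obtain ⟨w, rfl⟩ := hodd
      rw [show (2 * w + 1 - 1) * (2 * w + 1 + 1) = 2 * (2 * (w * (w + 1))) by ring, pow_succ',
        mul_dvd_mul_iff_left (by norm_num)] at hd
      have hcop : (2 : ℤ) ^ b ∣ 2 * w ∨ (2 : ℤ) ^ b ∣ 2 * (w + 1) := by
        rcases Int.even_or_odd w with h | h
        · left
          rw [show 2 * (w * (w + 1)) = (2 * w) * (w + 1) by ring] at hd
          refine IsCoprime.dvd_of_dvd_mul_right (IsCoprime.pow_left ?_) hd
          exact ⟨-(w / 2), 1, by have := Int.even_iff.1 h; omega⟩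
        · right
          rw [show 2 * (w * (w + 1)) = (2 * (w + 1)) * w by ring] at hd
          refine IsCoprime.dvd_of_dvd_mul_right (IsCoprime.pow_left ?_) hd
          exact ⟨-(w / 2), 1, by have := Int.odd_iff.1 h; omega⟩
      rcases hcop with ⟨k, hk⟩ | ⟨k, hk⟩
      · have e : 2 * w + 1 = 1 + 2 ^ b * k := by rw [← hk]; ring
        rw [e] at hu
        rw [← hu]
        rcases key 1 k with h | h <;> rw [h] <;> simp [S]
      · have e : 2 * w + 1 = -1 + 2 ^ b * k := by rw [← hk]; ring
        rw [e] at hu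
        rw [← hu]
        rcases key (-1) k with h | h <;> rw [h] <;> simp [S]
    refine (Nat.card_le_card_of_injective (fun x => (⟨_, hS x⟩ : S)) ?_).trans ?_
    · intro x y h
      exact Subtype.ext (Units.ext (congrArg Subtype.val h))
    · rw [Nat.card_eq_fintype_card, Fintype.card_coe]
      exact Finset.card_le_four

lemma mod_eq_one_mod_iff_dvd {l Q : ℕ} (hl : 1 ≤ l) : l % Q = 1 % Q ↔ Q ∣ l - 1 := by
  rw [← Nat.modEq_iff_dvd' hl]
  exact eq_comm

lemma torsionCard_units_prime_pow {p l : ℕ} (hp : p.Prime) (hl : l.Prime) (hpl : l ≠ p) (β : ℕ)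
    {a : ℕ} (ha : 0 < a) : torsionCard p β (ZMod (l ^ a))ˣ =
      if l % p ^ (β + 1) = 1 % p ^ (β + 1) then p else 1 := by
  have : NeZero (l ^ a) := ⟨pow_ne_zero _ hl.ne_zero⟩
  have hcard : Nat.card (ZMod (l ^ a))ˣ = l ^ (a - 1) * (l - 1) := by
    rw [Nat.card_eq_fintype_card, ZMod.card_units_eq_totient, Nat.totient_prime_pow hl ha]
  have hcop : Nat.Coprime (p ^ (β + 1)) (l ^ (a - 1)) :=
    Nat.Coprime.pow _ _ ((Nat.coprime_primes hp hl).2 hpl.symm)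
  have hiff : p ^ (β + 1) ∣ Nat.card (ZMod (l ^ a))ˣ ↔ l % p ^ (β + 1) = 1 % p ^ (β + 1) := by
    rw [hcard, hcop.dvd_mul_left, mod_eq_one_mod_iff_dvd hl.one_le]
  by_cases hl2 : l = 2
  · have hn : ¬ l % p ^ (β + 1) = 1 % p ^ (β + 1) := by
      rw [mod_eq_one_mod_iff_dvd hl.one_le, hl2]
      intro h
      have : p ≤ p ^ (β + 1) := Nat.le_self_pow (Nat.succ_ne_zero β) p
      have : p ≠ 2 := fun h => hpl (hl2.trans h.symm)
      have := hp.two_le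
      have := Nat.le_of_dvd (by norm_num) h
      omega
    rw [if_neg hn]
    refine torsionCard_eq_one_of fun x hx _ => ?_
    have h1 := orderOf_dvd_of_pow_eq_one hx
    have h2 := hcard ▸ orderOf_dvd_natCard x
    rw [show l - 1 = 1 by omega, mul_one] at h2
    have h3 := Nat.dvd_gcd h1 h2
    rw [Nat.Coprime.gcd_eq_one (Nat.Coprime.pow_right _ ((Nat.coprime_primes hp hl).2 hpl.symm)),
      Nat.dvd_one, orderOf_eq_one_iff] at h3
    exact h3
  · have := ZMod.isCyclic_units_of_prime_pow l hl hl2 a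
    rw [torsionCard_of_isCyclic hp]
    simp only [hiff]

lemma torsionCard_units_self_le {p : ℕ} (hp : p.Prime) (β a : ℕ) :
    torsionCard p β (ZMod (p ^ a))ˣ ≤ p ^ 2 := by
  have : NeZero (p ^ a) := ⟨pow_ne_zero _ hp.ne_zero⟩
  refine (torsionCard_le p β _).trans ?_
  by_cases h2 : p = 2
  · subst h2
    exact card_sq_eq_one_units_two_pow a
  · have := ZMod.isCyclic_units_of_prime_pow p hp h2 a
    rw [IsCyclic.card_powMonoidHom_ker]
    exact (Nat.gcd_le_right _ hp.pos).trans (Nat.le_self_pow (by norm_num) p)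

/-- The number of invariant factors of `(ℤ/mℤ)ˣ` divisible by a prime power `Q` is
`ω(m;Q,1)` up to an additive constant. -/
theorem omegaQ_le_card_dvd {m : ℕ} (hm : m ≠ 0) {K : ℕ} {lam : Fin K → ℕ}
    (h : IsInvChain (ZMod m)ˣ K lam) {Q : ℕ} (hQ : IsPrimePow Q) :
    omegaQ m Q ≤ (Finset.univ.filter fun j => Q ∣ lam j).card ∧
      (Finset.univ.filter fun j => Q ∣ lam j).card ≤ omegaQ m Q + 2 := by
  obtain ⟨p, k, hp, hk, rfl⟩ := (isPrimePow_nat_iff _).1 hQ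
  obtain ⟨β, rfl⟩ := Nat.exists_eq_succ_of_ne_zero hk.ne'
  rw [Nat.succ_eq_add_one]
  have e := torsionCard_of_isInvChain hp β h
  rw [torsionCard_congr p β ((Units.mapEquiv (ZMod.equivPi m hm).toMulEquiv).trans
    MulEquiv.piUnits), torsionCard_pi, Finset.prod_coe_sort m.primeFactors
    (fun l => torsionCard p β (ZMod (l ^ m.factorization l))ˣ)] at e
  have hω : p ^ omegaQ m (p ^ (β + 1)) =
      ∏ l ∈ m.primeFactors, if l % p ^ (β + 1) = 1 % p ^ (β + 1) then p else 1 := by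
    rw [omegaQ, Finset.prod_ite, Finset.prod_const, Finset.prod_const_one, mul_one]
  have hpp : ¬ p % p ^ (β + 1) = 1 % p ^ (β + 1) := by
    rw [mod_eq_one_mod_iff_dvd hp.one_le]
    intro h
    have h1 := Nat.le_of_dvd (by have := hp.two_le; omega) ((dvd_pow_self p (Nat.succ_ne_zero β)).trans h)
    have := hp.pos
    omega
  have hfac : ∀ l ∈ m.primeFactors, l.Prime ∧ 0 < m.factorization l := fun l hl =>
    ⟨Nat.prime_of_mem_primeFactors hl, Nat.Prime.factorization_pos_of_dvd
      (Nat.prime_of_mem_primeFactors hl) hm (Nat.dvd_of_mem_primeFactors hl)⟩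
  constructor
  · rw [← Nat.pow_le_pow_iff_right hp.one_lt, ← e, hω]
    refine Finset.prod_le_prod' fun l hl => ?_
    by_cases hlp : l = p
    · rw [hlp, if_neg hpp]
      have : NeZero (p ^ m.factorization p) := ⟨pow_ne_zero _ hp.ne_zero⟩
      exact torsionCard_pos p β _
    · rw [torsionCard_units_prime_pow hp (hfac l hl).1 hlp β (hfac l hl).2]
  · rw [← Nat.pow_le_pow_iff_right hp.one_lt, ← e, pow_add, hω]
    have h2 : (∏ l ∈ m.primeFactors, if l = p then p ^ 2 else 1) ≤ p ^ 2 := by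
      rw [Finset.prod_ite_eq']
      split_ifs
      · exact le_rfl
      · exact Nat.one_le_pow _ _ hp.pos
    refine le_trans ?_ (Nat.mul_le_mul_left _ h2)
    rw [← Finset.prod_mul_distrib]
    refine Finset.prod_le_prod' fun l hl => ?_
    by_cases hlp : l = p
    · rw [hlp, if_neg hpp, if_pos rfl, one_mul]
      exact torsionCard_units_self_le hp β _
    · rw [torsionCard_units_prime_pow hp (hfac l hl).1 hlp β (hfac l hl).2, if_neg hlp, mul_one]

lemma card_chain_filter {K : ℕ} {lam : Fin K → ℕ} (hlam : ∀ j k : Fin K, j ≤ k → lam j ∣ lam k)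
    {q q' : ℕ} (h : (Finset.univ.filter fun j => q ∣ lam j).card ≤
      (Finset.univ.filter fun j => q' ∣ lam j).card) :
    (Finset.univ.filter fun j => q ∣ lam j) ⊆ (Finset.univ.filter fun j => q' ∣ lam j) := by
  intro j hj
  by_contra hj'
  simp only [Finset.mem_filter, Finset.mem_univ, true_and] at hj hj'
  have h1 : (Finset.univ.filter fun j => q' ∣ lam j) ⊂ (Finset.univ.filter fun j => q ∣ lam j) := by
    rw [Finset.ssubset_iff_of_subset]
    · exact ⟨j, by simpa using hj, by simpa using hj'⟩
    · intro k hk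
      simp only [Finset.mem_filter, Finset.mem_univ, true_and] at hk ⊢
      rcases le_total j k with h | h
      · exact hj.trans (hlam _ _ h)
      · exact absurd (hk.trans (hlam _ _ h)) hj'
  exact absurd (Finset.card_lt_card h1) (not_lt.2 h)

lemma eq_of_primePow_dvd_iff {a b : ℕ}
    (h : ∀ Q, IsPrimePow Q → (Q ∣ a ↔ Q ∣ b)) : a = b := by
  have key : ∀ p k : ℕ, p.Prime → (p ^ k ∣ a ↔ p ^ k ∣ b) := by
    intro p k hp
    rcases Nat.eq_zero_or_pos k with rfl | hk
    · simp
    · exact h _ (hp.isPrimePow.pow hk.ne')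
  exact Nat.dvd_antisymm
    ((Nat.dvd_iff_prime_pow_dvd_dvd _ _).2 fun p k hp hpk => (key p k hp).1 hpk)
    ((Nat.dvd_iff_prime_pow_dvd_dvd _ _).2 fun p k hp hpk => (key p k hp).2 hpk)

/-- The number of invariant factors equal to `d`, if the divisibility pattern of the chain is
ordered by the totients of the prime powers. -/
theorem card_filter_eq_sub {K : ℕ} {lam : Fin K → ℕ}
    (hlam : ∀ j k : Fin K, j ≤ k → lam j ∣ lam k) {v q q' d : ℕ}
    (hq : IsPrimePow q) (hq' : IsPrimePow q') (hqq : q ≠ q')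
    (hqv : q.totient = v) (hqv' : q'.totient = v)
    (huniq : ∀ Q, IsPrimePow Q → Q.totient = v → Q = q ∨ Q = q')
    (hd : ∀ Q, IsPrimePow Q → (Q ∣ d ↔ Q.totient < v ∨ Q = q))
    (hlow : ∀ Q, IsPrimePow Q → Q.totient < v →
      (Finset.univ.filter fun j => q ∣ lam j).card ≤ (Finset.univ.filter fun j => Q ∣ lam j).card)
    (hhigh : ∀ Q, IsPrimePow Q → v < Q.totient →
      (Finset.univ.filter fun j => Q ∣ lam j).card ≤ (Finset.univ.filter fun j => q' ∣ lam j).card) :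
    (Finset.univ.filter fun j => lam j = d).card =
      (Finset.univ.filter fun j => q ∣ lam j).card -
        (Finset.univ.filter fun j => q' ∣ lam j).card := by
  have key : (Finset.univ.filter fun j => lam j = d) =
      (Finset.univ.filter fun j => q ∣ lam j) \ (Finset.univ.filter fun j => q' ∣ lam j) := by
    ext j
    simp only [Finset.mem_filter, Finset.mem_univ, true_and, Finset.mem_sdiff]
    constructor
    · intro h
      rw [h]
      refine ⟨(hd q hq).2 (Or.inr rfl), fun h' => ?_⟩
      rcases (hd q' hq').1 h' with h' | h'
      · omega
      · exact hqq h'.symm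
    · rintro ⟨ha, hb⟩
      refine eq_of_primePow_dvd_iff fun Q hQ => ?_
      rw [hd Q hQ]
      constructor
      · intro hQj
        rcases lt_trichotomy Q.totient v with h | h | h
        · exact Or.inl h
        · rcases huniq Q hQ h with rfl | rfl
          · exact Or.inr rfl
          · exact absurd hQj hb
        · have := card_chain_filter hlam (hhigh Q hQ h) (by simpa using hQj : j ∈ _)
          exact absurd (by simpa using this) hb
      · rintro (h | rfl)
        · simpa using card_chain_filter hlam (hlow Q hQ h) (by simpa using ha : j ∈ _)
        · exact ha
  rw [key]
  by_cases h : (Finset.univ.filter fun j => q ∣ lam j).card ≤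
      (Finset.univ.filter fun j => q' ∣ lam j).card
  · rw [Finset.sdiff_eq_empty_iff_subset.2 (card_chain_filter hlam h), Finset.card_empty]
    omega
  · exact Finset.card_sdiff_of_subset (card_chain_filter hlam (by omega))

open Classical in
lemma cnt_eq_card (P : ℕ → Prop) (n : ℕ) : cnt P n = ((Finset.Icc 1 n).filter P).card := by
  rw [cnt, ← Set.ncard_coe_finset]
  congr 1
  ext m
  simp [and_assoc]

lemma cnt_mono {P Q : ℕ → Prop} {n : ℕ} (h : ∀ m, 1 ≤ m → m ≤ n → P m → Q m) :
    cnt P n ≤ cnt Q n := by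
  classical
  rw [cnt_eq_card, cnt_eq_card]
  refine Finset.card_le_card fun m hm => ?_
  simp only [Finset.mem_filter, Finset.mem_Icc] at hm ⊢
  exact ⟨hm.1, h m hm.1.1 hm.1.2 hm.2⟩

lemma cnt_or_le (P Q : ℕ → Prop) (n : ℕ) : cnt (fun m => P m ∨ Q m) n ≤ cnt P n + cnt Q n := by
  classical
  rw [cnt_eq_card, cnt_eq_card, cnt_eq_card]
  refine (Finset.card_le_card fun m hm => ?_).trans (Finset.card_union_le _ _)
  simp only [Finset.mem_filter, Finset.mem_union] at hm ⊢
  tauto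

lemma cnt_exists_le {ι : Type*} (s : Finset ι) (P : ι → ℕ → Prop) (n : ℕ) :
    cnt (fun m => ∃ i ∈ s, P i m) n ≤ ∑ i ∈ s, cnt (P i) n := by
  classical
  simp only [cnt_eq_card]
  refine le_trans (Finset.card_le_card fun m hm => ?_) Finset.card_biUnion_le
  simp only [Finset.mem_filter, Finset.mem_biUnion] at hm ⊢
  obtain ⟨h1, i, hi, h2⟩ := hm
  exact ⟨i, hi, h1, h2⟩

/-- A family of properties, the `n`-th of which holds for `o(n)` of the integers up to `n`. -/
def Negligible (P : ℕ → ℕ → Prop) : Prop :=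
  Tendsto (fun n : ℕ => (cnt (P n) n : ℝ) / n) atTop (nhds 0)

lemma negligible_of_le {P : ℕ → ℕ → Prop} {g : ℕ → ℝ} (hg : Tendsto g atTop (nhds 0))
    (h : ∀ᶠ n in atTop, (cnt (P n) n : ℝ) ≤ n * g n) : Negligible P := by
  refine squeeze_zero' (Eventually.of_forall fun n => by positivity) ?_ hg
  filter_upwards [h, eventually_gt_atTop 0] with n hn h0
  have : (0 : ℝ) < n := by exact_mod_cast h0
  rw [div_le_iff₀ this]
  linarith

lemma Negligible.mono {P Q : ℕ → ℕ → Prop} (hQ : Negligible Q)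
    (h : ∀ᶠ n in atTop, ∀ m, 1 ≤ m → m ≤ n → P n m → Q n m) : Negligible P := by
  refine squeeze_zero' (Eventually.of_forall fun n => by positivity) ?_ hQ
  filter_upwards [h] with n hn
  gcongr
  exact cnt_mono hn

lemma Negligible.or {P Q : ℕ → ℕ → Prop} (hP : Negligible P) (hQ : Negligible Q) :
    Negligible (fun n m => P n m ∨ Q n m) := by
  have h := Tendsto.add hP hQ
  rw [add_zero] at h
  refine squeeze_zero (fun n => by positivity) (fun n => ?_) h
  rw [← add_div]
  gcongr
  exact_mod_cast cnt_or_le _ _ _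

lemma Negligible.exists {ι : Type*} (s : Finset ι) {P : ι → ℕ → ℕ → Prop}
    (h : ∀ i ∈ s, Negligible (P i)) : Negligible (fun n m => ∃ i ∈ s, P i n m) := by
  have h2 : Tendsto (fun n : ℕ => ∑ i ∈ s, (cnt (P i n) n : ℝ) / n) atTop (nhds 0) := by
    simpa using tendsto_finsetSum s h
  refine squeeze_zero (fun n => by positivity) (fun n => ?_) h2
  rw [← Finset.sum_div]
  gcongr
  exact_mod_cast cnt_exists_le s (fun i => P i n) n

lemma cnt_mul_le_sum (P : ℕ → Prop) (n : ℕ) {c : ℝ} (f : ℕ → ℝ) (hf : ∀ m, 0 ≤ f m)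
    (h : ∀ m, 1 ≤ m → m ≤ n → P m → c ≤ f m) : cnt P n * c ≤ ∑ m ∈ Finset.Icc 1 n, f m := by
  classical
  rw [cnt_eq_card, ← nsmul_eq_mul]
  refine (Finset.card_nsmul_le_sum _ f c fun m hm => ?_).trans
    (Finset.sum_le_sum_of_subset_of_nonneg (Finset.filter_subset _ _) fun m _ _ => hf m)
  simp only [Finset.mem_filter, Finset.mem_Icc] at hm
  exact h m hm.1.1 hm.1.2 hm.2

/-- The primes `p ≤ n` with `p ≡ 1 (mod q)`. -/
def primesOne (q n : ℕ) : Finset ℕ :=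
  (Finset.range (n + 1)).filter fun p => p.Prime ∧ p % q = 1 % q

lemma mem_primesOne {q n p : ℕ} : p ∈ primesOne q n ↔ p ≤ n ∧ p.Prime ∧ p % q = 1 % q := by
  simp [primesOne]

lemma primeRecip_eq_sum (q n : ℕ) : primeRecip q n = ∑ p ∈ primesOne q n, (1 : ℝ) / p := rfl

lemma card_filter_dvd (n d : ℕ) : ((Finset.Icc 1 n).filter fun m => d ∣ m).card = n / d := by
  have : Finset.Icc 1 n = Finset.Ioc 0 n := by ext; simp [Nat.succ_le_iff]
  rw [this, Nat.Ioc_filter_dvd_card_eq_div]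

lemma omegaQ_eq_sum {m n q : ℕ} (hm : 1 ≤ m) (hmn : m ≤ n) :
    (omegaQ m q : ℝ) = ∑ p ∈ primesOne q n, if p ∣ m then (1 : ℝ) else 0 := by
  rw [← Finset.sum_filter, Finset.sum_const, nsmul_eq_mul, mul_one, omegaQ]
  congr 2
  ext p
  simp only [Finset.mem_filter, Nat.mem_primeFactors, mem_primesOne]
  constructor
  · rintro ⟨⟨a, b, c⟩, d⟩
    exact ⟨⟨(Nat.le_of_dvd hm b).trans hmn, a, d⟩, b⟩
  · rintro ⟨⟨a, b, c⟩, d⟩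
    exact ⟨⟨b, d, by omega⟩, c⟩

lemma sum_prod_one_add {R : Type*} [CommRing R] (s : Finset ℕ) (hs : ∀ p ∈ s, p.Prime)
    (z : ℕ → R) (n : ℕ) :
    ∑ m ∈ Finset.Icc 1 n, ∏ p ∈ s, (1 + if p ∣ m then z p else 0) =
      ∑ t ∈ s.powerset, (∏ p ∈ t, z p) * ((n / ∏ p ∈ t, p : ℕ) : R) := by
  simp_rw [Finset.prod_one_add]
  rw [Finset.sum_comm]
  refine Finset.sum_congr rfl fun t ht => ?_
  have htp : ∀ p ∈ t, p.Prime := fun p hp => hs p (Finset.mem_powerset.1 ht hp)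
  have hdvd : ∀ m, (∀ p ∈ t, p ∣ m) ↔ ∏ p ∈ t, p ∣ m := fun m =>
    ⟨fun h => Finset.prod_primes_dvd m (fun p hp => (htp p hp).prime) h,
      fun h p hp => (Finset.dvd_prod_of_mem _ hp).trans h⟩
  simp_rw [Finset.prod_ite_zero, hdvd]
  rw [← Finset.sum_filter, Finset.sum_const, card_filter_dvd, nsmul_eq_mul, mul_comm]

lemma sum_prod_one_add_le (s : Finset ℕ) (hs : ∀ p ∈ s, p.Prime) {c : ℝ} (hc : 0 ≤ c) (n : ℕ) :
    ∑ m ∈ Finset.Icc 1 n, ∏ p ∈ s, (1 + if p ∣ m then c else 0) ≤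
      n * Real.exp (c * ∑ p ∈ s, (1 : ℝ) / p) := by
  rw [sum_prod_one_add s hs]
  calc ∑ t ∈ s.powerset, (∏ p ∈ t, c) * ((n / ∏ p ∈ t, p : ℕ) : ℝ)
      ≤ ∑ t ∈ s.powerset, n * ∏ p ∈ t, (c / p) := by
        refine Finset.sum_le_sum fun t _ => ?_
        rw [Finset.prod_div_distrib, ← mul_div_assoc, mul_comm (n : ℝ), mul_div_assoc]
        refine mul_le_mul_of_nonneg_left ?_ (by positivity)
        exact Nat.cast_div_le.trans (by push_cast; exact le_rfl)
    _ = n * ∏ p ∈ s, (1 + c / p) := by rw [← Finset.mul_sum, Finset.prod_one_add]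
    _ ≤ _ := by
        gcongr
        rw [Finset.mul_sum, Real.exp_sum]
        refine Finset.prod_le_prod (fun p _ => by positivity) fun p _ => ?_
        rw [mul_one_div, add_comm]
        exact Real.add_one_le_exp _

/-- Exponential moments of `ω(m;q,1)`. -/
lemma sum_exp_omegaQ_le (q n : ℕ) {t : ℝ} (ht : 0 ≤ t) :
    ∑ m ∈ Finset.Icc 1 n, Real.exp (t * omegaQ m q) ≤
      n * Real.exp ((Real.exp t - 1) * primeRecip q n) := by
  have h := sum_prod_one_add_le (primesOne q n) (fun p hp => (mem_primesOne.1 hp).2.1)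
    (c := Real.exp t - 1) (by linarith [Real.add_one_le_exp t]) n
  rw [← primeRecip_eq_sum] at h
  refine le_trans (Finset.sum_le_sum fun m hm => ?_) h
  rw [Finset.mem_Icc] at hm
  rw [omegaQ_eq_sum hm.1 hm.2, Finset.mul_sum, Real.exp_sum]
  refine (Finset.prod_congr rfl fun p _ => ?_).le
  split_ifs <;> simp

/-- Turán's variance bound. -/
lemma sum_sq_omegaQ_sub_le (q n : ℕ) :
    ∑ m ∈ Finset.Icc 1 n, ((omegaQ m q : ℝ) - primeRecip q n) ^ 2 ≤ 3 * n * primeRecip q n := by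
  set S := primeRecip q n with hS
  have hS0 : 0 ≤ S := Finset.sum_nonneg fun p _ => by positivity
  have h1 : n * S - n ≤ ∑ m ∈ Finset.Icc 1 n, (omegaQ m q : ℝ) := by
    have e : ∑ m ∈ Finset.Icc 1 n, (omegaQ m q : ℝ) = ∑ p ∈ primesOne q n, ((n / p : ℕ) : ℝ) := by
      rw [Finset.sum_congr rfl fun m hm => omegaQ_eq_sum (Finset.mem_Icc.1 hm).1
        (Finset.mem_Icc.1 hm).2, Finset.sum_comm]
      refine Finset.sum_congr rfl fun p _ => ?_
      rw [← Finset.sum_filter, Finset.sum_const, card_filter_dvd, nsmul_eq_mul, mul_one]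
    rw [e]
    have hc : ((primesOne q n).card : ℝ) ≤ n := by
      have : primesOne q n ⊆ Finset.Icc 1 n := fun p hp => by
        rw [mem_primesOne] at hp
        exact Finset.mem_Icc.2 ⟨hp.2.1.one_le, hp.1⟩
      exact_mod_cast (Finset.card_le_card this).trans (by simp)
    calc n * S - n ≤ n * S - (primesOne q n).card := by linarith
      _ = ∑ p ∈ primesOne q n, ((n : ℝ) / p - 1) := by
        rw [Finset.sum_sub_distrib, hS, primeRecip_eq_sum, Finset.mul_sum]
        simp [div_eq_mul_inv]
      _ ≤ _ := by
        refine Finset.sum_le_sum fun p hp => ?_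
        rw [← Nat.floor_div_eq_div (K := ℝ)]
        linarith [Nat.lt_floor_add_one ((n : ℝ) / p)]
  have h2 : ∑ m ∈ Finset.Icc 1 n, (omegaQ m q : ℝ) ^ 2 ≤ n * (S ^ 2 + S) := by
    have e : ∑ m ∈ Finset.Icc 1 n, (omegaQ m q : ℝ) ^ 2 =
        ∑ p ∈ primesOne q n, ∑ r ∈ primesOne q n, ∑ m ∈ Finset.Icc 1 n,
          (if p ∣ m ∧ r ∣ m then (1 : ℝ) else 0) := by
      rw [Finset.sum_congr rfl fun m hm => by
        rw [omegaQ_eq_sum (Finset.mem_Icc.1 hm).1 (Finset.mem_Icc.1 hm).2, sq, Finset.sum_mul_sum]]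
      rw [Finset.sum_comm]
      refine Finset.sum_congr rfl fun p _ => ?_
      rw [Finset.sum_comm]
      refine Finset.sum_congr rfl fun r _ => Finset.sum_congr rfl fun m _ => ?_
      by_cases a : p ∣ m <;> by_cases b : r ∣ m <;> simp [a, b]
    rw [e]
    have hb : ∀ p ∈ primesOne q n, ∀ r ∈ primesOne q n, ∑ m ∈ Finset.Icc 1 n,
        (if p ∣ m ∧ r ∣ m then (1 : ℝ) else 0) ≤
          n * ((1 : ℝ) / p * (1 / r) + if p = r then (1 : ℝ) / p else 0) := by
      intro p hp r hr
      have hp' := (mem_primesOne.1 hp).2.1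
      have hr' := (mem_primesOne.1 hr).2.1
      rw [← Finset.sum_filter, Finset.sum_const, nsmul_eq_mul, mul_one]
      by_cases hpr : p = r
      · subst hpr
        simp only [and_self, if_true, card_filter_dvd]
        calc ((n / p : ℕ) : ℝ) ≤ n / p := Nat.cast_div_le
          _ = n * (1 / p) := by ring
          _ ≤ _ := by
            refine mul_le_mul_of_nonneg_left ?_ (by positivity)
            have : (0 : ℝ) ≤ 1 / p * (1 / p) := by positivity
            linarith
      · have hd : ∀ m, (p ∣ m ∧ r ∣ m) ↔ p * r ∣ m := fun m =>
          ⟨fun h => ((Nat.coprime_primes hp' hr').2 hpr).mul_dvd_of_dvd_of_dvd h.1 h.2,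
            fun h => ⟨(dvd_mul_right _ _).trans h, (dvd_mul_left _ _).trans h⟩⟩
        simp only [hd, card_filter_dvd, if_neg hpr, add_zero]
        refine Nat.cast_div_le.trans (le_of_eq ?_)
        push_cast
        ring
    refine (Finset.sum_le_sum fun p hp => Finset.sum_le_sum fun r hr => hb p hp r hr).trans
      (le_of_eq ?_)
    simp_rw [← Finset.mul_sum, Finset.sum_add_distrib]
    rw [← Finset.sum_mul_sum, ← primeRecip_eq_sum, ← hS, ← sq]
    congr 2
    rw [hS, primeRecip_eq_sum]
    refine Finset.sum_congr rfl fun p hp => ?_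
    rw [Finset.sum_ite_eq, if_pos hp]
  have e : ∑ m ∈ Finset.Icc 1 n, ((omegaQ m q : ℝ) - S) ^ 2 =
      ∑ m ∈ Finset.Icc 1 n, (omegaQ m q : ℝ) ^ 2 - 2 * S * ∑ m ∈ Finset.Icc 1 n, (omegaQ m q : ℝ)
        + n * S ^ 2 := by
    simp_rw [sub_sq]
    rw [Finset.sum_add_distrib, Finset.sum_sub_distrib, ← Finset.sum_mul, ← Finset.mul_sum]
    simp
    ring
  rw [e]
  nlinarith

lemma tendsto_log_natCast : Tendsto (fun n : ℕ => Real.log n) atTop atTop :=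
  Real.tendsto_log_atTop.comp tendsto_natCast_atTop_atTop

lemma tendsto_LL : Tendsto LL atTop atTop := Real.tendsto_log_atTop.comp tendsto_log_natCast

lemma exp_LL {n : ℕ} (hn : 2 ≤ n) : Real.exp (LL n) = Real.log n :=
  Real.exp_log (Real.log_pos (by exact_mod_cast hn))

/-- The normal order of `ω(m;q,1)`. -/
theorem omegaQ_normal_order {q : ℕ} (hq : 0 < q) {ε : ℝ} (hε : 0 < ε) :
    Negligible fun n m => ε * LL n ≤ |(omegaQ m q : ℝ) - LL n / q.totient| := by
  have : NeZero q := ⟨hq.ne'⟩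
  obtain ⟨C, hC0, hC⟩ := primeRecip_asymp q
  have hφ : (1 : ℝ) ≤ q.totient := by exact_mod_cast Nat.totient_pos.2 hq
  have hg : Tendsto (fun n => 24 / ε ^ 2 * (LL n)⁻¹) atTop (nhds 0) := by
    simpa using (tendsto_inv_atTop_zero.comp tendsto_LL).const_mul (24 / ε ^ 2)
  refine negligible_of_le hg ?_
  filter_upwards [eventually_ge_atTop 3, tendsto_LL.eventually_ge_atTop 1,
    tendsto_LL.eventually_ge_atTop (2 * C / ε), tendsto_LL.eventually_ge_atTop C]
    with n hn h1 h2 h3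
  have h4 := abs_le.1 (hC n hn)
  have h5 : LL n / q.totient ≤ LL n := div_le_self (by linarith) hφ
  rw [div_le_iff₀ hε] at h2
  have hmain := cnt_mul_le_sum (fun m => ε * LL n ≤ |(omegaQ m q : ℝ) - LL n / q.totient|) n
    (c := (ε * LL n / 2) ^ 2) (fun m => ((omegaQ m q : ℝ) - primeRecip q n) ^ 2)
    (fun m => sq_nonneg _) (fun m _ _ hm => by
      rw [← sq_abs ((omegaQ m q : ℝ) - primeRecip q n)]
      refine pow_le_pow_left₀ (by positivity) ?_ 2
      have : |(omegaQ m q : ℝ) - LL n / q.totient| ≤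
          |(omegaQ m q : ℝ) - primeRecip q n| + |primeRecip q n - LL n / q.totient| :=
        abs_sub_le _ _ _
      have := hC n hn
      linarith)
  have h6 := hmain.trans (sum_sq_omegaQ_sub_le q n)
  have hL : 0 < LL n := by linarith
  have h7 : 3 * n * primeRecip q n ≤ n * (6 * LL n) := by
    have : primeRecip q n ≤ 2 * LL n := by linarith
    nlinarith [Nat.cast_nonneg (α := ℝ) n]
  have h8 : (0 : ℝ) < (ε * LL n / 2) ^ 2 := by positivity
  have h9 := (le_div_iff₀ h8).2 (h6.trans h7)
  refine h9.trans (le_of_eq ?_)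
  field_simp
  ring

lemma primeRecip_le_log_div {p n : ℕ} (hp : 2 ≤ p) :
    primeRecip p n ≤ (1 + Real.log n) / p := by
  have hp0 : (0 : ℝ) < p := by exact_mod_cast (by omega : 0 < p)
  have hmem : ∀ l ∈ primesOne p n, l = p * ((l - 1) / p) + 1 ∧ 1 ≤ (l - 1) / p := by
    intro l hl
    rw [mem_primesOne] at hl
    have h1 := (mod_eq_one_mod_iff_dvd hl.2.1.one_le).1 hl.2.2
    have h2 := Nat.mul_div_cancel' h1
    have := hl.2.1.two_le
    refine ⟨by omega, ?_⟩
    rw [Nat.one_le_div_iff (by omega)]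
    exact Nat.le_of_dvd (by omega) h1
  have hinj : Set.InjOn (fun l => (l - 1) / p) (primesOne p n : Set ℕ) := by
    intro a ha b hb hab
    rw [(hmem a ha).1, (hmem b hb).1]
    simp only at hab
    rw [hab]
  calc primeRecip p n ≤ ∑ l ∈ primesOne p n, (1 / (p : ℝ)) * (1 / (((l - 1) / p : ℕ) : ℝ)) := by
        rw [primeRecip_eq_sum]
        refine Finset.sum_le_sum fun l hl => ?_
        obtain ⟨h1, h2⟩ := hmem l hl
        have h2' : (1 : ℝ) ≤ (((l - 1) / p : ℕ) : ℝ) := by exact_mod_cast h2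
        have h1' : (l : ℝ) = p * (((l - 1) / p : ℕ) : ℝ) + 1 := by exact_mod_cast h1
        rw [h1', one_div_mul_one_div]
        exact one_div_le_one_div_of_le (by positivity) (by linarith)
    _ = (1 / (p : ℝ)) * ∑ k ∈ (primesOne p n).image (fun l => (l - 1) / p), 1 / (k : ℝ) := by
        rw [Finset.sum_image hinj, Finset.mul_sum]
    _ ≤ (1 / (p : ℝ)) * ∑ k ∈ Finset.Icc 1 n, 1 / (k : ℝ) := by
        refine mul_le_mul_of_nonneg_left ?_ (by positivity)
        refine Finset.sum_le_sum_of_subset_of_nonneg ?_ fun k _ _ => by positivity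
        intro k hk
        obtain ⟨l, hl, rfl⟩ := Finset.mem_image.1 hk
        refine Finset.mem_Icc.2 ⟨(hmem l hl).2, (Nat.div_le_self _ _).trans ?_⟩
        have := (mem_primesOne.1 hl).1
        omega
    _ ≤ (1 / (p : ℝ)) * (1 + Real.log n) := by
        refine mul_le_mul_of_nonneg_left ?_ (by positivity)
        have h := harmonic_le_one_add_log n
        rw [harmonic_eq_sum_Icc] at h
        push_cast at h
        simpa [one_div] using h
    _ = _ := by ring

lemma cnt_two_le_omegaQ {p n : ℕ} {T : ℝ} (hT : 0 < T) (h : primeRecip p n ≤ T) :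
    (cnt (fun m => 2 ≤ omegaQ m p) n : ℝ) ≤ n * (Real.exp 1 * T ^ 2) := by
  have hpos : 0 < 1 + 1 / T := by positivity
  have ht : 0 ≤ Real.log (1 + 1 / T) := Real.log_nonneg (by
    have : 0 < 1 / T := by positivity
    linarith)
  have h1 := cnt_mul_le_sum (fun m => 2 ≤ omegaQ m p) n (c := (1 + 1 / T) ^ 2)
    (fun m => Real.exp (Real.log (1 + 1 / T) * omegaQ m p)) (fun m => (Real.exp_pos _).le)
    (fun m _ _ hm => by
      have hm' : (2 : ℝ) ≤ omegaQ m p := by exact_mod_cast hm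
      calc (1 + 1 / T) ^ 2 = Real.exp (Real.log (1 + 1 / T) * 2) := by
            rw [mul_two, Real.exp_add, Real.exp_log hpos, sq]
        _ ≤ _ := Real.exp_le_exp.2 (mul_le_mul_of_nonneg_left hm' ht))
  have h2 := h1.trans (sum_exp_omegaQ_le p n ht)
  rw [Real.exp_log hpos, add_sub_cancel_left] at h2
  have h3 : Real.exp (1 / T * primeRecip p n) ≤ Real.exp 1 := by
    refine Real.exp_le_exp.2 ?_
    rw [one_div_mul_eq_div, div_le_one hT]
    exact h
  have h4 : (1 / T) ^ 2 ≤ (1 + 1 / T) ^ 2 := pow_le_pow_left₀ (by positivity) (by linarith) 2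
  have h5 : (cnt (fun m => 2 ≤ omegaQ m p) n : ℝ) * (1 / T) ^ 2 ≤ n * Real.exp 1 :=
    (mul_le_mul_of_nonneg_left h4 (Nat.cast_nonneg _)).trans
      (h2.trans (mul_le_mul_of_nonneg_left h3 (Nat.cast_nonneg _)))
  rw [div_pow, one_pow, mul_one_div, div_le_iff₀ (by positivity)] at h5
  linarith

lemma negligible_omegaQ_huge_prime : Negligible fun n m =>
    ∃ p : ℕ, p.Prime ∧ (Real.log n) ^ 3 < p ∧ 2 ≤ omegaQ m p := by
  have hg : Tendsto (fun n : ℕ => 8 * Real.exp 1 * (Real.log n)⁻¹) atTop (nhds 0) := by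
    simpa using (tendsto_inv_atTop_zero.comp tendsto_log_natCast).const_mul (8 * Real.exp 1)
  refine negligible_of_le hg ?_
  filter_upwards [tendsto_log_natCast.eventually_ge_atTop 2] with n hL
  set L := Real.log n with hLdef
  set k := ⌊L ^ 3⌋₊ with hk
  have hL3 : 8 ≤ L ^ 3 := by
    have := pow_le_pow_left₀ (by norm_num) hL 3
    linarith
  have hk1 : L ^ 3 / 2 ≤ k := by
    have := Nat.lt_floor_add_one (L ^ 3)
    rw [← hk] at this
    linarith
  have hk0 : (0 : ℝ) < k := by linarith
  have hk0' : k ≠ 0 := by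
    intro h
    rw [h] at hk0
    simp at hk0
  have h1 : cnt (fun m => ∃ p : ℕ, p.Prime ∧ L ^ 3 < p ∧ 2 ≤ omegaQ m p) n ≤
      cnt (fun m => ∃ p ∈ (Finset.Ioc k n).filter Nat.Prime, 2 ≤ omegaQ m p) n := by
    refine cnt_mono fun m hm1 hmn ⟨p, hp, hpL, hω⟩ => ⟨p, ?_, hω⟩
    rw [Finset.mem_filter, Finset.mem_Ioc]
    refine ⟨⟨(Nat.floor_lt (by positivity)).2 hpL, ?_⟩, hp⟩
    obtain ⟨l, hl⟩ := Finset.card_pos.1 (show 0 < omegaQ m p by omega)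
    rw [Finset.mem_filter, Nat.mem_primeFactors] at hl
    have h3 := (mod_eq_one_mod_iff_dvd hl.1.1.one_le).1 hl.2
    have h4 := Nat.le_of_dvd (by have := hl.1.1.two_le; omega) h3
    have h5 := Nat.le_of_dvd hm1 hl.1.2.1
    omega
  have h2 := h1.trans (cnt_exists_le _ (fun p m => 2 ≤ omegaQ m p) n)
  have h3 : (cnt (fun m => ∃ p : ℕ, p.Prime ∧ L ^ 3 < p ∧ 2 ≤ omegaQ m p) n : ℝ) ≤
      ∑ p ∈ (Finset.Ioc k n).filter Nat.Prime, n * (Real.exp 1 * ((1 + L) / p) ^ 2) := by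
    refine (Nat.cast_le.2 h2).trans ?_
    push_cast
    refine Finset.sum_le_sum fun p hp => ?_
    have hp' := (Finset.mem_filter.1 hp).2
    have : (0 : ℝ) < p := by exact_mod_cast hp'.pos
    exact cnt_two_le_omegaQ (by positivity) (primeRecip_le_log_div hp'.two_le)
  have h4 : ∑ p ∈ (Finset.Ioc k n).filter Nat.Prime, n * (Real.exp 1 * ((1 + L) / p) ^ 2) ≤
      n * (Real.exp 1 * (1 + L) ^ 2) * ∑ p ∈ Finset.Ioc k n, ((p : ℝ) ^ 2)⁻¹ := by
    rw [Finset.mul_sum]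
    refine (Finset.sum_le_sum_of_subset_of_nonneg (Finset.filter_subset _ _)
      fun p _ _ => by positivity).trans (le_of_eq (Finset.sum_congr rfl fun p _ => ?_))
    rw [div_pow]
    ring
  have h5 : ∑ p ∈ Finset.Ioc k n, ((p : ℝ) ^ 2)⁻¹ ≤ 2 / L ^ 3 := by
    by_cases hkn : k ≤ n
    · have := sum_Ioc_inv_sq_le_sub (α := ℝ) hk0' hkn
      have h6 : (k : ℝ)⁻¹ ≤ 2 / L ^ 3 := by
        rw [inv_eq_one_div, div_le_div_iff₀ hk0 (by positivity)]
        linarith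
      have : (0 : ℝ) ≤ (n : ℝ)⁻¹ := by positivity
      linarith
    · rw [Finset.Ioc_eq_empty (by omega), Finset.sum_empty]
      positivity
  refine h3.trans (h4.trans ?_)
  calc n * (Real.exp 1 * (1 + L) ^ 2) * ∑ p ∈ Finset.Ioc k n, ((p : ℝ) ^ 2)⁻¹
      ≤ n * (Real.exp 1 * (2 * L) ^ 2) * (2 / L ^ 3) := by gcongr; linarith
    _ = n * (8 * Real.exp 1 * L⁻¹) := by
      have : L ≠ 0 := by linarith
      field_simp
      ring

lemma eventually_mul_log_add_le (K C : ℝ) (hK : 0 ≤ K) :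
    ∀ᶠ u : ℝ in atTop, K * (Real.log (2 + 3 * u) + C) ≤ u / 2 := by
  have ht : Tendsto (fun u : ℝ => 2 + 3 * u) atTop atTop :=
    tendsto_atTop_add_const_left _ _ (tendsto_id.const_mul_atTop (by norm_num))
  have h := (Real.isLittleO_log_id_atTop.comp_tendsto ht).bound
    (show (0 : ℝ) < 1 / (12 * (K + 1)) by positivity)
  filter_upwards [h, eventually_ge_atTop 1, eventually_ge_atTop (4 * (1 + K * |C|))]
    with u hu h1 h2
  simp only [Function.comp, id, Real.norm_eq_abs] at hu
  rw [abs_of_pos (show 0 < 2 + 3 * u by linarith)] at hu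
  have h3 := (le_abs_self _).trans hu
  have h4 : K * (1 / (12 * (K + 1)) * (2 + 3 * u)) ≤ (2 + 3 * u) / 12 := by
    have : K * (1 / (12 * (K + 1)) * (2 + 3 * u)) = (2 + 3 * u) / 12 * (K / (K + 1)) := by
      field_simp
    rw [this]
    refine mul_le_of_le_one_right (by linarith) ?_
    rw [div_le_one (by linarith)]
    linarith
  have h5 := mul_le_mul_of_nonneg_left h3 hK
  have h6 := mul_le_mul_of_nonneg_left (le_abs_self C) hK
  linarith

lemma negligible_omegaQ_medium_prime {c : ℝ} (hc : 0 < c) : ∃ B : ℕ, Negligible fun n m =>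
    ∃ p : ℕ, p.Prime ∧ B < p ∧ (p : ℝ) ≤ (Real.log n) ^ 3 ∧ c * LL n ≤ omegaQ m p := by
  obtain ⟨C, hC0, hC⟩ := primeRecip_le
  set t := 5 / c with ht
  have ht0 : 0 < t := by positivity
  set K := Real.exp t - 1 with hK
  have hK0 : 0 ≤ K := by linarith [Real.add_one_le_exp t]
  obtain ⟨B, hB⟩ := exists_nat_ge (2 * K + 1)
  refine ⟨B, ?_⟩
  have hg : Tendsto (fun n : ℕ => Real.exp (-LL n)) atTop (nhds 0) :=
    Real.tendsto_exp_neg_atTop_nhds_zero.comp tendsto_LL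
  refine negligible_of_le hg ?_
  filter_upwards [eventually_ge_atTop 3, tendsto_LL.eventually_ge_atTop 1,
    tendsto_LL.eventually (eventually_mul_log_add_le K C hK0)] with n hn hL hev
  set s := (Finset.Ioc B ⌊(Real.log n) ^ 3⌋₊).filter Nat.Prime with hs
  have hlog : 0 < Real.log n := Real.log_pos (by exact_mod_cast (by omega : 1 < n))
  have h1 : cnt (fun m => ∃ p : ℕ, p.Prime ∧ B < p ∧ (p : ℝ) ≤ (Real.log n) ^ 3 ∧
      c * LL n ≤ omegaQ m p) n ≤ cnt (fun m => ∃ p ∈ s, c * LL n ≤ omegaQ m p) n := by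
    refine cnt_mono fun m _ _ ⟨p, hp, hpB, hpL, hω⟩ => ⟨p, ?_, hω⟩
    rw [hs, Finset.mem_filter, Finset.mem_Ioc]
    exact ⟨⟨hpB, Nat.le_floor hpL⟩, hp⟩
  have h2 := h1.trans (cnt_exists_le s (fun p m => c * LL n ≤ omegaQ m p) n)
  have hcard : (s.card : ℝ) ≤ Real.exp (3 * LL n) := by
    have : s.card ≤ ⌊(Real.log n) ^ 3⌋₊ :=
      (Finset.card_filter_le _ _).trans (by simp)
    refine (Nat.cast_le.2 this).trans ((Nat.floor_le (by positivity)).trans (le_of_eq ?_))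
    rw [mul_comm, Real.exp_mul, exp_LL (by omega)]
    norm_cast
  have h3 : ∀ p ∈ s, (cnt (fun m => c * LL n ≤ omegaQ m p) n : ℝ) ≤ n * Real.exp (-4 * LL n) := by
    intro p hp
    rw [hs, Finset.mem_filter, Finset.mem_Ioc] at hp
    obtain ⟨⟨hpB, hpL⟩, hp'⟩ := hp
    have hpL' : (p : ℝ) ≤ Real.log n ^ 3 := (Nat.le_floor_iff (by positivity)).1 hpL
    have hp0 : (0 : ℝ) < p := by exact_mod_cast hp'.pos
    have hp1 : 0 ≤ Real.log p := Real.log_natCast_nonneg p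
    have hlp : Real.log p ≤ 3 * LL n := by
      have := Real.log_le_log hp0 hpL'
      rwa [Real.log_pow] at this
    have hll : Real.log (2 + Real.log p) ≤ Real.log (2 + 3 * LL n) :=
      Real.log_le_log (by linarith) (by linarith)
    have hr := hC p n hp'.pos hn
    have hBp : (B : ℝ) ≤ p.totient := by
      rw [Nat.totient_prime hp']
      exact_mod_cast (by omega : B ≤ p - 1)
    have hdiv : K * (LL n / p.totient) ≤ LL n / 2 := by
      have : (0 : ℝ) < p.totient := by linarith
      rw [mul_div_assoc', div_le_div_iff₀ this (by norm_num)]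
      nlinarith
    have hKr : K * primeRecip p n ≤ LL n := by
      have h5 := mul_le_mul_of_nonneg_left hr hK0
      have h6 := mul_le_mul_of_nonneg_left hll hK0
      linarith
    have h4 := cnt_mul_le_sum (fun m => c * LL n ≤ omegaQ m p) n (c := Real.exp (5 * LL n))
      (fun m => Real.exp (t * omegaQ m p)) (fun m => (Real.exp_pos _).le) (fun m _ _ hm => by
        refine Real.exp_le_exp.2 ?_
        have := mul_le_mul_of_nonneg_left hm ht0.le
        have e : t * (c * LL n) = 5 * LL n := by rw [ht]; field_simp
        linarith)
    have h5 := h4.trans (sum_exp_omegaQ_le p n ht0.le)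
    have h6 : (n : ℝ) * Real.exp ((Real.exp t - 1) * primeRecip p n) ≤ n * Real.exp (LL n) := by
      gcongr
    have h7 := h5.trans h6
    rw [← le_div_iff₀ (Real.exp_pos _), mul_div_assoc, ← Real.exp_sub] at h7
    refine h7.trans (le_of_eq ?_)
    congr 2
    ring
  calc (cnt (fun m => ∃ p : ℕ, p.Prime ∧ B < p ∧ (p : ℝ) ≤ (Real.log n) ^ 3 ∧
        c * LL n ≤ omegaQ m p) n : ℝ)
      ≤ ∑ p ∈ s, (cnt (fun m => c * LL n ≤ omegaQ m p) n : ℝ) := by exact_mod_cast h2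
    _ ≤ s.card • (n * Real.exp (-4 * LL n)) := Finset.sum_le_card_nsmul _ _ _ h3
    _ ≤ Real.exp (3 * LL n) * (n * Real.exp (-4 * LL n)) := by
        rw [nsmul_eq_mul]
        gcongr
    _ = n * Real.exp (-LL n) := by
        rw [mul_left_comm, ← Real.exp_add]
        congr 2
        ring

/-- Uniformly over large primes `p`, `ω(m;p,1)` is at most a small multiple of `log log n`. -/
theorem negligible_omegaQ_large_prime {c : ℝ} (hc : 0 < c) : ∃ B : ℕ, Negligible fun n m =>
    ∃ p : ℕ, p.Prime ∧ B < p ∧ c * LL n ≤ omegaQ m p := by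
  obtain ⟨B, hB⟩ := negligible_omegaQ_medium_prime hc
  refine ⟨B, (hB.or negligible_omegaQ_huge_prime).mono ?_⟩
  filter_upwards [tendsto_LL.eventually_ge_atTop (2 / c)] with n hn m _ _ ⟨p, hp, hpB, hω⟩
  rcases le_or_gt (p : ℝ) (Real.log n ^ 3) with h | h
  · exact Or.inl ⟨p, hp, hpB, h, hω⟩
  · refine Or.inr ⟨p, hp, h, ?_⟩
    rw [div_le_iff₀ hc] at hn
    exact_mod_cast (by linarith : (2 : ℝ) ≤ omegaQ m p)

lemma negligible_not_omegaQ_add_two_le {a b : ℕ} (ha : 0 < a) (hb : 0 < b)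
    (hab : a.totient < b.totient) : Negligible fun _ m => ¬ omegaQ m b + 2 ≤ omegaQ m a := by
  have ha' : (0 : ℝ) < a.totient := by exact_mod_cast Nat.totient_pos.2 ha
  have hlt : (1 : ℝ) / b.totient < 1 / a.totient :=
    one_div_lt_one_div_of_lt ha' (by exact_mod_cast hab)
  set ε : ℝ := (1 / a.totient - 1 / b.totient) / 3 with hε
  have hε0 : 0 < ε := by rw [hε]; linarith
  refine ((omegaQ_normal_order ha hε0).or (omegaQ_normal_order hb hε0)).mono ?_
  filter_upwards [tendsto_LL.eventually_ge_atTop (2 / ε)] with n hn m _ _ hm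
  by_contra! h
  obtain ⟨h1, h2⟩ := h
  refine hm ?_
  rw [div_le_iff₀ hε0] at hn
  have h3 := (abs_lt.1 h1).1
  have h4 := (abs_lt.1 h2).2
  have e : LL n / a.totient - LL n / b.totient = 3 * (ε * LL n) := by
    rw [hε]
    ring
  exact_mod_cast (by linarith : (omegaQ m b : ℝ) + 2 ≤ omegaQ m a)

/-- The counts `ω(m;Q,1)` over prime powers `Q` compare with `ω(m;q,1)` as the totients do. -/
def OrderedAt (q m : ℕ) : Prop :=
  (∀ Q, IsPrimePow Q → Q.totient < q.totient → omegaQ m q + 2 ≤ omegaQ m Q) ∧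
    ∀ Q, IsPrimePow Q → q.totient < Q.totient →
      ∃ R, IsPrimePow R ∧ R ∣ Q ∧ omegaQ m R + 2 ≤ omegaQ m q

lemma exists_dvd_totient_gt {p k v : ℕ} (hp : p.Prime) (hv : 1 ≤ v)
    (h : v < (p ^ k).totient) :
    ∃ R, IsPrimePow R ∧ R ∣ p ^ k ∧ v < R.totient ∧ R ≤ 2 * v * p := by
  classical
  have hex : ∃ k, v < (p ^ k).totient := ⟨k, h⟩
  have hmin := Nat.find_min' hex h
  have hspec := Nat.find_spec hex
  obtain ⟨j, hj⟩ : ∃ j, Nat.find hex = j + 1 := by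
    refine Nat.exists_eq_succ_of_ne_zero fun h0 => ?_
    rw [h0] at hspec
    simp at hspec
    omega
  have hlt := Nat.find_min hex (m := j) (by omega)
  rw [hj] at hspec hmin
  refine ⟨p ^ (j + 1), hp.isPrimePow.pow (by omega), pow_dvd_pow _ hmin, hspec, ?_⟩
  rw [pow_succ]
  refine Nat.mul_le_mul_right _ ?_
  rcases Nat.eq_zero_or_pos j with rfl | hj0
  · simp
    omega
  · have := isPrimePow_le_two_mul_totient (hp.isPrimePow.pow hj0.ne')
    omega

theorem negligible_not_orderedAt {q : ℕ} (hq : IsPrimePow q) :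
    Negligible fun _ m => ¬ OrderedAt q m := by
  have hq0 : 0 < q := hq.pos
  set v := q.totient with hv
  have hv0 : 0 < v := Nat.totient_pos.2 hq0
  have hv0' : (0 : ℝ) < v := by exact_mod_cast hv0
  obtain ⟨B, hB⟩ := negligible_omegaQ_large_prime (c := 1 / (3 * v)) (by positivity)
  set N := 2 * v * (max B (2 * v)) with hN
  have h1 : Negligible fun _ m => ∃ Q ∈ (Finset.range (2 * v)).filter
      (fun Q => 0 < Q ∧ Q.totient < v), ¬ omegaQ m q + 2 ≤ omegaQ m Q := by
    refine Negligible.exists _ fun Q hQ => ?_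
    rw [Finset.mem_filter] at hQ
    exact negligible_not_omegaQ_add_two_le hQ.2.1 hq0 hQ.2.2
  have h2 : Negligible fun _ m => ∃ Q ∈ (Finset.range (N + 1)).filter
      (fun Q => 0 < Q ∧ v < Q.totient), ¬ omegaQ m Q + 2 ≤ omegaQ m q := by
    refine Negligible.exists _ fun Q hQ => ?_
    rw [Finset.mem_filter] at hQ
    exact negligible_not_omegaQ_add_two_le hq0 hQ.2.1 hQ.2.2
  have h3 := omegaQ_normal_order hq0 (ε := 1 / (3 * v)) (by positivity)
  refine ((h1.or h2).or (hB.or h3)).mono ?_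
  filter_upwards [tendsto_LL.eventually_ge_atTop (6 * v)] with n hn m _ _ hm
  by_contra! h
  obtain ⟨⟨hlow, hhigh⟩, hlarge, hnorm⟩ := h
  refine hm ⟨fun Q hQ hQv => ?_, fun Q hQ hQv => ?_⟩
  · refine hlow Q (Finset.mem_filter.2 ⟨Finset.mem_range.2 ?_, hQ.pos, hQv⟩)
    have := isPrimePow_le_two_mul_totient hQ
    omega
  · obtain ⟨p, k, hp, hk, rfl⟩ := (isPrimePow_nat_iff _).1 hQ
    rcases le_or_gt p (max B (2 * v)) with hpB | hpB
    · obtain ⟨R, hR, hRQ, hvR, hRle⟩ := exists_dvd_totient_gt hp hv0 hQv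
      refine ⟨R, hR, hRQ, hhigh R (Finset.mem_filter.2 ⟨Finset.mem_range.2 ?_, hR.pos, hvR⟩)⟩
      exact Nat.lt_succ_of_le (hRle.trans (Nat.mul_le_mul_left _ hpB))
    · refine ⟨p, hp.isPrimePow, dvd_pow_self _ hk.ne', ?_⟩
      have h4 := hlarge p hp ((le_max_left _ _).trans_lt hpB)
      have h5 := (abs_lt.1 hnorm).1
      have e : LL n / v = 3 * (1 / (3 * v) * LL n) := by field_simp
      have h6 : 2 ≤ 1 / (3 * v) * LL n := by
        rw [one_div_mul_eq_div, le_div_iff₀ (by positivity)]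
        linarith
      exact_mod_cast (by linarith : (omegaQ m p : ℝ) + 2 ≤ omegaQ m q)

lemma card_eq_sub_of_orderedAt {m K : ℕ} (hm : m ≠ 0) {lam : Fin K → ℕ}
    (h : IsInvChain (ZMod m)ˣ K lam) {q q' d : ℕ}
    (hq : IsPrimePow q) (hq' : IsPrimePow q') (hqq : q ≠ q') (hφ : q'.totient = q.totient)
    (huniq : ∀ Q, IsPrimePow Q → Q.totient = q.totient → Q = q ∨ Q = q')
    (hd : ∀ Q, IsPrimePow Q → (Q ∣ d ↔ Q.totient < q.totient ∨ Q = q))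
    (ho : OrderedAt q m) (ho' : OrderedAt q' m) :
    (Finset.univ.filter fun j => lam j = d).card =
      (Finset.univ.filter fun j => q ∣ lam j).card -
        (Finset.univ.filter fun j => q' ∣ lam j).card := by
  refine card_filter_eq_sub h.2.1 hq hq' hqq rfl hφ huniq hd (fun Q hQ hlt => ?_)
    fun Q hQ hlt => ?_
  · exact (omegaQ_le_card_dvd hm h hq).2.trans
      ((ho.1 Q hQ hlt).trans (omegaQ_le_card_dvd hm h hQ).1)
  · obtain ⟨R, hR, hRQ, hle⟩ := ho'.2 Q hQ (by omega)
    refine le_trans (Finset.card_le_card fun j hj => ?_) ((omegaQ_le_card_dvd hm h hR).2.trans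
      (hle.trans (omegaQ_le_card_dvd hm h hq').1))
    simp only [Finset.mem_filter] at hj ⊢
    exact ⟨hj.1, hRQ.trans hj.2⟩

/-- Outside a negligible set, the counts of two factors attached to prime powers `q`, `q'` of equal
totient are the positive and negative part of a quantity close to `ω(m;q,1) - ω(m;q',1)`. -/
theorem exists_diff_of_isInvCount {q q' d d' : ℕ}
    (hq : IsPrimePow q) (hq' : IsPrimePow q') (hqq : q ≠ q') (hφ : q'.totient = q.totient)
    (huniq : ∀ Q, IsPrimePow Q → Q.totient = q.totient → Q = q ∨ Q = q')
    (hd : ∀ Q, IsPrimePow Q → (Q ∣ d ↔ Q.totient < q.totient ∨ Q = q))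
    (hd' : ∀ Q, IsPrimePow Q → (Q ∣ d' ↔ Q.totient < q.totient ∨ Q = q'))
    {J J' : ℕ → ℕ} (hJ : IsInvCount d J) (hJ' : IsInvCount d' J') :
    ∃ D : ℕ → ℝ, (∀ m, 1 ≤ m → |D m - ((omegaQ m q : ℝ) - omegaQ m q')| ≤ 2) ∧
      Negligible fun _ m => ¬ ((J m : ℝ) = max 0 (D m) ∧ (J m : ℝ) + J' m = |D m|) := by
  have hex : ∀ m : ℕ, ∃ K, ∃ lam : Fin K → ℕ, 1 ≤ m → IsInvChain (ZMod m)ˣ K lam := by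
    intro m
    rcases Nat.eq_zero_or_pos m with rfl | hm
    · exact ⟨0, fun _ => 0, by omega⟩
    · have : NeZero m := ⟨hm.ne'⟩
      obtain ⟨K, lam, h⟩ := exists_isInvChain _ (ZMod m)ˣ rfl
      exact ⟨K, lam, fun _ => h⟩
  choose K lam hlam using hex
  refine ⟨fun m => ((Finset.univ.filter fun j => q ∣ lam m j).card : ℝ) -
    (Finset.univ.filter fun j => q' ∣ lam m j).card, fun m hm => ?_, ?_⟩
  · have h1 := omegaQ_le_card_dvd (by omega) (hlam m hm) hq
    have h2 := omegaQ_le_card_dvd (by omega) (hlam m hm) hq'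
    have a1 : (omegaQ m q : ℝ) ≤ _ := Nat.cast_le.2 h1.1
    have a2 : _ ≤ ((omegaQ m q + 2 : ℕ) : ℝ) := Nat.cast_le.2 h1.2
    have b1 : (omegaQ m q' : ℝ) ≤ _ := Nat.cast_le.2 h2.1
    have b2 : _ ≤ ((omegaQ m q' + 2 : ℕ) : ℝ) := Nat.cast_le.2 h2.2
    push_cast at a2 b2
    rw [abs_le]
    constructor <;> linarith
  · refine ((negligible_not_orderedAt hq).or (negligible_not_orderedAt hq')).mono
      (Eventually.of_forall fun n m hm _ hbad => ?_)
    by_contra! h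
    obtain ⟨ho, ho'⟩ := h
    have hc := hlam m hm
    have e1 := hJ m hm _ _ hc.1 hc.2.1 hc.2.2
    have e2 := hJ' m hm _ _ hc.1 hc.2.1 hc.2.2
    rw [card_eq_sub_of_orderedAt (by omega) hc hq hq' hqq hφ huniq hd ho ho'] at e1
    rw [card_eq_sub_of_orderedAt (by omega) hc hq' hq hqq.symm hφ.symm
      (fun Q hQ hQv => (huniq Q hQ (hQv.trans hφ)).symm) (by rwa [hφ]) ho' ho] at e2
    refine hbad ?_
    beta_reduce
    rw [e1, e2]
    set a := (Finset.univ.filter fun j => q ∣ lam m j).card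
    set b := (Finset.univ.filter fun j => q' ∣ lam m j).card
    rcases le_total a b with hab | hab
    · have : (a : ℝ) ≤ b := by exact_mod_cast hab
      rw [Nat.sub_eq_zero_of_le hab, Nat.cast_sub hab, max_eq_left (by linarith),
        abs_of_nonpos (by linarith)]
      constructor
      · simp
      · push_cast
        ring
    · have : (b : ℝ) ≤ a := by exact_mod_cast hab
      rw [Nat.sub_eq_zero_of_le hab, Nat.cast_sub hab, max_eq_right (by linarith),
        abs_of_nonneg (by linarith)]
      constructor <;> simp

/-- The distribution of `Y` over `{1, …, n + 1}` with the uniform measure. -/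
def empiricalMeasure (Y : ℕ → ℝ) (n : ℕ) : Measure ℝ :=
  ((n + 1 : ℕ) : ENNReal)⁻¹ • ∑ m ∈ Finset.Icc 1 (n + 1), Measure.dirac (Y m)

lemma empiricalMeasure_apply (Y : ℕ → ℝ) (n : ℕ) {E : Set ℝ} (hE : MeasurableSet E) :
    empiricalMeasure Y n E = (cnt (fun m => Y m ∈ E) (n + 1) : ENNReal) / ((n + 1 : ℕ) : ENNReal) := by
  classical
  rw [empiricalMeasure, Measure.smul_apply, Measure.finsetSum_apply, smul_eq_mul,
    ENNReal.div_eq_inv_mul, cnt_eq_card, Finset.card_filter]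
  push_cast
  congr 1
  refine Finset.sum_congr rfl fun m _ => ?_
  rw [Measure.dirac_apply' _ hE, Set.indicator_apply]
  rfl

instance (Y : ℕ → ℝ) (n : ℕ) : IsProbabilityMeasure (empiricalMeasure Y n) := by
  refine ⟨?_⟩
  have h : cnt (fun m => Y m ∈ Set.univ) (n + 1) = n + 1 := by
    classical
    rw [cnt_eq_card]
    simp
  rw [empiricalMeasure_apply Y n MeasurableSet.univ, h]
  exact ENNReal.div_self (by simp) (by simp)

lemma charFun_empiricalMeasure (Y : ℕ → ℝ) (n : ℕ) (t : ℝ) :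
    charFun (empiricalMeasure Y n) t =
      (∑ m ∈ Finset.Icc 1 (n + 1), Complex.exp (t * Y m * Complex.I)) / ((n + 1 : ℕ) : ℂ) := by
  rw [charFun_apply_real, empiricalMeasure, integral_smul_measure, integral_finsetSum_measure]
  · simp_rw [integral_dirac]
    rw [div_eq_inv_mul, ENNReal.toReal_inv, ENNReal.toReal_natCast, Complex.real_smul]
    push_cast
    rfl
  · intro m _
    exact integrable_dirac (by simp)

lemma gaussianReal_real_Iic (x : ℝ) : (gaussianReal 0 1).real (Set.Iic x) = Phi x := by
  rw [measureReal_def, gaussianReal_apply_eq_integral 0 one_ne_zero,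
    ENNReal.toReal_ofReal (integral_nonneg fun y => gaussianPDFReal_nonneg _ _ _), Phi,
    ← integral_const_mul]
  refine setIntegral_congr_fun measurableSet_Iic fun y _ => ?_
  simp [gaussianPDFReal]

lemma gaussianReal_real_Icc {x : ℝ} (hx : 0 ≤ x) :
    (gaussianReal 0 1).real (Set.Icc (-x) x) = Phi x - Phi (-x) := by
  have : NullSingletonClass (gaussianReal 0 1) := nullSingletonClass_gaussianReal one_ne_zero
  rw [measureReal_congr Ioc_ae_eq_Icc.symm, ← Set.Iic_sdiff_Iic,
    measureReal_sdiff (Set.Iic_subset_Iic.2 (by linarith)) measurableSet_Iic,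
    gaussianReal_real_Iic, gaussianReal_real_Iic]

/-- Lévy's continuity theorem for empirical distributions. -/
theorem tendsto_cnt_of_tendsto_charFun {Y : ℕ → ℕ → ℝ}
    (h : ∀ t : ℝ, Tendsto (fun n : ℕ =>
      (∑ m ∈ Finset.Icc 1 n, Complex.exp (t * Y n m * Complex.I)) / (n : ℂ)) atTop
        (nhds (Complex.exp (-(t : ℂ) ^ 2 / 2)))) {E : Set ℝ} (hE : MeasurableSet E)
    (hfr : (frontier E).Finite) :
    Tendsto (fun n : ℕ => (cnt (fun m => Y n m ∈ E) n : ℝ) / n) atTop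
      (nhds ((gaussianReal 0 1).real E)) := by
  have : NullSingletonClass (gaussianReal 0 1) := nullSingletonClass_gaussianReal one_ne_zero
  let μ : ℕ → ProbabilityMeasure ℝ := fun n => ⟨empiricalMeasure (Y (n + 1)) n, inferInstance⟩
  let ν : ProbabilityMeasure ℝ := ⟨gaussianReal 0 1, inferInstance⟩
  have hlim : Tendsto μ atTop (nhds ν) := by
    refine ProbabilityMeasure.tendsto_of_tendsto_charFun fun t => ?_
    have e : charFun (gaussianReal 0 1) t = Complex.exp (-(t : ℂ) ^ 2 / 2) := by
      rw [charFun_gaussianReal]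
      congr 1
      simp
      ring
    change Tendsto (fun n => charFun (empiricalMeasure (Y (n + 1)) n) t) atTop
      (nhds (charFun (gaussianReal 0 1) t))
    simp_rw [charFun_empiricalMeasure, e]
    exact (tendsto_add_atTop_iff_nat 1).2 (h t)
  have h2 := ProbabilityMeasure.tendsto_measure_of_null_frontier_of_tendsto' hlim
    (E := E) (hfr.measure_zero (gaussianReal 0 1))
  have h3 := (ENNReal.tendsto_toReal (measure_ne_top (gaussianReal 0 1) E)).comp h2
  rw [← tendsto_add_atTop_iff_nat 1]
  refine h3.congr fun n => ?_
  change (empiricalMeasure (Y (n + 1)) n E).toReal = _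
  rw [empiricalMeasure_apply _ _ hE, ENNReal.toReal_div, ENNReal.toReal_natCast,
    ENNReal.toReal_natCast]

lemma abs_natDiv_div_sub_le {n D : ℕ} (hn : 0 < n) (hD : 0 < D) {δ : ℝ} (h0 : 0 ≤ δ)
    (h1 : δ ≤ 1) : |((n / D : ℕ) : ℝ) / n - 1 / D| ≤ (n : ℝ) ^ (-δ) * (D : ℝ) ^ (δ - 1) := by
  have hn' : (0 : ℝ) < n := by exact_mod_cast hn
  have hD' : (0 : ℝ) < D := by exact_mod_cast hD
  have hup : ((n / D : ℕ) : ℝ) / n ≤ 1 / D := by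
    rw [div_le_iff₀ hn', one_div_mul_eq_div]
    exact Nat.cast_div_le
  rw [abs_of_nonpos (by linarith)]
  rcases le_or_gt D n with h | h
  · have h2 : (n : ℝ) / D ≤ (n / D : ℕ) + 1 := by
      rw [← Nat.floor_div_eq_div (K := ℝ)]
      exact (Nat.lt_floor_add_one _).le
    calc -(((n / D : ℕ) : ℝ) / n - 1 / D) ≤ 1 / n := by
          rw [neg_sub, sub_le_iff_le_add, ← add_div, le_div_iff₀ hn', one_div_mul_eq_div]
          linarith
      _ = (n : ℝ) ^ (-δ) * (n : ℝ) ^ (δ - 1) := by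
          rw [← Real.rpow_add hn', one_div, ← Real.rpow_neg_one]
          congr 1
          ring
      _ ≤ _ := by
          refine mul_le_mul_of_nonneg_left ?_ (by positivity)
          exact Real.rpow_le_rpow_of_nonpos hD' (by exact_mod_cast h) (by linarith)
  · calc -(((n / D : ℕ) : ℝ) / n - 1 / D) ≤ 1 / D := by
          have : (0 : ℝ) ≤ ((n / D : ℕ) : ℝ) / n := by positivity
          linarith
      _ = (D : ℝ) ^ (-δ) * (D : ℝ) ^ (δ - 1) := by
          rw [← Real.rpow_add hD', one_div, ← Real.rpow_neg_one]
          congr 1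
          ring
      _ ≤ _ := by
          refine mul_le_mul_of_nonneg_right ?_ (by positivity)
          exact Real.rpow_le_rpow_of_nonpos hn' (by exact_mod_cast h.le) (by linarith)

/-- The mean value of a multiplicative function supported on few small primes, compared to its
Euler product by Rankin's trick. -/
lemma norm_mean_prod_sub_le (S : Finset ℕ) (hS : ∀ p ∈ S, p.Prime) (z : ℕ → ℂ) {n : ℕ}
    (hn : 0 < n) {δ : ℝ} (h0 : 0 ≤ δ) (h1 : δ ≤ 1) :
    ‖(∑ m ∈ Finset.Icc 1 n, ∏ p ∈ S, (1 + if p ∣ m then z p else 0)) / n -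
        ∏ p ∈ S, (1 + z p / p)‖ ≤
      (n : ℝ) ^ (-δ) * Real.exp (∑ p ∈ S, ‖z p‖ * (p : ℝ) ^ (δ - 1)) := by
  rw [sum_prod_one_add S hS, Finset.prod_one_add, Finset.sum_div, ← Finset.sum_sub_distrib]
  calc _ ≤ ∑ t ∈ S.powerset, (n : ℝ) ^ (-δ) * ∏ p ∈ t, (‖z p‖ * (p : ℝ) ^ (δ - 1)) := by
        refine (norm_sum_le _ _).trans (Finset.sum_le_sum fun t ht => ?_)
        have hpos : 0 < ∏ p ∈ t, p :=
          Finset.prod_pos fun p hp => (hS p (Finset.mem_powerset.1 ht hp)).pos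
        have e : (∏ p ∈ t, z p) * ((n / ∏ p ∈ t, p : ℕ) : ℂ) / n - ∏ p ∈ t, z p / (p : ℂ) =
            (∏ p ∈ t, z p) *
              ((((n / ∏ p ∈ t, p : ℕ) : ℝ) / n - 1 / ((∏ p ∈ t, p : ℕ) : ℝ) : ℝ) : ℂ) := by
          rw [Finset.prod_div_distrib]
          push_cast
          ring
        rw [e, norm_mul, norm_prod, Complex.norm_real, Real.norm_eq_abs, Finset.prod_mul_distrib,
          mul_left_comm]
        refine mul_le_mul_of_nonneg_left ?_ (by positivity)
        refine (abs_natDiv_div_sub_le hn hpos h0 h1).trans (le_of_eq ?_)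
        push_cast
        rw [Real.finsetProd_rpow _ _ fun p _ => by positivity]
    _ = (n : ℝ) ^ (-δ) * ∏ p ∈ S, (1 + ‖z p‖ * (p : ℝ) ^ (δ - 1)) := by
        rw [← Finset.mul_sum, Finset.prod_one_add]
    _ ≤ _ := by
        refine mul_le_mul_of_nonneg_left ?_ (by positivity)
        rw [Real.exp_sum]
        refine Finset.prod_le_prod (fun p _ => by positivity) fun p _ => ?_
        rw [add_comm]
        exact Real.add_one_le_exp _

/-- The truncation point `n ^ (1 / log log n)`. -/
def truncPoint (n : ℕ) : ℕ := ⌊Real.exp (Real.log n / LL n)⌋₊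

lemma eventually_truncPoint : ∀ᶠ n : ℕ in atTop, 3 ≤ truncPoint n ∧ truncPoint n ≤ n ∧
    LL n - Real.log (LL n) - Real.log 2 ≤ LL (truncPoint n) := by
  have hdiv : Tendsto (fun n : ℕ => Real.exp (LL n) / LL n ^ 1) atTop atTop :=
    (Real.tendsto_exp_div_pow_atTop 1).comp tendsto_LL
  filter_upwards [hdiv.eventually_ge_atTop 2, tendsto_LL.eventually_ge_atTop 1,
    eventually_ge_atTop 3] with n hd hu hn
  rw [exp_LL (by omega), pow_one] at hd
  have hn' : (0 : ℝ) < n := by exact_mod_cast (by omega : 0 < n)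
  have hL : 0 < Real.log n := Real.log_pos (by exact_mod_cast (by omega : 1 < n))
  set w := Real.log n / LL n with hw
  have hle : Real.exp w ≤ n := by
    rw [← Real.le_log_iff_exp_le hn', hw]
    exact div_le_self hL.le hu
  have h4 : 4 ≤ Real.exp w := by
    have h1 := Real.exp_le_exp.2 hd
    have h2 : (2 : ℝ) ≤ Real.exp 1 := by linarith [Real.add_one_le_exp (1 : ℝ)]
    have h3 : Real.exp 2 = Real.exp 1 * Real.exp 1 := by rw [← Real.exp_add]; norm_num
    nlinarith
  have hfl : Real.exp w / 2 ≤ truncPoint n := by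
    have := Nat.lt_floor_add_one (Real.exp w)
    rw [truncPoint]
    linarith
  have hT3 : 3 ≤ truncPoint n := Nat.le_floor (by push_cast; linarith)
  refine ⟨hT3, ?_, ?_⟩
  · have : (truncPoint n : ℝ) ≤ n := (Nat.floor_le (Real.exp_pos _).le).trans hle
    exact_mod_cast this
  · have hlog : w / 2 ≤ Real.log (truncPoint n) := by
      have h1 := Real.log_le_log (by positivity) hfl
      rw [Real.log_div (by positivity) (by norm_num), Real.log_exp] at h1
      have := Real.log_two_lt_d9
      linarith
    have h2 := Real.log_le_log (by linarith) hlog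
    rw [Real.log_div (by linarith) (by norm_num), hw, Real.log_div hL.ne' (by linarith)] at h2
    exact h2

lemma tendsto_log_LL_div_sqrt (C : ℝ) :
    Tendsto (fun n : ℕ => (Real.log (LL n) + C) / Real.sqrt (LL n)) atTop (nhds 0) := by
  have h1 : Tendsto (fun u : ℝ => Real.log u / u ^ (1 / 2 : ℝ)) atTop (nhds 0) :=
    (isLittleO_log_rpow_atTop (by norm_num)).tendsto_div_nhds_zero
  have h2 : Tendsto (fun u : ℝ => C / Real.sqrt u) atTop (nhds 0) :=
    tendsto_const_nhds.div_atTop Real.tendsto_sqrt_atTop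
  have h3 := (h1.add h2).comp tendsto_LL
  rw [add_zero] at h3
  refine h3.congr fun n => ?_
  simp only [Function.comp]
  rw [← Real.sqrt_eq_rpow, add_div]

lemma LL_mono {a b : ℕ} (ha : 3 ≤ a) (hab : a ≤ b) : LL a ≤ LL b := by
  have ha' : (1 : ℝ) < a := by exact_mod_cast (by omega : 1 < a)
  exact Real.log_le_log (Real.log_pos ha')
    (Real.log_le_log (by linarith) (by exact_mod_cast hab))

lemma tendsto_LL_truncPoint_div : Tendsto (fun n => LL (truncPoint n) / LL n) atTop (nhds 1) := by
  have h1 : Tendsto (fun n : ℕ => 1 - (Real.log (LL n) + Real.log 2) / Real.sqrt (LL n)) atTop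
      (nhds 1) := by
    simpa using (tendsto_log_LL_div_sqrt (Real.log 2)).const_sub 1
  refine tendsto_of_tendsto_of_tendsto_of_le_of_le' h1 tendsto_const_nhds ?_ ?_
  · filter_upwards [eventually_truncPoint, tendsto_LL.eventually_ge_atTop 1] with n hn hu
    have h2 : 0 ≤ Real.log (LL n) + Real.log 2 :=
      add_nonneg (Real.log_nonneg hu) (Real.log_nonneg (by norm_num))
    have h3 : (Real.log (LL n) + Real.log 2) / LL n ≤
        (Real.log (LL n) + Real.log 2) / Real.sqrt (LL n) := by
      refine div_le_div_of_nonneg_left h2 (Real.sqrt_pos.2 (by linarith)) ?_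
      rw [Real.sqrt_le_left (by linarith)]
      nlinarith
    have h4 : 1 - (Real.log (LL n) + Real.log 2) / LL n ≤ LL (truncPoint n) / LL n := by
      rw [sub_le_iff_le_add, ← add_div, le_div_iff₀ (by linarith)]
      linarith [hn.2.2]
    linarith
  · filter_upwards [eventually_truncPoint, tendsto_LL.eventually_ge_atTop 1] with n hn hu
    rw [div_le_one (by linarith)]
    exact LL_mono hn.1 hn.2.1

/-- The indicator of `p ≡ 1 (mod q)`. -/
def oneMod (q p : ℕ) : ℝ := if p % q = 1 % q then 1 else 0

lemma sum_primesOne_one_oneMod {R : Type*} [AddCommMonoid R] (q n : ℕ) (g : ℕ → R) :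
    (∑ p ∈ primesOne 1 n, if p % q = 1 % q then g p else 0) = ∑ p ∈ primesOne q n, g p := by
  rw [← Finset.sum_filter]
  congr 1
  ext p
  simp only [Finset.mem_filter, mem_primesOne, Nat.mod_one, and_true, and_assoc]

lemma omegaQ_eq_sum_oneMod {m n q : ℕ} (hm : 1 ≤ m) (hmn : m ≤ n) :
    (omegaQ m q : ℝ) = ∑ p ∈ primesOne 1 n, if p ∣ m then oneMod q p else 0 := by
  rw [omegaQ_eq_sum hm hmn, ← sum_primesOne_one_oneMod]
  refine Finset.sum_congr rfl fun p _ => ?_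
  by_cases a : p ∣ m <;> simp [a, oneMod]

lemma primeRecip_eq_sum_oneMod (q n : ℕ) :
    primeRecip q n = ∑ p ∈ primesOne 1 n, oneMod q p / p := by
  rw [primeRecip_eq_sum, ← sum_primesOne_one_oneMod]
  refine Finset.sum_congr rfl fun p _ => ?_
  by_cases a : p % q = 1 % q <;> simp [a, oneMod]

lemma oneMod_mul {q q' : ℕ} (h : Nat.Coprime q q') (p : ℕ) :
    oneMod (q * q') p = oneMod q p * oneMod q' p := by
  have := Nat.modEq_and_modEq_iff_modEq_mul (a := p) (b := 1) h
  simp only [Nat.ModEq] at this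
  simp only [oneMod, ← this]
  by_cases a : p % q = 1 % q <;> by_cases b : p % q' = 1 % q' <;> simp [a, b]

lemma abs_oneMod_sub_le (q q' p : ℕ) : |oneMod q p - oneMod q' p| ≤ 1 := by
  simp only [oneMod]
  split_ifs <;> simp

lemma primesOne_mono {N n : ℕ} (h : N ≤ n) (q : ℕ) : primesOne q N ⊆ primesOne q n :=
  fun p hp => by
    rw [mem_primesOne] at hp ⊢
    exact ⟨hp.1.trans h, hp.2⟩

lemma primeRecip_mono {N n : ℕ} (h : N ≤ n) (q : ℕ) : primeRecip q N ≤ primeRecip q n := by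
  rw [primeRecip_eq_sum, primeRecip_eq_sum]
  exact Finset.sum_le_sum_of_subset_of_nonneg (primesOne_mono h q) fun p _ _ => by positivity

lemma sum_abs_omegaQ_sub_truncated_le (q q' : ℕ) {N n : ℕ} (h : N ≤ n) :
    ∑ m ∈ Finset.Icc 1 n, |((omegaQ m q : ℝ) - omegaQ m q') -
      ∑ p ∈ primesOne 1 N, (if p ∣ m then oneMod q p - oneMod q' p else 0)| ≤
        n * (primeRecip 1 n - primeRecip 1 N) := by
  have hm : ∀ m ∈ Finset.Icc 1 n, |((omegaQ m q : ℝ) - omegaQ m q') -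
      ∑ p ∈ primesOne 1 N, (if p ∣ m then oneMod q p - oneMod q' p else 0)| ≤
        ∑ p ∈ primesOne 1 n \ primesOne 1 N, if p ∣ m then (1 : ℝ) else 0 := by
    intro m hm
    rw [Finset.mem_Icc] at hm
    rw [omegaQ_eq_sum_oneMod hm.1 hm.2, omegaQ_eq_sum_oneMod hm.1 hm.2, ← Finset.sum_sub_distrib,
      ← Finset.sum_sdiff (primesOne_mono h 1)]
    have e : ∑ p ∈ primesOne 1 N, ((if p ∣ m then oneMod q p else 0) -
        if p ∣ m then oneMod q' p else 0) =
        ∑ p ∈ primesOne 1 N, if p ∣ m then oneMod q p - oneMod q' p else 0 :=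
      Finset.sum_congr rfl fun p _ => by split_ifs <;> simp
    rw [e, add_sub_cancel_right]
    refine (Finset.abs_sum_le_sum_abs _ _).trans (Finset.sum_le_sum fun p _ => ?_)
    split_ifs
    · exact abs_oneMod_sub_le _ _ _
    · simp
  refine (Finset.sum_le_sum hm).trans ?_
  rw [Finset.sum_comm]
  have e2 : primeRecip 1 n - primeRecip 1 N =
      ∑ p ∈ primesOne 1 n \ primesOne 1 N, (1 : ℝ) / p := by
    rw [primeRecip_eq_sum, primeRecip_eq_sum, ← Finset.sum_sdiff (primesOne_mono h 1),
      add_sub_cancel_right]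
  rw [e2, Finset.mul_sum]
  refine Finset.sum_le_sum fun p _ => ?_
  rw [← Finset.sum_filter, Finset.sum_const, card_filter_dvd, nsmul_eq_mul, mul_one, mul_one_div]
  exact Nat.cast_div_le

lemma norm_exp_ofReal_mul_I_sub_le (a b : ℝ) :
    ‖Complex.exp (a * Complex.I) - Complex.exp (b * Complex.I)‖ ≤ |a - b| := by
  have e : Complex.exp (a * Complex.I) - Complex.exp (b * Complex.I) =
      Complex.exp (b * Complex.I) * (Complex.exp (Complex.I * ((a - b : ℝ) : ℂ)) - 1) := by
    rw [mul_sub, ← Complex.exp_add, mul_one]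
    congr 2
    push_cast
    ring
  rw [e, norm_mul, Complex.norm_exp_ofReal_mul_I, one_mul]
  exact Real.norm_exp_I_mul_ofReal_sub_one_le

/-- The local factor at `p` of the characteristic function. -/
def localFactor (q q' : ℕ) (τ : ℝ) (p : ℕ) : ℂ :=
  Complex.exp ((τ * (oneMod q p - oneMod q' p) : ℝ) * Complex.I) - 1

lemma norm_localFactor_le (q q' : ℕ) (τ : ℝ) (p : ℕ) : ‖localFactor q q' τ p‖ ≤ |τ| := by
  have h := norm_exp_ofReal_mul_I_sub_le (τ * (oneMod q p - oneMod q' p)) 0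
  rw [sub_zero, abs_mul] at h
  simp only [Complex.ofReal_zero, zero_mul, Complex.exp_zero] at h
  exact h.trans (mul_le_of_le_one_right (abs_nonneg _) (abs_oneMod_sub_le _ _ _))

lemma norm_mean_exp_sub_mean_prod_le {q q' : ℕ} {D : ℕ → ℝ}
    (hD : ∀ m, 1 ≤ m → |D m - ((omegaQ m q : ℝ) - omegaQ m q')| ≤ 2) (τ : ℝ) {N n : ℕ}
    (hn : 0 < n) (h : N ≤ n) :
    ‖(∑ m ∈ Finset.Icc 1 n, Complex.exp ((τ * D m : ℝ) * Complex.I)) / (n : ℂ) -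
      (∑ m ∈ Finset.Icc 1 n, ∏ p ∈ primesOne 1 N,
        (1 + if p ∣ m then localFactor q q' τ p else 0)) / n‖ ≤
      |τ| * (2 + (primeRecip 1 n - primeRecip 1 N)) := by
  have hn' : (0 : ℝ) < n := by exact_mod_cast hn
  have hprod : ∀ m, ∏ p ∈ primesOne 1 N, (1 + if p ∣ m then localFactor q q' τ p else 0) =
      Complex.exp ((τ * ∑ p ∈ primesOne 1 N,
        (if p ∣ m then oneMod q p - oneMod q' p else 0) : ℝ) * Complex.I) := by
    intro m
    rw [Finset.mul_sum, Complex.ofReal_sum, Finset.sum_mul, Complex.exp_sum]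
    refine Finset.prod_congr rfl fun p _ => ?_
    split_ifs <;> simp [localFactor]
  rw [← sub_div, ← Finset.sum_sub_distrib, norm_div, Complex.norm_natCast, div_le_iff₀ hn']
  calc _ ≤ ∑ m ∈ Finset.Icc 1 n, |τ| * (2 + |((omegaQ m q : ℝ) - omegaQ m q') -
        ∑ p ∈ primesOne 1 N, (if p ∣ m then oneMod q p - oneMod q' p else 0)|) := by
        refine (norm_sum_le _ _).trans (Finset.sum_le_sum fun m hm => ?_)
        rw [hprod]
        refine (norm_exp_ofReal_mul_I_sub_le _ _).trans ?_
        rw [← mul_sub, abs_mul]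
        refine mul_le_mul_of_nonneg_left ?_ (abs_nonneg _)
        exact (abs_sub_le _ ((omegaQ m q : ℝ) - omegaQ m q') _).trans
          (by linarith [hD m (Finset.mem_Icc.1 hm).1])
    _ ≤ _ := by
        rw [← Finset.mul_sum, Finset.sum_add_distrib, mul_assoc]
        refine mul_le_mul_of_nonneg_left ?_ (abs_nonneg _)
        have := sum_abs_omegaQ_sub_truncated_le q q' h
        simp only [Finset.sum_const, Nat.card_Icc, add_tsub_cancel_right, nsmul_eq_mul]
        linarith

lemma sum_localFactor_div {q q' : ℕ} (hc : Nat.Coprime q q') (τ : ℝ) (N : ℕ) :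
    ∑ p ∈ primesOne 1 N, localFactor q q' τ p / p =
      ((primeRecip q N + primeRecip q' N - 2 * primeRecip (q * q') N : ℝ) : ℂ) *
          ((Real.cos τ - 1 : ℝ) : ℂ) +
        ((primeRecip q N - primeRecip q' N : ℝ) : ℂ) * ((Real.sin τ : ℝ) : ℂ) * Complex.I := by
  have hl : ∀ p, localFactor q q' τ p =
      ((oneMod q p + oneMod q' p - 2 * (oneMod q p * oneMod q' p) : ℝ) : ℂ) *
          ((Real.cos τ - 1 : ℝ) : ℂ) +
        ((oneMod q p - oneMod q' p : ℝ) : ℂ) * ((Real.sin τ : ℝ) : ℂ) * Complex.I := by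
    intro p
    simp only [localFactor, Complex.exp_mul_I, oneMod]
    split_ifs <;> norm_num <;> ring
  rw [primeRecip_eq_sum_oneMod, primeRecip_eq_sum_oneMod, primeRecip_eq_sum_oneMod,
    Finset.mul_sum, ← Finset.sum_add_distrib, ← Finset.sum_sub_distrib, ← Finset.sum_sub_distrib,
    Complex.ofReal_sum, Complex.ofReal_sum, Finset.sum_mul, Finset.sum_mul, Finset.sum_mul,
    ← Finset.sum_add_distrib]
  refine Finset.sum_congr rfl fun p _ => ?_
  rw [hl, oneMod_mul hc]
  push_cast
  ring

lemma tendsto_prod_one_add {S : ℕ → Finset ℕ} {w : ℕ → ℕ → ℂ} {c : ℂ}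
    (hsum : Tendsto (fun n => ∑ p ∈ S n, w n p) atTop (nhds c))
    (hsmall : ∀ᶠ n in atTop, ∀ p ∈ S n, ‖w n p‖ ≤ 1 / 2)
    (hsq : Tendsto (fun n => ∑ p ∈ S n, ‖w n p‖ ^ 2) atTop (nhds 0)) :
    Tendsto (fun n => ∏ p ∈ S n, (1 + w n p)) atTop (nhds (Complex.exp c)) := by
  have hlog : Tendsto (fun n => ∑ p ∈ S n, Complex.log (1 + w n p)) atTop (nhds c) := by
    have hd : Tendsto (fun n => ∑ p ∈ S n, Complex.log (1 + w n p) - ∑ p ∈ S n, w n p) atTop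
        (nhds 0) := by
      refine squeeze_zero_norm' ?_ hsq
      filter_upwards [hsmall] with n hn
      rw [← Finset.sum_sub_distrib]
      refine (norm_sum_le _ _).trans (Finset.sum_le_sum fun p hp => ?_)
      have h1 := hn p hp
      refine (Complex.norm_log_one_add_sub_self_le (by linarith)).trans ?_
      have h2 : (1 - ‖w n p‖)⁻¹ ≤ 2 := by
        rw [inv_le_comm₀ (by linarith) (by norm_num)]
        linarith
      nlinarith [sq_nonneg ‖w n p‖]
    simpa using hd.add hsum
  refine ((Complex.continuous_exp.tendsto c).comp hlog).congr' ?_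
  filter_upwards [hsmall] with n hn
  simp only [Function.comp]
  rw [Complex.exp_sum]
  refine Finset.prod_congr rfl fun p hp => Complex.exp_log fun h0 => ?_
  have : w n p = -1 := by linear_combination h0
  have h1 := hn p hp
  rw [this] at h1
  norm_num at h1

lemma tendsto_sqrt_LL : Tendsto (fun n => Real.sqrt (LL n)) atTop atTop :=
  Real.tendsto_sqrt_atTop.comp tendsto_LL

lemma tendsto_div_mul_sqrt_LL (t σ : ℝ) :
    Tendsto (fun n => t / (σ * Real.sqrt (LL n))) atTop (nhds 0) := by
  have h : Tendsto (fun n => t / σ / Real.sqrt (LL n)) atTop (nhds 0) :=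
    tendsto_const_nhds.div_atTop tendsto_sqrt_LL
  simpa only [div_div] using h

lemma tendsto_primeRecip_truncPoint_div {q : ℕ} (hq : 0 < q) :
    Tendsto (fun n => primeRecip q (truncPoint n) / LL n) atTop (nhds (1 / q.totient)) := by
  have : NeZero q := ⟨hq.ne'⟩
  obtain ⟨C, _, hC⟩ := primeRecip_asymp q
  have h1 : Tendsto (fun n => LL (truncPoint n) / LL n * (1 / q.totient)) atTop
      (nhds (1 / q.totient)) := by
    simpa using tendsto_LL_truncPoint_div.mul_const (1 / (q.totient : ℝ))
  have h2 : Tendsto (fun n => C / LL n) atTop (nhds 0) := tendsto_const_nhds.div_atTop tendsto_LL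
  have h3 : Tendsto (fun n => primeRecip q (truncPoint n) / LL n -
      LL (truncPoint n) / LL n * (1 / q.totient)) atTop (nhds 0) := by
    refine squeeze_zero_norm' ?_ h2
    filter_upwards [eventually_truncPoint, tendsto_LL.eventually_gt_atTop 0] with n hn hu
    have e : primeRecip q (truncPoint n) / LL n - LL (truncPoint n) / LL n * (1 / q.totient) =
        (primeRecip q (truncPoint n) - LL (truncPoint n) / q.totient) / LL n := by ring
    rw [e, Real.norm_eq_abs, abs_div, abs_of_pos hu]
    exact div_le_div_of_nonneg_right (hC _ hn.1) hu.le
  simpa using h3.add h1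

lemma tendsto_LL_mul_cos_sub_one {σ : ℝ} (hσ : 0 < σ) (t : ℝ) :
    Tendsto (fun n => LL n * (Real.cos (t / (σ * Real.sqrt (LL n))) - 1)) atTop
      (nhds (-(t ^ 2 / (2 * σ ^ 2)))) := by
  have h2 : Tendsto (fun n => (t / σ) ^ 4 * (5 / 96) / LL n) atTop (nhds 0) :=
    tendsto_const_nhds.div_atTop tendsto_LL
  have h3 : Tendsto (fun n => LL n * (Real.cos (t / (σ * Real.sqrt (LL n))) - 1) +
      t ^ 2 / (2 * σ ^ 2)) atTop (nhds 0) := by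
    refine squeeze_zero_norm' ?_ h2
    have hτ := (tendsto_div_mul_sqrt_LL t σ).norm
    rw [norm_zero] at hτ
    filter_upwards [tendsto_LL.eventually_gt_atTop 0, hτ.eventually_le_const one_pos] with n hu h1
    have hs : Real.sqrt (LL n) ≠ 0 := (Real.sqrt_pos.2 hu).ne'
    have hs2 : Real.sqrt (LL n) ^ 2 = LL n := Real.sq_sqrt hu.le
    set r := Real.sqrt (LL n) with hr
    have e : LL n * (Real.cos (t / (σ * r)) - 1) + t ^ 2 / (2 * σ ^ 2) =
        LL n * (Real.cos (t / (σ * r)) - (1 - (t / (σ * r)) ^ 2 / 2)) := by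
      rw [← hs2]
      field_simp
      ring
    rw [e, norm_mul, Real.norm_eq_abs, Real.norm_eq_abs, abs_of_pos hu]
    refine (mul_le_mul_of_nonneg_left (Real.cos_bound h1) hu.le).trans (le_of_eq ?_)
    rw [show |t / (σ * r)| ^ 4 = (t / (σ * r)) ^ 4 from Even.pow_abs (by decide) _, ← hs2]
    field_simp
  have h4 := h3.sub_const (t ^ 2 / (2 * σ ^ 2))
  rw [zero_sub] at h4
  exact h4.congr fun n => by ring

lemma tendsto_sum_localFactor_div {q q' v : ℕ} (hq : 0 < q) (hq' : 0 < q')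
    (hc : Nat.Coprime q q') (hv : q.totient = v) (hv' : q'.totient = v) {σ : ℝ} (hσ : 0 < σ)
    (hσ2 : σ ^ 2 = 2 / v - 2 / (v : ℝ) ^ 2) (t : ℝ) :
    Tendsto (fun n => ∑ p ∈ primesOne 1 (truncPoint n),
      localFactor q q' (t / (σ * Real.sqrt (LL n))) p / p) atTop
        (nhds (-(t : ℂ) ^ 2 / 2)) := by
  have hre : Tendsto (fun n => (primeRecip q (truncPoint n) + primeRecip q' (truncPoint n) -
      2 * primeRecip (q * q') (truncPoint n)) *
        (Real.cos (t / (σ * Real.sqrt (LL n))) - 1)) atTop (nhds (-(t ^ 2 / 2))) := by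
    have h1 := ((tendsto_primeRecip_truncPoint_div hq).add
      (tendsto_primeRecip_truncPoint_div hq')).sub
        ((tendsto_primeRecip_truncPoint_div (Nat.mul_pos hq hq')).const_mul 2)
    have h2 := h1.mul (tendsto_LL_mul_cos_sub_one hσ t)
    have e : ((1 : ℝ) / q.totient + 1 / q'.totient - 2 * (1 / (q * q').totient)) *
        -(t ^ 2 / (2 * σ ^ 2)) = -(t ^ 2 / 2) := by
      have : (1 : ℝ) / q.totient + 1 / q'.totient - 2 * (1 / (q * q').totient) = σ ^ 2 := by
        rw [Nat.totient_mul hc, hv, hv', hσ2]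
        push_cast
        ring
      rw [this]
      field_simp
    rw [e] at h2
    refine h2.congr' ?_
    filter_upwards [tendsto_LL.eventually_gt_atTop 0] with n hu
    field_simp
  have him : Tendsto (fun n => (primeRecip q (truncPoint n) - primeRecip q' (truncPoint n)) *
      Real.sin (t / (σ * Real.sqrt (LL n)))) atTop (nhds 0) := by
    have : NeZero q := ⟨hq.ne'⟩
    have : NeZero q' := ⟨hq'.ne'⟩
    obtain ⟨C, hC0, hC⟩ := primeRecip_asymp q
    obtain ⟨C', hC0', hC'⟩ := primeRecip_asymp q'
    have hb := (tendsto_div_mul_sqrt_LL t σ).norm.const_mul (C + C')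
    rw [norm_zero, mul_zero] at hb
    refine squeeze_zero_norm' ?_ hb
    filter_upwards [eventually_truncPoint] with n hn
    rw [norm_mul]
    refine mul_le_mul ?_ Real.abs_sin_le_abs (norm_nonneg _) (by positivity)
    have h1 := abs_le.1 (hC _ hn.1)
    have h2 := abs_le.1 (hC' _ hn.1)
    rw [hv] at h1
    rw [hv'] at h2
    rw [Real.norm_eq_abs, abs_le]
    constructor <;> linarith
  have h := ((Complex.continuous_ofReal.tendsto _).comp hre).add
    (((Complex.continuous_ofReal.tendsto _).comp him).mul_const Complex.I)
  have e : ((-(t ^ 2 / 2) : ℝ) : ℂ) + ((0 : ℝ) : ℂ) * Complex.I = -(t : ℂ) ^ 2 / 2 := by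
    push_cast
    ring
  rw [e] at h
  refine h.congr fun n => ?_
  rw [sum_localFactor_div hc]
  simp only [Function.comp]
  push_cast
  ring

lemma sum_primesOne_inv_sq_le (N : ℕ) : ∑ p ∈ primesOne 1 N, ((p : ℝ) ^ 2)⁻¹ ≤ 1 := by
  rcases Nat.eq_zero_or_pos N with rfl | hN
  · have : primesOne 1 0 = ∅ := by
      ext p
      rw [mem_primesOne]
      simp only [Finset.notMem_empty, iff_false]
      rintro ⟨h, hp, _⟩
      exact hp.ne_zero (by omega)
    simp [this]
  · have hsub : primesOne 1 N ⊆ Finset.Ioc 1 N := fun p hp => by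
      rw [mem_primesOne] at hp
      exact Finset.mem_Ioc.2 ⟨hp.2.1.one_lt, hp.1⟩
    refine (Finset.sum_le_sum_of_subset_of_nonneg hsub fun p _ _ => by positivity).trans ?_
    have h := sum_Ioc_inv_sq_le_sub (α := ℝ) one_ne_zero hN
    have : (0 : ℝ) ≤ (N : ℝ)⁻¹ := by positivity
    simp only [Nat.cast_one, inv_one] at h
    linarith

lemma norm_localFactor_div_le {q q' : ℕ} (τ : ℝ) (p : ℕ) :
    ‖localFactor q q' τ p / p‖ ≤ |τ| * (p : ℝ)⁻¹ := by
  rw [norm_div, Complex.norm_natCast, div_eq_mul_inv]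
  exact mul_le_mul_of_nonneg_right (norm_localFactor_le _ _ _ _) (by positivity)

lemma tendsto_prod_localFactor {q q' v : ℕ} (hq : 0 < q) (hq' : 0 < q')
    (hc : Nat.Coprime q q') (hv : q.totient = v) (hv' : q'.totient = v) {σ : ℝ} (hσ : 0 < σ)
    (hσ2 : σ ^ 2 = 2 / v - 2 / (v : ℝ) ^ 2) (t : ℝ) :
    Tendsto (fun n => ∏ p ∈ primesOne 1 (truncPoint n),
      (1 + localFactor q q' (t / (σ * Real.sqrt (LL n))) p / p)) atTop
        (nhds (Complex.exp (-(t : ℂ) ^ 2 / 2))) := by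
  refine tendsto_prod_one_add (tendsto_sum_localFactor_div hq hq' hc hv hv' hσ hσ2 t) ?_ ?_
  · have hτ := (tendsto_div_mul_sqrt_LL t σ).norm
    rw [norm_zero] at hτ
    filter_upwards [hτ.eventually_le_const (show (0 : ℝ) < 1 / 2 by norm_num)] with n hn p hp
    refine (norm_localFactor_div_le _ p).trans ?_
    refine (mul_le_of_le_one_right (abs_nonneg _) ?_).trans hn
    exact inv_le_one_of_one_le₀ (by exact_mod_cast (mem_primesOne.1 hp).2.1.one_le)
  · have hτ := (tendsto_div_mul_sqrt_LL t σ).pow 2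
    rw [zero_pow two_ne_zero] at hτ
    refine squeeze_zero (fun n => by positivity) (fun n => ?_) hτ
    calc _ ≤ ∑ p ∈ primesOne 1 (truncPoint n),
          (t / (σ * Real.sqrt (LL n))) ^ 2 * ((p : ℝ) ^ 2)⁻¹ := by
          refine Finset.sum_le_sum fun p _ => ?_
          refine (pow_le_pow_left₀ (norm_nonneg _) (norm_localFactor_div_le _ p) 2).trans ?_
          rw [mul_pow, sq_abs, inv_pow]
      _ ≤ _ := by
          rw [← Finset.mul_sum]
          exact mul_le_of_le_one_right (sq_nonneg _) (sum_primesOne_inv_sq_le _)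

lemma tendsto_mean_prod_sub {q q' : ℕ} (σ t : ℝ) :
    Tendsto (fun n : ℕ => (∑ m ∈ Finset.Icc 1 n, ∏ p ∈ primesOne 1 (truncPoint n),
        (1 + if p ∣ m then localFactor q q' (t / (σ * Real.sqrt (LL n))) p else 0)) / (n : ℂ) -
      ∏ p ∈ primesOne 1 (truncPoint n),
        (1 + localFactor q q' (t / (σ * Real.sqrt (LL n))) p / p)) atTop (nhds 0) := by
  obtain ⟨C, hC0, hC⟩ := primeRecip_asymp 1
  have hg : Tendsto (fun n : ℕ => Real.exp (C - LL n / 2)) atTop (nhds 0) := by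
    have h := tendsto_atBot_add_const_left atTop C
      (tendsto_neg_atTop_atBot.comp (tendsto_LL.atTop_div_const two_pos))
    exact Real.tendsto_exp_atBot.comp h
  refine squeeze_zero_norm' ?_ hg
  have hτ := (tendsto_div_mul_sqrt_LL t σ).norm
  rw [norm_zero] at hτ
  filter_upwards [eventually_truncPoint, tendsto_LL.eventually_ge_atTop 1,
    hτ.eventually_le_const (show (0 : ℝ) < 1 / 2 * (Real.exp 1)⁻¹ by positivity),
    eventually_ge_atTop 3] with n hN hu hsmall hn
  set τ := t / (σ * Real.sqrt (LL n)) with hτdef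
  have hn0 : (0 : ℝ) < n := by exact_mod_cast (by omega : 0 < n)
  have hL : 0 < Real.log n := Real.log_pos (by exact_mod_cast (by omega : 1 < n))
  have huL : LL n ≤ Real.log n := Real.log_le_self hL.le
  set δ := LL n / Real.log n with hδ
  have hδ0 : 0 ≤ δ := div_nonneg (by linarith) hL.le
  refine (norm_mean_prod_sub_le (primesOne 1 (truncPoint n))
    (fun p hp => (mem_primesOne.1 hp).2.1) (localFactor q q' τ) (by omega) hδ0
    ((div_le_one hL).2 huL)).trans ?_
  have hnδ : (n : ℝ) ^ (-δ) = Real.exp (-LL n) := by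
    rw [Real.rpow_def_of_pos hn0, hδ]
    congr 1
    field_simp
  have hM : primeRecip 1 (truncPoint n) ≤ LL n + C := by
    have h1 := (abs_le.1 (hC n hn)).2
    rw [Nat.totient_one, Nat.cast_one, div_one] at h1
    linarith [primeRecip_mono hN.2.1 1]
  have hsum : ∑ p ∈ primesOne 1 (truncPoint n), ‖localFactor q q' τ p‖ * (p : ℝ) ^ (δ - 1) ≤
      LL n / 2 + C := by
    calc _ ≤ ∑ p ∈ primesOne 1 (truncPoint n), (1 / 2 : ℝ) * (1 / p) := by
          refine Finset.sum_le_sum fun p hp => ?_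
          have hp' := (mem_primesOne.1 hp).2.1
          have hp0 : (0 : ℝ) < p := by exact_mod_cast hp'.pos
          have hpN : (p : ℝ) ≤ Real.exp (Real.log n / LL n) :=
            (Nat.le_floor_iff (Real.exp_pos _).le).1 (mem_primesOne.1 hp).1
          have hpδ : (p : ℝ) ^ δ ≤ Real.exp 1 := by
            refine (Real.rpow_le_rpow hp0.le hpN hδ0).trans (le_of_eq ?_)
            rw [← Real.exp_mul, hδ]
            congr 1
            field_simp
          have hz : ‖localFactor q q' τ p‖ ≤ 1 / 2 * (Real.exp 1)⁻¹ :=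
            (norm_localFactor_le _ _ _ _).trans hsmall
          rw [Real.rpow_sub_one hp0.ne']
          calc _ ≤ 1 / 2 * (Real.exp 1)⁻¹ * (Real.exp 1 / p) := by gcongr
            _ = _ := by field_simp
      _ = 1 / 2 * primeRecip 1 (truncPoint n) := by rw [← Finset.mul_sum, primeRecip_eq_sum]
      _ ≤ _ := by linarith
  rw [hnδ, ← Real.exp_add]
  exact Real.exp_le_exp.2 (by linarith)

/-- An Erdős–Kac theorem for `ω(m;q,1) - ω(m;q',1)`, stated with characteristic functions. -/
theorem tendsto_charFun_omegaQ_sub {q q' v : ℕ} (hq : 0 < q) (hq' : 0 < q')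
    (hc : Nat.Coprime q q') (hv : q.totient = v) (hv' : q'.totient = v) {σ : ℝ} (hσ : 0 < σ)
    (hσ2 : σ ^ 2 = 2 / v - 2 / (v : ℝ) ^ 2) {D : ℕ → ℝ}
    (hD : ∀ m, 1 ≤ m → |D m - ((omegaQ m q : ℝ) - omegaQ m q')| ≤ 2) (t : ℝ) :
    Tendsto (fun n : ℕ => (∑ m ∈ Finset.Icc 1 n,
      Complex.exp (t * ((D m / (σ * Real.sqrt (LL n)) : ℝ) : ℂ) * Complex.I)) / (n : ℂ)) atTop
        (nhds (Complex.exp (-(t : ℂ) ^ 2 / 2))) := by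
  obtain ⟨C, hC0, hC⟩ := primeRecip_asymp 1
  have hdiff : Tendsto (fun n : ℕ => (∑ m ∈ Finset.Icc 1 n,
      Complex.exp (((t / (σ * Real.sqrt (LL n))) * D m : ℝ) * Complex.I)) / (n : ℂ) -
      (∑ m ∈ Finset.Icc 1 n, ∏ p ∈ primesOne 1 (truncPoint n),
        (1 + if p ∣ m then localFactor q q' (t / (σ * Real.sqrt (LL n))) p else 0)) / (n : ℂ)) atTop
        (nhds 0) := by
    have hb := (tendsto_log_LL_div_sqrt (Real.log 2 + 2 + 2 * C)).const_mul (|t| / σ)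
    rw [mul_zero] at hb
    refine squeeze_zero_norm' ?_ hb
    filter_upwards [eventually_truncPoint, eventually_ge_atTop 3,
      tendsto_LL.eventually_gt_atTop 0] with n hN hn hu
    refine (norm_mean_exp_sub_mean_prod_le hD _ (by omega) hN.2.1).trans ?_
    have h1 := (abs_le.1 (hC n hn)).2
    have h2 := (abs_le.1 (hC _ hN.1)).1
    rw [Nat.totient_one, Nat.cast_one, div_one] at h1 h2
    have hs := Real.sqrt_pos.2 hu
    have e : |t / (σ * Real.sqrt (LL n))| = |t| / σ / Real.sqrt (LL n) := by
      rw [abs_div, abs_of_pos (mul_pos hσ hs), div_div]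
    rw [e, div_mul_eq_mul_div, mul_div_assoc]
    refine mul_le_mul_of_nonneg_left (div_le_div_of_nonneg_right ?_ hs.le) (by positivity)
    linarith [hN.2.2]
  have h := (hdiff.add (tendsto_mean_prod_sub (q := q) (q' := q') σ t)).add
    (tendsto_prod_localFactor hq hq' hc hv hv' hσ hσ2 t)
  rw [add_zero, zero_add] at h
  refine h.congr fun n => ?_
  rw [sub_add_sub_cancel, sub_add_cancel]
  congr 1
  refine Finset.sum_congr rfl fun m _ => ?_
  congr 2
  push_cast
  ring

lemma tendsto_cnt_congr {P Q : ℕ → ℕ → Prop} {l : ℝ}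
    (h : Negligible fun n m => ¬ (P n m ↔ Q n m))
    (hQ : Tendsto (fun n : ℕ => (cnt (Q n) n : ℝ) / n) atTop (nhds l)) :
    Tendsto (fun n : ℕ => (cnt (P n) n : ℝ) / n) atTop (nhds l) := by
  have key : ∀ (R S : ℕ → Prop) (n : ℕ),
      (cnt R n : ℝ) ≤ cnt S n + cnt (fun m => ¬ (R m ↔ S m)) n := by
    intro R S n
    exact_mod_cast (cnt_mono fun m _ _ hm => by tauto).trans
      (cnt_or_le S (fun m => ¬ (R m ↔ S m)) n)
  have h0 : Tendsto (fun n : ℕ => (cnt (P n) n : ℝ) / n - (cnt (Q n) n : ℝ) / n) atTop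
      (nhds 0) := by
    refine squeeze_zero_norm (fun n => ?_) h
    rw [← sub_div, Real.norm_eq_abs, abs_div, Nat.abs_cast]
    refine div_le_div_of_nonneg_right ?_ n.cast_nonneg
    have h1 := key (P n) (Q n) n
    have h2 := key (Q n) (P n) n
    simp only [iff_comm (a := Q n _)] at h2
    rw [abs_sub_le_iff]
    constructor <;> linarith
  simpa using h0.add hQ

lemma tendsto_cnt_of_neg {G : ℕ → ℝ} (hG : ∀ m, 0 ≤ G m) {σ x : ℝ} (hσ : 0 < σ) (hx : x < 0) :
    Tendsto (fun n : ℕ => (cnt (fun m => G m ≤ x * σ * Real.sqrt (LL n)) n : ℝ) / n) atTop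
      (nhds 0) := by
  refine tendsto_const_nhds.congr' ?_
  filter_upwards [tendsto_LL.eventually_gt_atTop 0] with n hn
  have hneg : x * σ * Real.sqrt (LL n) < 0 :=
    mul_neg_of_neg_of_pos (mul_neg_of_neg_of_pos hx hσ) (Real.sqrt_pos.2 hn)
  have : {m | 1 ≤ m ∧ m ≤ n ∧ G m ≤ x * σ * Real.sqrt (LL n)} = ∅ := by
    ext m
    simp only [Set.mem_ofPred_eq, Set.mem_empty_iff_false, iff_false, not_and, not_le]
    exact fun _ _ => hneg.trans_le (hG m)
  simp [cnt, this]

theorem tendsto_cnt_isInvCount {q q' d d' v : ℕ}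
    (hq : IsPrimePow q) (hq' : IsPrimePow q') (hc : Nat.Coprime q q')
    (hv : q.totient = v) (hv' : q'.totient = v)
    (huniq : ∀ Q, IsPrimePow Q → Q.totient = v → Q = q ∨ Q = q')
    (hd : ∀ Q, IsPrimePow Q → (Q ∣ d ↔ Q.totient < v ∨ Q = q))
    (hd' : ∀ Q, IsPrimePow Q → (Q ∣ d' ↔ Q.totient < v ∨ Q = q'))
    {J J' : ℕ → ℕ} (hJ : IsInvCount d J) (hJ' : IsInvCount d' J')
    {σ : ℝ} (hσ : 0 < σ) (hσ2 : σ ^ 2 = 2 / v - 2 / (v : ℝ) ^ 2) {x : ℝ} (hx : 0 ≤ x) :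
    Tendsto (fun n : ℕ => (cnt (fun m => (J m : ℝ) ≤ x * σ * Real.sqrt (LL n)) n : ℝ) / n)
        atTop (nhds (Phi x)) ∧
      Tendsto (fun n : ℕ =>
        (cnt (fun m => (J m : ℝ) + (J' m : ℝ) ≤ x * σ * Real.sqrt (LL n)) n : ℝ) / n)
        atTop (nhds (Phi x - Phi (-x))) := by
  have hqq : q ≠ q' := by
    rintro rfl
    exact hq.ne_one ((Nat.coprime_self q).1 hc)
  subst hv
  obtain ⟨D, hD, hbad⟩ := exists_diff_of_isInvCount hq hq' hqq hv' huniq hd hd' hJ hJ'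
  have hchar := tendsto_charFun_omegaQ_sub hq.pos hq'.pos hc rfl hv' hσ hσ2 hD
  constructor
  · rw [← gaussianReal_real_Iic]
    refine tendsto_cnt_congr (hbad.mono ?_) (tendsto_cnt_of_tendsto_charFun hchar
      (measurableSet_Iic (a := x)) (by rw [frontier_Iic]; exact Set.finite_singleton x))
    filter_upwards [tendsto_LL.eventually_gt_atTop 0] with n hn m _ _
    have hs := mul_pos hσ (Real.sqrt_pos.2 hn)
    refine mt fun h => ?_
    rw [h.1, Set.mem_Iic, div_le_iff₀ hs, max_le_iff, mul_assoc]
    exact and_iff_right (mul_nonneg hx hs.le)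
  · rw [← gaussianReal_real_Icc hx]
    refine tendsto_cnt_congr (hbad.mono ?_) (tendsto_cnt_of_tendsto_charFun hchar
      (measurableSet_Icc (a := -x) (b := x))
      (by rw [frontier_Icc (by linarith)]; exact Set.toFinite _))
    filter_upwards [tendsto_LL.eventually_gt_atTop 0] with n hn m _ _
    have hs := mul_pos hσ (Real.sqrt_pos.2 hn)
    refine mt fun h => ?_
    rw [h.2, Set.mem_Icc, div_le_iff₀ hs, le_div_iff₀ hs, abs_le, mul_assoc, neg_mul]

theorem statement13 (i : ℕ) (hi : 1 ≤ i) (hcard : (UFO i).ncard = 2)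
    (d d' : ℕ) (hne : d ≠ d') (hset : UFO i = {d, d'})
    (J J' : ℕ → ℕ) (hJ : IsInvCount d J) (hJ' : IsInvCount d' J') :
    ((∀ x : ℝ, 0 ≤ x → Filter.Tendsto
        (fun n : ℕ => ((cnt (fun m =>
            (J m : ℝ) ≤ x * sigSeq i * Real.sqrt (LL n)) n : ℝ)) / n)
        Filter.atTop (nhds (Phi x))) ∧
      (∀ x : ℝ, x < 0 → Filter.Tendsto
        (fun n : ℕ => ((cnt (fun m =>
            (J m : ℝ) ≤ x * sigSeq i * Real.sqrt (LL n)) n : ℝ)) / n)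
        Filter.atTop (nhds 0))) ∧
    ((∀ x : ℝ, 0 ≤ x → Filter.Tendsto
        (fun n : ℕ => ((cnt (fun m =>
            ((J m : ℝ) + (J' m : ℝ)) ≤ x * sigSeq i * Real.sqrt (LL n)) n : ℝ)) / n)
        Filter.atTop (nhds (Phi x - Phi (-x)))) ∧
      (∀ x : ℝ, x < 0 → Filter.Tendsto
        (fun n : ℕ => ((cnt (fun m =>
            ((J m : ℝ) + (J' m : ℝ)) ≤ x * sigSeq i * Real.sqrt (LL n)) n : ℝ)) / n)
        Filter.atTop (nhds 0))) := by
  obtain ⟨e, e', hU, -, -, hq, hq', hc, hφ, hv2, huniq, he, he'⟩ := UFO_structure hi hcard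
  have hv2' : (2 : ℝ) ≤ (qt i).totient := by exact_mod_cast hv2
  have harg : 1 / phiQ i + 1 / phiQ (i + 1) - 2 / (phiQ i * phiQ (i + 1)) =
      2 / ((qt i).totient : ℝ) - 2 / ((qt i).totient : ℝ) ^ 2 := by
    rw [phiQ, phiQ, hφ]
    ring
  have hpos : 0 < 2 / ((qt i).totient : ℝ) - 2 / ((qt i).totient : ℝ) ^ 2 := by
    rw [sub_pos]
    exact div_lt_div_of_pos_left two_pos (by linarith) (by nlinarith)
  have hσ : 0 < sigSeq i := by
    rw [sigSeq, harg]
    exact Real.sqrt_pos.2 hpos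
  have hσ2 : sigSeq i ^ 2 = 2 / ((qt i).totient : ℝ) - 2 / ((qt i).totient : ℝ) ^ 2 := by
    rw [sigSeq, harg, Real.sq_sqrt hpos.le]
  have main : ∀ x : ℝ, 0 ≤ x →
      Tendsto (fun n : ℕ => (cnt (fun m => (J m : ℝ) ≤ x * sigSeq i * Real.sqrt (LL n)) n : ℝ) / n)
        atTop (nhds (Phi x)) ∧
      Tendsto (fun n : ℕ =>
        (cnt (fun m => (J m : ℝ) + (J' m : ℝ) ≤ x * sigSeq i * Real.sqrt (LL n)) n : ℝ) / n)
        atTop (nhds (Phi x - Phi (-x))) := by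
    intro x hx
    rw [hU, Set.pair_eq_pair_iff] at hset
    rcases hset with ⟨rfl, rfl⟩ | ⟨rfl, rfl⟩
    · exact tendsto_cnt_isInvCount hq hq' hc rfl hφ huniq he he' hJ hJ' hσ hσ2 hx
    · exact tendsto_cnt_isInvCount hq' hq hc.symm hφ rfl (fun Q h h' => (huniq Q h h').symm)
        he' he hJ hJ' hσ hσ2 hx
  exact ⟨⟨fun x hx => (main x hx).1, fun x hx => tendsto_cnt_of_neg (fun m => by positivity) hσ hx⟩,
    fun x hx => (main x hx).2, fun x hx => tendsto_cnt_of_neg (fun m => by positivity) hσ hx⟩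

end
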